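/- arXiv:2001.09904 — 2 statements merged into one kernel-verified Lean document; each statement's English description precedes it below -/
import Mathlib

section
/- The first-order theory of nonabelian free groups does not have quantifier elimination down to boolean combinations of universal formulas: there exists an L_gp-formula φ(x̄) such that for no formula ψ(x̄) lying in the smallest class of formulas that contains all universal formulas and is closed under negation and finite conjunction does the free group F₂ of rank 2 satisfy ∀x̄ (φ(x̄) ↔ ψ(x̄)). -/
open FirstOrder

/-- Function symbols of the first-order language of groups: a constant for the identity,
a unary symbol for inversion, and a binary symbol for multiplication. -/
inductive GroupFn : ℕ → Type
  | one : GroupFn 0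
  | inv : GroupFn 1
  | mul : GroupFn 2

/-- The first-order language of groups. -/
def Lgp : Language := ⟨GroupFn, fun _ => Empty⟩

/-- Every group is an `Lgp`-structure in the natural way. -/
instance (priority := 100) groupLgpStructure (G : Type*) [Group G] : Lgp.Structure G where
  funMap {_} f x :=
    match f with
    | .one => 1
    | .inv => (x 0)⁻¹
    | .mul => x 0 * x 1
  RelMap {_} r := Empty.elim r

/-- A formula is universal if it is (syntactically) a block of universal quantifiers applied
to a quantifier-free formula. -/
def IsUniversalF {α : Type*} (φ : Lgp.Formula α) : Prop :=
  ∃ (n : ℕ) (ψ : Lgp.BoundedFormula α n), ψ.IsQF ∧ φ = ψ.alls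

/-- Boolean combinations of universal formulas: the smallest class of formulas containing all
universal formulas and closed under negation and finite conjunction. -/
inductive IsBoolCombOfUniversals {α : Type} : Lgp.Formula α → Prop
  | of_universal {φ : Lgp.Formula α} : IsUniversalF φ → IsBoolCombOfUniversals φ
  | not {φ : Lgp.Formula α} : IsBoolCombOfUniversals φ → IsBoolCombOfUniversals φ.not
  | and {φ ψ : Lgp.Formula α} : IsBoolCombOfUniversals φ → IsBoolCombOfUniversals ψ →
      IsBoolCombOfUniversals (φ ⊓ ψ)

namespace NoQE

open FirstOrder Language

/-- `L` respects the identity, inverses and all the products in `T`. -/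
structure PartHom {G H : Type} [Group G] [Group H] (T : Finset (G × G)) (L : G → H) : Prop where
  one : L 1 = 1
  inv : ∀ g, L g⁻¹ = (L g)⁻¹
  mul : ∀ p ∈ T, L (p.1 * p.2) = L p.1 * L p.2

theorem PartHom.mono {G H : Type} [Group G] [Group H] {T T' : Finset (G × G)} {L : G → H}
    (h : PartHom T L) (hT : T' ⊆ T) : PartHom T' L :=
  ⟨h.one, h.inv, fun p hp => h.mul p (hT hp)⟩

theorem realize_func_eq {G : Type} [Group G] {β : Type} (v : β → G) {l : ℕ} (f : Lgp.Functions l)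
    (ts : Fin l → Lgp.Term β) :
    (Term.func f ts).realize v = Structure.funMap f (fun i => (ts i).realize v) := rfl

theorem term_transfer {G : Type} [Group G] {β : Type} (t : Lgp.Term β) :
    ∃ N : ℕ, ∀ v : β → G, ∃ T : Finset (G × G), T.card ≤ N ∧
      ∀ (H : Type) [Group H] (L : G → H), PartHom T L → t.realize (L ∘ v) = L (t.realize v) := by
  classical
  induction t with
  | var i => exact ⟨0, fun v => ⟨∅, by simp, fun H _ L _ => rfl⟩⟩
  | @func l f ts ih =>
    change GroupFn l at f
    cases f with
    | one => exact ⟨0, fun v => ⟨∅, by simp, fun H _ L h => h.one.symm⟩⟩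
    | inv =>
      obtain ⟨N, hN⟩ := ih 0
      refine ⟨N, fun v => ?_⟩
      obtain ⟨T, hT, h⟩ := hN v
      refine ⟨T, hT, fun H _ L hL => ?_⟩
      change ((ts 0).realize (L ∘ v))⁻¹ = L (((ts 0).realize v)⁻¹)
      rw [h H L hL, hL.inv]
    | mul =>
      obtain ⟨N, hN⟩ := ih 0
      obtain ⟨M, hM⟩ := ih 1
      refine ⟨(N + M) + 1, fun v => ?_⟩
      obtain ⟨T, hT, h⟩ := hN v
      obtain ⟨T', hT', h'⟩ := hM v
      refine ⟨insert ((ts 0).realize v, (ts 1).realize v) (T ∪ T'), ?_, fun H _ L hL => ?_⟩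
      · refine (Finset.card_insert_le _ _).trans ?_
        have := Finset.card_union_le T T'
        omega
      change ((ts 0).realize (L ∘ v)) * ((ts 1).realize (L ∘ v)) =
        L ((ts 0).realize v * (ts 1).realize v)
      rw [h H L (hL.mono (by intro x hx; simp [hx])), h' H L (hL.mono (by intro x hx; simp [hx]))]
      exact (hL.mul ((ts 0).realize v, (ts 1).realize v) (by simp)).symm

theorem qf_transfer {G : Type} [Group G] {α : Type} {n : ℕ} (θ : Lgp.BoundedFormula α n)
    (hθ : θ.IsQF) :
    ∃ N : ℕ, ∀ (v : α → G) (xs : Fin n → G), ∃ T : Finset (G × G), T.card ≤ N ∧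
      ∀ (H : Type) [Group H] (L : G → H), PartHom T L → Function.Injective L →
        (θ.Realize v xs ↔ θ.Realize (L ∘ v) (L ∘ xs)) := by
  classical
  induction hθ with
  | falsum => exact ⟨0, fun v xs => ⟨∅, by simp, fun H _ L _ _ => Iff.rfl⟩⟩
  | of_isAtomic h =>
    cases h with
    | equal t₁ t₂ =>
      obtain ⟨N, hN⟩ := term_transfer (G := G) t₁
      obtain ⟨M, hM⟩ := term_transfer (G := G) t₂
      refine ⟨N + M, fun v xs => ?_⟩
      obtain ⟨T, hT, h⟩ := hN (Sum.elim v xs)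
      obtain ⟨T', hT', h'⟩ := hM (Sum.elim v xs)
      refine ⟨T ∪ T', ?_, fun H _ L hL hi => ?_⟩
      · have := Finset.card_union_le T T'
        omega
      rw [BoundedFormula.realize_bdEqual, BoundedFormula.realize_bdEqual, ← Sum.comp_elim,
        h H L (hL.mono (by intro x hx; simp [hx])), h' H L (hL.mono (by intro x hx; simp [hx])),
        hi.eq_iff]
    | rel R ts => exact Empty.elim R
  | imp h1 h2 ih1 ih2 =>
    obtain ⟨N, hN⟩ := ih1
    obtain ⟨M, hM⟩ := ih2
    refine ⟨N + M, fun v xs => ?_⟩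
    obtain ⟨T, hT, h⟩ := hN v xs
    obtain ⟨T', hT', h'⟩ := hM v xs
    refine ⟨T ∪ T', ?_, fun H _ L hL hi => ?_⟩
    · have := Finset.card_union_le T T'
      omega
    rw [BoundedFormula.realize_imp, BoundedFormula.realize_imp,
      h H L (hL.mono (by intro x hx; simp [hx])) hi, h' H L (hL.mono (by intro x hx; simp [hx])) hi]

theorem term_hom {G H : Type} [Group G] [Group H] {β : Type} (t : Lgp.Term β) (f : G →* H)
    (v : β → G) : t.realize (f ∘ v) = f (t.realize v) := by
  obtain ⟨N, hN⟩ := term_transfer (G := G) t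
  obtain ⟨T, -, hT⟩ := hN v
  exact hT H f ⟨map_one f, map_inv f, fun p _ => map_mul f _ _⟩

theorem qf_hom {G : Type} [Group G] {α : Type} {n : ℕ} (θ : Lgp.BoundedFormula α n)
    (hθ : θ.IsQF) (v : α → G) (xs : Fin n → G) :
    ∃ S : Finset G, (∀ s ∈ S, s ≠ 1) ∧
      ∀ (H : Type) [Group H] (f : G →* H), (∀ s ∈ S, f s ≠ 1) →
        (θ.Realize v xs ↔ θ.Realize (f ∘ v) (f ∘ xs)) := by
  classical
  induction hθ with
  | falsum => exact ⟨∅, by simp, fun H _ L _ => Iff.rfl⟩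
  | of_isAtomic h =>
    cases h with
    | equal t₁ t₂ =>
      by_cases h : t₁.realize (Sum.elim v xs) = t₂.realize (Sum.elim v xs)
      · refine ⟨∅, by simp, fun H _ f _ => ?_⟩
        rw [BoundedFormula.realize_bdEqual, BoundedFormula.realize_bdEqual, ← Sum.comp_elim,
          term_hom, term_hom, h]
        simp
      · refine ⟨{t₁.realize (Sum.elim v xs) * (t₂.realize (Sum.elim v xs))⁻¹}, ?_,
          fun H _ f hf => ?_⟩
        · simpa [mul_inv_eq_one] using h
        rw [BoundedFormula.realize_bdEqual, BoundedFormula.realize_bdEqual, ← Sum.comp_elim,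
          term_hom, term_hom]
        simp [mul_inv_eq_one] at hf
        simp [h, hf]
    | rel R ts => exact Empty.elim R
  | imp h1 h2 ih1 ih2 =>
    obtain ⟨S, hS, h⟩ := ih1
    obtain ⟨S', hS', h'⟩ := ih2
    refine ⟨S ∪ S', ?_, fun H _ f hf => ?_⟩
    · intro s hs
      rcases Finset.mem_union.1 hs with hs | hs
      exacts [hS s hs, hS' s hs]
    rw [BoundedFormula.realize_imp, BoundedFormula.realize_imp,
      h H f (fun s hs => hf s (by simp [hs])), h' H f (fun s hs => hf s (by simp [hs]))]

theorem bool_dep {G : Type} [Group G] {α : Type} {ψ : Lgp.Formula α}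
    (h : IsBoolCombOfUniversals ψ) :
    ∃ Us : List (Lgp.Formula α), (∀ θ ∈ Us, IsUniversalF θ) ∧ ∀ v w : α → G,
      (∀ θ ∈ Us, (θ.Realize v ↔ θ.Realize w)) → (ψ.Realize v ↔ ψ.Realize w) := by
  induction h with
  | @of_universal φ h => exact ⟨[φ], by simpa using h, fun v w h => h φ (by simp)⟩
  | not h ih =>
    obtain ⟨Us, h1, h2⟩ := ih
    exact ⟨Us, h1, fun v w h => by rw [Formula.realize_not, Formula.realize_not, h2 v w h]⟩
  | and h h' ih ih' =>
    obtain ⟨Us, h1, h2⟩ := ih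
    obtain ⟨Us', h1', h2'⟩ := ih'
    refine ⟨Us ++ Us', ?_, fun v w h => ?_⟩
    · intro θ hθ
      rcases List.mem_append.1 hθ with hθ | hθ
      exacts [h1 θ hθ, h1' θ hθ]
    · rw [Formula.realize_inf, Formula.realize_inf, h2 v w (fun θ hθ => h θ (by simp [hθ])),
        h2' v w (fun θ hθ => h θ (by simp [hθ]))]

/-- Eventual constancy for finite lists of antitone sequences of propositions. -/
theorem exists_stable {X : Type} (Us : List X) (P : X → ℕ → Prop)
    (hP : ∀ θ ∈ Us, ∀ i, P θ (i + 1) → P θ i) :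
    ∃ I, ∀ θ ∈ Us, (P θ I ↔ P θ (I + 1)) := by
  suffices h : ∃ I, ∀ i ≥ I, ∀ θ ∈ Us, (P θ i ↔ P θ (i + 1)) by
    obtain ⟨I, hI⟩ := h
    exact ⟨I, hI I le_rfl⟩
  induction Us with
  | nil => exact ⟨0, by simp⟩
  | cons θ Us ih =>
    obtain ⟨I, hI⟩ := ih (fun θ' h => hP θ' (by simp [h]))
    have hmono : ∀ i d, P θ (i + d) → P θ i := by
      intro i d
      induction d with
      | zero => exact id
      | succ d ih => exact fun h => ih (hP θ (by simp) _ h)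
    have : ∃ J, ∀ i ≥ J, (P θ i ↔ P θ (i + 1)) := by
      by_cases h : ∀ i, P θ i
      · exact ⟨0, fun i _ => by simp [h]⟩
      · push Not at h
        obtain ⟨J, hJ⟩ := h
        have hJ' : ∀ i ≥ J, ¬ P θ i := fun i hi h => hJ (hmono J (i - J) (by
          rwa [Nat.add_sub_cancel' hi]))
        exact ⟨J, fun i hi => by simp [hJ' i hi, hJ' (i + 1) (by omega)]⟩
    obtain ⟨J, hJ⟩ := this
    refine ⟨max I J, fun i hi θ' h => ?_⟩
    rcases List.mem_cons.1 h with rfl | h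
    · exact hJ i (le_of_max_le_right hi)
    · exact hI i (le_of_max_le_left hi) θ' h

/-- The formula. -/
def mulT {β : Type} (s t : Lgp.Term β) : Lgp.Term β := Term.func (L := Lgp) (l := 2) GroupFn.mul ![s, t]

theorem realize_mulT {G : Type} [Group G] {β : Type} (s t : Lgp.Term β) (v : β → G) :
    (mulT s t).realize v = s.realize v * t.realize v := rfl

def notSq : Lgp.BoundedFormula (Fin 1) 5 :=
  ((Term.bdEqual (&0 : Lgp.Term (Fin 1 ⊕ Fin 5))
    (mulT (mulT (mulT (mulT &1 &1) (mulT &2 &2)) (mulT &3 &3)) (mulT &4 &4))).not)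

def phi : Lgp.Formula (Fin 1) :=
  BoundedFormula.ex (n := 0)
    ((Term.bdEqual (mulT (Term.var (Sum.inl 0)) &0 : Lgp.Term (Fin 1 ⊕ Fin 1))
      (mulT &0 (Term.var (Sum.inl 0)))) ⊓ notSq.all.all.all.all)

theorem realize_phi {G : Type} [Group G] (v : Fin 1 → G) :
    phi.Realize v ↔ ∃ y : G, v 0 * y = y * v 0 ∧
      ∀ z1 z2 z3 z4 : G, y ≠ z1 * z1 * (z2 * z2) * (z3 * z3) * (z4 * z4) := by
  rw [phi, Formula.Realize, BoundedFormula.realize_ex]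
  refine exists_congr fun y => ?_
  rw [BoundedFormula.realize_inf]
  refine and_congr Iff.rfl ?_
  rfl

end NoQE

namespace NoQE

abbrev F2 := FreeGroup (Fin 2)
abbrev F3 := FreeGroup (Fin 3)

def ga : F2 := FreeGroup.of 0
def gb : F2 := FreeGroup.of 1
def ha : F3 := FreeGroup.of 0
def hb : F3 := FreeGroup.of 1
def ht : F3 := FreeGroup.of 2

/-- `c_n = ∏_{k=1}^n a^6 b^{6k}` -/
def cn (n : ℕ) : F2 := ((List.range n).map fun k => ga ^ 6 * gb ^ (6 * (k + 1))).prod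

def rhoN (n : ℕ) : F2 := ga * ga * (gb * gb) * ((cn n)⁻¹ * (cn n)⁻¹)
def rho : F3 := ha * ha * (hb * hb) * (ht⁻¹ * ht⁻¹)

def piN (n : ℕ) : F3 →* F2 := FreeGroup.lift ![ga, gb, cn n]

theorem piN_ha (n : ℕ) : piN n ha = ga := by simp [piN, ha]
theorem piN_hb (n : ℕ) : piN n hb = gb := by simp [piN, hb]
theorem piN_ht (n : ℕ) : piN n ht = cn n := by simp [piN, ht]
theorem piN_rho (n : ℕ) : piN n rho = rhoN n := by
  simp only [rho, map_mul, map_inv, piN_ha, piN_hb, piN_ht, rhoN]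

theorem main_of
    (up : ∀ θ : Lgp.Formula (Fin 1), IsUniversalF θ → ∀ m : ℕ, ∃ n₀, ∀ n ≥ n₀,
      θ.Realize (fun _ => ga ^ (2 * m)) → θ.Realize (fun _ => rhoN n ^ m))
    (down : ∀ θ : Lgp.Formula (Fin 1), IsUniversalF θ → ∀ m : ℕ, ∃ n₀, ∀ n ≥ n₀,
      θ.Realize (fun _ => rhoN n ^ m) → θ.Realize (fun _ => ga ^ m))
    (phi1 : ∀ m : ℕ, phi.Realize (fun _ => ga ^ m))
    (phi2 : ∀ n m : ℕ, m ≠ 0 → ¬ phi.Realize (fun _ => rhoN n ^ m)) :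
    ∃ (k : ℕ) (φ : Lgp.Formula (Fin k)),
      ∀ ψ : Lgp.Formula (Fin k), IsBoolCombOfUniversals ψ →
        ¬ ∀ v : Fin k → FreeGroup (Fin 2), (φ.Realize v ↔ ψ.Realize v) := by
  refine ⟨1, phi, fun ψ hψ H => ?_⟩
  obtain ⟨Us, hUs, hdep⟩ := bool_dep (G := F2) hψ
  obtain ⟨I, hI⟩ := exists_stable Us (fun θ i => θ.Realize (fun _ => ga ^ (2 ^ i))) (by
    intro θ hθ i h
    obtain ⟨n₀, h0⟩ := up θ (hUs θ hθ) (2 ^ i)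
    obtain ⟨n₁, h1⟩ := down θ (hUs θ hθ) (2 ^ i)
    apply h1 (max n₀ n₁) (le_max_right _ _)
    apply h0 (max n₀ n₁) (le_max_left _ _)
    rwa [pow_succ', ] at h)
  have : ∃ n₀, ∀ n ≥ n₀, ∀ θ ∈ Us, (θ.Realize (fun _ => ga ^ (2 ^ I)) ↔
      θ.Realize (fun _ => rhoN n ^ (2 ^ I))) := by
    clear hdep
    induction Us with
    | nil => exact ⟨0, by simp⟩
    | cons θ Us ih =>
      obtain ⟨n₀, h0⟩ := up θ (hUs θ (by simp)) (2 ^ I)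
      obtain ⟨n₁, h1⟩ := down θ (hUs θ (by simp)) (2 ^ I)
      obtain ⟨n₂, h2⟩ := ih (fun θ' h => hUs θ' (by simp [h])) (fun θ' h => hI θ' (by simp [h]))
      refine ⟨max n₀ (max n₁ n₂), fun n hn θ' h => ?_⟩
      simp only [ge_iff_le, max_le_iff] at hn
      rcases List.mem_cons.1 h with rfl | h
      · refine ⟨fun h => h0 n hn.1 ?_, h1 n hn.2.1⟩
        have := (hI θ' (by simp)).1 h
        rwa [pow_succ'] at this
      · exact h2 n hn.2.2 θ' h
  obtain ⟨n, hn⟩ := this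
  have h1 := hdep _ _ (hn n le_rfl)
  rw [← H, ← H] at h1
  exact phi2 n (2 ^ I) (by positivity) (h1.1 (phi1 _))

theorem phi1 (m : ℕ) : phi.Realize (fun _ => ga ^ m) := by
  rw [realize_phi]
  refine ⟨ga, (Commute.pow_self ga m).eq, fun z1 z2 z3 z4 h => ?_⟩
  let f : F2 →* Multiplicative ℤ := FreeGroup.lift ![Multiplicative.ofAdd 1, 1]
  have := congrArg (fun x => (f x).toAdd) h
  simp only [map_mul, toAdd_mul] at this
  have h1 : (f ga).toAdd = 1 := by simp [f, ga]
  omega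

/-! ### Commuting elements -/

theorem cyclic_of_comm {F : Type} [Group F] [IsFreeGroup F] (hc : ∀ x y : F, x * y = y * x) :
    IsCyclic F := by
  let e := IsFreeGroup.toFreeGroup F
  have : Subsingleton (IsFreeGroup.Generators F) := by
    constructor
    intro i j
    by_contra hij
    classical
    have h := hc (e.symm (FreeGroup.of i)) (e.symm (FreeGroup.of j))
    rw [← map_mul, ← map_mul, e.symm.injective.eq_iff] at h
    let f : FreeGroup (IsFreeGroup.Generators F) →* Equiv.Perm (Fin 3) :=
      FreeGroup.lift fun k => if k = i then Equiv.swap 0 1 else Equiv.swap 1 2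
    have h2 := congrArg f h
    simp only [map_mul, f, FreeGroup.lift_apply_of, if_true, if_neg (Ne.symm hij)] at h2
    revert h2
    decide
  rcases isEmpty_or_nonempty (IsFreeGroup.Generators F) with h | ⟨⟨i⟩⟩
  · have : Subsingleton F := e.injective.subsingleton
    infer_instance
  · have : Unique (IsFreeGroup.Generators F) := ⟨⟨i⟩, fun j => Subsingleton.elim _ _⟩
    exact isCyclic_of_surjective e.symm e.symm.surjective

theorem common_root {α : Type} {x y : FreeGroup α} (h : x * y = y * x) :
    ∃ (z : FreeGroup α) (i j : ℤ), x = z ^ i ∧ y = z ^ j := by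
  let K : Subgroup (FreeGroup α) := Subgroup.closure {x, y}
  have hK : ∀ u v : K, u * v = v * u := by
    have := Subgroup.isMulCommutative_closure (k := ({x, y} : Set (FreeGroup α))) (by
      rintro u (rfl | rfl) v (rfl | rfl) <;> simp [h])
    exact fun u v => mul_comm' u v
  have := cyclic_of_comm hK
  obtain ⟨z, hz⟩ := this.exists_generator
  obtain ⟨i, hi⟩ := hz ⟨x, Subgroup.subset_closure (by simp)⟩
  obtain ⟨j, hj⟩ := hz ⟨y, Subgroup.subset_closure (by simp)⟩
  exact ⟨z, i, j, by simpa using (congrArg Subtype.val hi).symm,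
    by simpa using (congrArg Subtype.val hj).symm⟩

theorem comm_of_pow {α : Type} {x y : FreeGroup α} {m : ℕ} (hm : m ≠ 0)
    (h : x ^ m * y = y * x ^ m) : x * y = y * x := by
  have h1 : (y * x * y⁻¹) ^ m = x ^ m := by
    rw [conj_pow, ← h]; simp
  have := pow_left_injective hm h1
  rw [mul_inv_eq_iff_eq_mul] at this
  exact this.symm

/-- hom to the alternating group on four points -/
def toA4 : F2 →* Equiv.Perm (Fin 4) :=
  FreeGroup.lift ![Equiv.swap 0 1 * Equiv.swap 1 2, Equiv.swap 0 1 * Equiv.swap 1 3]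

theorem sign_toA4 (x : F2) : Equiv.Perm.sign (toA4 x) = 1 := by
  have : Equiv.Perm.sign.comp toA4 = 1 := by
    ext i
    fin_cases i <;> simp [toA4]
  exact DFunLike.congr_fun this x

theorem sq_A4' : ∀ x : Equiv.Perm (Fin 4), Equiv.Perm.sign x = 1 →
    x * x ≠ (Equiv.swap 0 1 * Equiv.swap 1 2) * (Equiv.swap 0 1 * Equiv.swap 1 2) *
      ((Equiv.swap 0 1 * Equiv.swap 1 3) * (Equiv.swap 0 1 * Equiv.swap 1 3)) := by
  decide

theorem sq_A4 (x : F2) : toA4 (x * x) ≠ toA4 (ga * ga * (gb * gb)) := by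
  have := sq_A4' (toA4 x) (sign_toA4 x)
  simpa [toA4, ga, gb] using this

theorem toA4_cn (n : ℕ) : toA4 (cn n) = 1 := by
  have ha : (toA4 ga) ^ 6 = 1 := by
    simp only [toA4, ga, FreeGroup.lift_apply_of]; decide
  have hb : (toA4 gb) ^ 6 = 1 := by
    simp only [toA4, gb, FreeGroup.lift_apply_of]; decide
  rw [cn, map_list_prod]
  apply List.prod_eq_one
  intro x hx
  simp only [List.map_map, List.mem_map, Function.comp] at hx
  obtain ⟨k, -, rfl⟩ := hx
  rw [map_mul, map_pow, map_pow, pow_mul, ha, hb]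
  simp

theorem phi2 (n m : ℕ) (hm : m ≠ 0) : ¬ phi.Realize (fun _ => rhoN n ^ m) := by
  rw [realize_phi]
  rintro ⟨y, hy, h⟩
  have hy := comm_of_pow hm hy
  obtain ⟨z, i, j, hi, hj⟩ := common_root hy
  rcases Int.even_or_odd' j with ⟨l, hl | hl⟩
  · apply h (z ^ l) 1 1 1
    rw [hj, hl, two_mul, zpow_add]; simp
  rcases Int.even_or_odd' i with ⟨k, hk | hk⟩
  · apply sq_A4 (z ^ k)
    rw [← zpow_add, ← two_mul, ← hk, ← hi, rhoN, map_mul]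
    nth_rewrite 2 [map_mul]
    rw [map_inv, toA4_cn]; simp
  · apply h ga gb (cn n)⁻¹ (z ^ (l - k))
    change y = rhoN n * _
    rw [hi, hj, hk, hl, ← zpow_add, ← zpow_add]
    congr 1; ring

end NoQE

namespace NoQE

open FirstOrder Language

theorem lift_pi (w : F3) : ∃ N : ℕ, ∀ n : ℕ, ∃ T : Finset (F2 × F2), T.card ≤ N ∧
    ∀ L : F2 → F3, PartHom T L → L ga = ha → L gb = hb → L (cn n) = ht →
      L (piN n w) = w := by
  classical
  induction w using FreeGroup.induction_on with
  | C1 => exact ⟨0, fun n => ⟨∅, by simp, fun L hL _ _ _ => by simpa using hL.one⟩⟩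
  | of i =>
    refine ⟨0, fun n => ⟨∅, by simp, fun L hL h0 h1 h2 => ?_⟩⟩
    fin_cases i
    · change L (piN n ha) = ha
      rw [piN_ha, h0]
    · change L (piN n hb) = hb
      rw [piN_hb, h1]
    · change L (piN n ht) = ht
      rw [piN_ht, h2]
  | inv_of i ih =>
    obtain ⟨N, hN⟩ := ih
    refine ⟨N, fun n => ?_⟩
    obtain ⟨T, hT, h⟩ := hN n
    refine ⟨T, hT, fun L hL h0 h1 h2 => ?_⟩
    rw [map_inv, hL.inv, h L hL h0 h1 h2]
  | mul x y ih ih' =>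
    obtain ⟨N, hN⟩ := ih
    obtain ⟨N', hN'⟩ := ih'
    refine ⟨N + N' + 1, fun n => ?_⟩
    obtain ⟨T, hT, h⟩ := hN n
    obtain ⟨T', hT', h'⟩ := hN' n
    refine ⟨insert (piN n x, piN n y) (T ∪ T'), ?_, fun L hL h0 h1 h2 => ?_⟩
    · refine (Finset.card_insert_le _ _).trans ?_
      have := Finset.card_union_le T T'
      omega
    rw [map_mul, hL.mul (piN n x, piN n y) (by simp),
      h L (hL.mono (by intro x hx; simp [hx])) h0 h1 h2,
      h' L (hL.mono (by intro x hx; simp [hx])) h0 h1 h2]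

/-- The lifting property (proved below). -/
def LiftProp : Prop := ∀ N : ℕ, ∃ n₀, ∀ n ≥ n₀, ∀ T : Finset (F2 × F2), T.card ≤ N →
  ∃ L : F2 → F3, PartHom T L ∧ Function.Injective L ∧ L ga = ha ∧ L gb = hb ∧ L (cn n) = ht

theorem pi_ne_one (M : LiftProp) {w : F3} (hw : w ≠ 1) : ∃ n₀, ∀ n ≥ n₀, piN n w ≠ 1 := by
  obtain ⟨N, hN⟩ := lift_pi w
  obtain ⟨n₀, h0⟩ := M N
  refine ⟨n₀, fun n hn h1 => hw ?_⟩
  obtain ⟨T, hT, h⟩ := hN n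
  obtain ⟨L, hL, -, l1, l2, l3⟩ := h0 n hn T hT
  rw [← h L hL l1 l2 l3, h1, hL.one]

theorem pi_ne_one' (M : LiftProp) (S : Finset F3) (hS : ∀ s ∈ S, s ≠ 1) :
    ∃ n₀, ∀ n ≥ n₀, ∀ s ∈ S, piN n s ≠ 1 := by
  classical
  induction S using Finset.induction_on with
  | empty => exact ⟨0, by simp⟩
  | insert w S hw ih =>
    obtain ⟨n₀, h0⟩ := ih (fun s hs => hS s (by simp [hs]))
    obtain ⟨n₁, h1⟩ := pi_ne_one M (hS w (by simp))
    refine ⟨max n₀ n₁, fun n hn s hs => ?_⟩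
    rcases Finset.mem_insert.1 hs with rfl | hs
    · exact h1 n (le_of_max_le_right hn)
    · exact h0 n (le_of_max_le_left hn) s hs

theorem down_of (M : LiftProp) (hinj : ∃ g : F2 →* F3, Function.Injective g ∧ g ga = rho)
    (θ : Lgp.Formula (Fin 1)) (hθ : IsUniversalF θ) (m : ℕ) : ∃ n₀, ∀ n ≥ n₀,
      θ.Realize (fun _ => rhoN n ^ m) → θ.Realize (fun _ => ga ^ m) := by
  obtain ⟨l, θ₀, hqf, rfl⟩ := hθ
  simp only [BoundedFormula.realize_alls]
  by_cases hall : ∀ xs : Fin l → F2, θ₀.Realize (fun _ => ga ^ m) xs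
  · exact ⟨0, fun n _ _ => hall⟩
  push Not at hall
  obtain ⟨xs, hxs⟩ := hall
  obtain ⟨g, hg, hgr⟩ := hinj
  obtain ⟨S, hS, h⟩ := qf_hom θ₀ hqf (fun _ => ga ^ m) xs
  rw [h F3 g (fun s hs => by rw [Ne, map_eq_one_iff g hg]; exact hS s hs)] at hxs
  obtain ⟨S', hS', h'⟩ := qf_hom θ₀ hqf (g ∘ fun _ => ga ^ m) (g ∘ xs)
  obtain ⟨n₀, h0⟩ := pi_ne_one' M S' hS'
  refine ⟨n₀, fun n hn hr => ?_⟩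
  rw [h' F2 (piN n) (h0 n hn)] at hxs
  refine absurd (hr (piN n ∘ g ∘ xs)) ?_
  convert hxs using 2
  funext x
  simp [hgr, piN_rho]

theorem up_of (M : LiftProp) (disc : ∀ S : Finset F3, (∀ s ∈ S, s ≠ 1) →
      ∃ f : F3 →* F2, f rho = ga ^ 2 ∧ ∀ s ∈ S, f s ≠ 1)
    (θ : Lgp.Formula (Fin 1)) (hθ : IsUniversalF θ) (m : ℕ) : ∃ n₀, ∀ n ≥ n₀,
      θ.Realize (fun _ => ga ^ (2 * m)) → θ.Realize (fun _ => rhoN n ^ m) := by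
  classical
  obtain ⟨l, θ₀, hqf, rfl⟩ := hθ
  simp only [BoundedFormula.realize_alls]
  obtain ⟨N, hN⟩ := qf_transfer (G := F2) θ₀ hqf
  obtain ⟨N', hN'⟩ := lift_pi (rho ^ m)
  obtain ⟨n₀, h0⟩ := M (N + N')
  refine ⟨n₀, fun n hn hr xs => ?_⟩
  by_contra hxs
  obtain ⟨T, hT, h⟩ := hN (fun _ => rhoN n ^ m) xs
  obtain ⟨T', hT', h'⟩ := hN' n
  obtain ⟨L, hL, hLi, l1, l2, l3⟩ := h0 n hn (T ∪ T') ((Finset.card_union_le _ _).trans (by omega))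
  rw [h F3 L (hL.mono Finset.subset_union_left) hLi] at hxs
  have hr' := h' L (hL.mono Finset.subset_union_right) l1 l2 l3
  rw [map_pow, piN_rho] at hr'
  obtain ⟨S, hS, hS'⟩ := qf_hom θ₀ hqf (L ∘ fun _ => rhoN n ^ m) (L ∘ xs)
  obtain ⟨f, hf, hf'⟩ := disc S hS
  rw [hS' F2 f hf'] at hxs
  refine absurd (hr (f ∘ L ∘ xs)) ?_
  convert hxs using 2
  funext x
  simp [hr', hf, pow_mul]

end NoQE

namespace NoQE

open Monoid

section Syllables

variable {ι : Type} {M : ι → Type} [∀ i, Group (M i)] {G : Type} [Group G]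

def Red (l : List (Σ i, M i)) : Prop :=
  (∀ x ∈ l, x.2 ≠ 1) ∧ l.IsChain (fun x y => x.1 ≠ y.1)

def lprod (l : List (Σ i, M i)) : CoprodI M := (l.map fun x => CoprodI.of x.2).prod

def tprod (θ : ∀ i, M i → G) (l : List (Σ i, M i)) : G := (l.map fun x => θ x.1 x.2).prod

variable [DecidableEq ι] [∀ i, DecidableEq (M i)]

def LL (θ : ∀ i, M i → G) (g : CoprodI M) : G := tprod θ (CoprodI.Word.equiv g).toList

theorem LL_lprod (θ : ∀ i, M i → G) {l : List (Σ i, M i)} (h : Red l) :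
    LL θ (lprod l) = tprod θ l := by
  let w : CoprodI.Word M := ⟨l, fun x hx => h.1 x hx, h.2⟩
  have : CoprodI.Word.equiv (lprod l) = w := (CoprodI.Word.equiv (M := M)).apply_symm_apply w
  rw [LL, this]

theorem exists_red (g : CoprodI M) : ∃ l, Red l ∧ lprod l = g :=
  ⟨(CoprodI.Word.equiv g).toList, ⟨fun x hx => (CoprodI.Word.equiv g).ne_one x hx,
    (CoprodI.Word.equiv g).chain_ne⟩, (CoprodI.Word.equiv (M := M)).symm_apply_apply g⟩

theorem LL_one (θ : ∀ i, M i → G) : LL θ 1 = 1 := by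
  have : LL θ (lprod []) = tprod θ [] := LL_lprod θ ⟨by simp, by simp⟩
  simpa [lprod, tprod] using this

theorem lprod_append (l l' : List (Σ i, M i)) : lprod (l ++ l') = lprod l * lprod l' := by
  simp [lprod]

theorem tprod_append (θ : ∀ i, M i → G) (l l' : List (Σ i, M i)) :
    tprod θ (l ++ l') = tprod θ l * tprod θ l' := by
  simp [tprod]

theorem LL_inv (θ : ∀ i, M i → G) (hθ : ∀ i x, θ i x⁻¹ = (θ i x)⁻¹) (g : CoprodI M) :
    LL θ g⁻¹ = (LL θ g)⁻¹ := by
  obtain ⟨l, hl, rfl⟩ := exists_red g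
  let f : (Σ i, M i) → Σ i, M i := fun x => ⟨x.1, x.2⁻¹⟩
  have hr : Red (l.map f).reverse := by
    constructor
    · intro x hx
      simp only [List.mem_reverse, List.mem_map] at hx
      obtain ⟨y, hy, rfl⟩ := hx
      simpa [f] using hl.1 y hy
    · rw [List.isChain_reverse, List.isChain_map]
      exact hl.2.imp fun x y h => h.symm
  have h1 : (lprod l)⁻¹ = lprod (l.map f).reverse := by
    rw [lprod, lprod, List.prod_inv_reverse, List.map_reverse, List.map_map, List.map_map]
    congr 2
  have h2 : (tprod θ l)⁻¹ = tprod θ (l.map f).reverse := by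
    rw [tprod, tprod, List.prod_inv_reverse, List.map_reverse, List.map_map, List.map_map]
    congr 2
    apply List.map_congr_left
    intro x hx
    simp [f, hθ]
  rw [h1, LL_lprod θ hr, LL_lprod θ hl, h2]

theorem key_lists [Nonempty ι] (l₁ : List (Σ i, M i)) : ∀ l₂ : List (Σ i, M i), Red l₁ → Red l₂ →
    ∃ (i : ι) (x y : M i), ∀ θ : ∀ i, M i → G, (∀ i x, θ i x⁻¹ = (θ i x)⁻¹) →
      θ i (x * y) = θ i x * θ i y → LL θ (lprod l₁ * lprod l₂) = tprod θ l₁ * tprod θ l₂ := by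
  induction l₁ using List.reverseRecOn with
  | nil =>
    intro l₂ _ h2
    refine ⟨Classical.arbitrary ι, 1, 1, fun θ hθ _ => ?_⟩
    simpa [lprod, tprod] using LL_lprod θ h2
  | append_singleton p u ih =>
    intro l₂ h1 h2
    cases l₂ with
    | nil =>
      refine ⟨Classical.arbitrary ι, 1, 1, fun θ hθ _ => ?_⟩
      simpa [lprod, tprod] using LL_lprod θ h1
    | cons v s =>
      have hp : Red p := ⟨fun x hx => h1.1 x (by simp [hx]), (List.isChain_append.1 h1.2).1⟩
      have hs : Red s := ⟨fun x hx => h2.1 x (by simp [hx]), h2.2.tail⟩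
      obtain ⟨i, x⟩ := u
      obtain ⟨j, y⟩ := v
      by_cases hij : i = j
      · subst hij
        by_cases hxy : x * y = 1
        · obtain ⟨k, x', y', h⟩ := ih s hp hs
          refine ⟨k, x', y', fun θ hθ hm => ?_⟩
          have h3 : lprod (p ++ [⟨i, x⟩]) * lprod (⟨i, y⟩ :: s) = lprod p * lprod s := by
            have : (CoprodI.of x : CoprodI M) * CoprodI.of y = 1 := by rw [← map_mul, hxy, map_one]
            simp only [lprod, List.map_append, List.prod_append, List.map_cons, List.prod_cons,
              List.map_nil, List.prod_nil, mul_one]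
            rw [mul_assoc, ← mul_assoc (CoprodI.of x), this, one_mul]
          have h4 : tprod θ (p ++ [⟨i, x⟩]) * tprod θ (⟨i, y⟩ :: s) = tprod θ p * tprod θ s := by
            have : θ i x * θ i y = 1 := by
              rw [← inv_eq_of_mul_eq_one_right hxy, hθ, mul_inv_cancel]
            simp only [tprod, List.map_append, List.prod_append, List.map_cons, List.prod_cons,
              List.map_nil, List.prod_nil, mul_one]
            rw [mul_assoc, ← mul_assoc (θ i x), this, one_mul]
          rw [h3, h4, h θ hθ hm]
        · refine ⟨i, x, y, fun θ hθ hm => ?_⟩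
          have h3 : lprod (p ++ [⟨i, x⟩]) * lprod (⟨i, y⟩ :: s) = lprod (p ++ ⟨i, x * y⟩ :: s) := by
            simp [lprod, mul_assoc]
          have h4 : tprod θ (p ++ [⟨i, x⟩]) * tprod θ (⟨i, y⟩ :: s) =
              tprod θ (p ++ ⟨i, x * y⟩ :: s) := by
            simp [tprod, mul_assoc, hm]
          rw [h3, h4]
          apply LL_lprod
          refine ⟨?_, ?_⟩
          · intro z hz
            simp only [List.mem_append, List.mem_cons] at hz
            rcases hz with hz | rfl | hz
            exacts [hp.1 z hz, hxy, hs.1 z hz]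
          · rw [List.isChain_append]
            refine ⟨hp.2, ?_, ?_⟩
            · have := h2.2
              rw [List.isChain_cons] at this ⊢
              exact this
            · have := (List.isChain_append.1 h1.2).2.2
              simpa using this
      · refine ⟨Classical.arbitrary ι, 1, 1, fun θ hθ _ => ?_⟩
        rw [← lprod_append, ← tprod_append]
        apply LL_lprod
        refine ⟨?_, ?_⟩
        · intro z hz
          rcases List.mem_append.1 hz with hz | hz
          exacts [h1.1 z hz, h2.1 z hz]
        · rw [List.isChain_append]
          refine ⟨h1.2, h2.2, ?_⟩
          simpa using hij

theorem key_mul [Nonempty ι] (g h : CoprodI M) :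
    ∃ (i : ι) (x y : M i), ∀ θ : ∀ i, M i → G, (∀ i x, θ i x⁻¹ = (θ i x)⁻¹) →
      θ i (x * y) = θ i x * θ i y → LL θ (g * h) = LL θ g * LL θ h := by
  obtain ⟨l, hl, rfl⟩ := exists_red g
  obtain ⟨l', hl', rfl⟩ := exists_red h
  obtain ⟨i, x, y, hk⟩ := key_lists (G := G) l l' hl hl'
  exact ⟨i, x, y, fun θ hθ hm => by rw [hk θ hθ hm, LL_lprod θ hl, LL_lprod θ hl']⟩

end Syllables

end NoQE

namespace NoQE

open Monoid

abbrev MZ : Fin 2 → Type := fun _ => Multiplicative ℤ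

def eF : F2 ≃* CoprodI MZ :=
  MonoidHom.toMulEquiv
    (FreeGroup.lift fun i => (CoprodI.of (M := MZ) (i := i) (Multiplicative.ofAdd 1)))
    (CoprodI.lift fun i => zpowersHom F2 (FreeGroup.of i))
    (by ext i; simp)
    (by
      apply CoprodI.ext_hom
      intro i
      apply MonoidHom.ext_mint
      simp)

theorem eF_of (i : Fin 2) : eF (FreeGroup.of i) = CoprodI.of (M := MZ) (i := i) (Multiplicative.ofAdd 1) := by
  simp [eF]

theorem eF_pow (i : Fin 2) (n : ℕ) :
    eF (FreeGroup.of i ^ n) = CoprodI.of (M := MZ) (i := i) (Multiplicative.ofAdd (n : ℤ)) := by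
  rw [map_pow, eF_of, ← map_pow, ← ofAdd_nsmul]
  simp

theorem eF_symm_of (i : Fin 2) (x : MZ i) :
    eF.symm (CoprodI.of (M := MZ) (i := i) x) = FreeGroup.of i ^ x.toAdd := by
  simp [eF]

/-- The syllable map replacing `b^j` by `t`. -/
def th (j : ℕ) : ∀ i, MZ i → F3 := fun i x =>
  if i = 0 then ha ^ x.toAdd else
    if x.toAdd = j then ht else if x.toAdd = -j then ht⁻¹ else hb ^ x.toAdd

theorem th_inv {j : ℕ} (hj : j ≠ 0) (i : Fin 2) (x : MZ i) : th j i x⁻¹ = (th j i x)⁻¹ := by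
  unfold th
  rw [toAdd_inv]
  generalize x.toAdd = z
  split_ifs <;> first | (exfalso; omega) | simp

theorem th_mul {j : ℕ} (i : Fin 2) (x y : MZ i) (hx : x.toAdd.natAbs ≠ j) (hy : y.toAdd.natAbs ≠ j)
    (hxy : (x.toAdd + y.toAdd).natAbs ≠ j) : th j i (x * y) = th j i x * th j i y := by
  unfold th
  rw [toAdd_mul]
  generalize x.toAdd = z at *
  generalize y.toAdd = w at *
  split_ifs <;> first | (exfalso; omega) | (rw [zpow_add])

def sig (j : ℕ) : F3 →* F2 := FreeGroup.lift ![ga, gb, gb ^ j]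

theorem sig_th (j : ℕ) (i : Fin 2) (x : MZ i) : sig j (th j i x) = FreeGroup.of i ^ x.toAdd := by
  have h1 : sig j ha = ga := by simp [sig, ha]
  have h2 : sig j hb = gb := by simp [sig, hb]
  have h3 : sig j ht = gb ^ j := by simp [sig, ht]
  unfold th
  split_ifs with h h' h''
  · subst h; rw [map_zpow, h1]; rfl
  · have : i = 1 := by omega
    subst this; rw [h3, h', zpow_natCast]; rfl
  · have : i = 1 := by omega
    subst this; rw [map_inv, h3, h'', zpow_neg, zpow_natCast]; rfl
  · have : i = 1 := by omega
    subst this; rw [map_zpow, h2]; rfl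

theorem sig_LL (j : ℕ) (g : F2) : sig j (LL (th j) (eF g)) = g := by
  obtain ⟨l, hl, h⟩ := exists_red (eF g)
  rw [← h, LL_lprod _ hl]
  apply eF.injective
  rw [← h]
  apply eF.symm.injective
  rw [MulEquiv.symm_apply_apply, tprod, lprod, map_list_prod, map_list_prod, List.map_map,
    List.map_map]
  congr 1
  apply List.map_congr_left
  intro x hx
  simp only [Function.comp, sig_th, eF_symm_of]

def iota : F2 →* F3 := FreeGroup.lift ![ha, hb]

/-- the syllables of `c_n` -/
def cl (ks : List ℕ) : List (Σ i, MZ i) :=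
  ks.flatMap fun k => [⟨0, Multiplicative.ofAdd (6 : ℤ)⟩,
    ⟨1, Multiplicative.ofAdd ((6 * (k + 1) : ℕ) : ℤ)⟩]

theorem cl_red (ks : List ℕ) : Red (cl ks) := by
  constructor
  · intro x hx
    simp only [cl, List.mem_flatMap, List.mem_cons, List.not_mem_nil, or_false] at hx
    obtain ⟨k, -, rfl | rfl⟩ := hx
    · simp
    · rw [Ne, ofAdd_eq_one]; omega
  · induction ks with
    | nil => simp [cl]
    | cons k ks ih =>
      have : cl (k :: ks) = ⟨0, Multiplicative.ofAdd (6 : ℤ)⟩ ::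
        ⟨1, Multiplicative.ofAdd ((6 * (k + 1) : ℕ) : ℤ)⟩ :: cl ks := rfl
      rw [this]
      refine List.IsChain.cons_cons (by simp) ?_
      rw [List.isChain_cons]
      refine ⟨?_, ih⟩
      cases ks with
      | nil => simp [cl]
      | cons k ks => simp [cl]

theorem cl_prod (n : ℕ) : lprod (cl (List.range n)) = eF (cn n) := by
  unfold cn
  generalize List.range n = ks
  induction ks with
  | nil => simp [cl, lprod]
  | cons k ks ih =>
    have : cl (k :: ks) = [⟨0, Multiplicative.ofAdd (6 : ℤ)⟩,
        ⟨1, Multiplicative.ofAdd ((6 * (k + 1) : ℕ) : ℤ)⟩] ++ cl ks := rfl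
    rw [this, lprod_append, ih, List.map_cons, List.prod_cons, map_mul, map_mul]
    congr 1
    rw [ga, gb, eF_pow, eF_pow]
    simp [lprod]

theorem cl_tprod (j : ℕ) (ks : List ℕ) : tprod (th j) (cl ks) =
    (ks.map fun k => ha ^ 6 * (if 6 * (k + 1) = j then ht else hb ^ (6 * (k + 1)))).prod := by
  induction ks with
  | nil => simp [cl, tprod]
  | cons k ks ih =>
    have : cl (k :: ks) = [⟨0, Multiplicative.ofAdd (6 : ℤ)⟩,
        ⟨1, Multiplicative.ofAdd ((6 * (k + 1) : ℕ) : ℤ)⟩] ++ cl ks := rfl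
    rw [this, tprod_append, ih, List.map_cons, List.prod_cons]
    congr 1
    simp only [tprod, List.map_cons, List.prod_cons, List.map_nil, List.prod_nil, mul_one]
    congr 1
    simp only [th, toAdd_ofAdd]
    have h1 : ((6 * (k + 1) : ℕ) : ℤ) ≠ -(j : ℤ) := by omega
    rw [if_neg (by simp), if_neg h1, zpow_natCast]
    simp only [Nat.cast_inj]

theorem no_t (j : ℕ) (ks : List ℕ) (h : ∀ k ∈ ks, 6 * (k + 1) ≠ j) :
    ∃ α : F2, iota α =
      (ks.map fun k => ha ^ 6 * (if 6 * (k + 1) = j then ht else hb ^ (6 * (k + 1)))).prod := by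
  refine ⟨(ks.map fun k => ga ^ 6 * gb ^ (6 * (k + 1))).prod, ?_⟩
  rw [map_list_prod, List.map_map]
  congr 1
  apply List.map_congr_left
  intro k hk
  simp [if_neg (h k hk), iota, ga, gb]

theorem LL_cn {n k : ℕ} (hk : k < n) :
    ∃ α β : F2, LL (th (6 * (k + 1))) (eF (cn n)) = iota α * ht * iota β := by
  rw [← cl_prod, LL_lprod _ (cl_red _), cl_tprod]
  obtain ⟨s, t, hst⟩ := List.append_of_mem (List.mem_range.2 hk)
  have hnd := List.nodup_range (n := n)
  rw [hst] at hnd ⊢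
  rw [List.nodup_append] at hnd
  obtain ⟨α, hα⟩ := no_t (6 * (k + 1)) s (fun x hx h => by
    have : x = k := by omega
    exact hnd.2.2 x hx k (by simp) this)
  obtain ⟨β, hβ⟩ := no_t (6 * (k + 1)) t (fun x hx h => by
    have : x = k := by omega
    subst this
    exact (List.nodup_cons.1 hnd.2.1).1 hx)
  refine ⟨α * ga ^ 6, β, ?_⟩
  have : iota ga = ha := by simp [iota, ga]
  rw [List.map_append, List.prod_append, List.map_cons, List.prod_cons, ← hα, ← hβ, map_mul,
    map_pow, this, if_pos rfl]
  group

theorem exists_mu (α β : F2) : ∃ μ : F3 →* F3, Function.Injective μ ∧ μ ha = ha ∧ μ hb = hb ∧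
    μ (iota α * ht * iota β) = ht := by
  let μ : F3 →* F3 := FreeGroup.lift ![ha, hb, (iota α)⁻¹ * ht * (iota β)⁻¹]
  let ν : F3 →* F3 := FreeGroup.lift ![ha, hb, iota α * ht * iota β]
  have m1 : μ ha = ha := by simp [μ, ha]
  have m2 : μ hb = hb := by simp [μ, hb]
  have m3 : μ ht = (iota α)⁻¹ * ht * (iota β)⁻¹ := by simp [μ, ht]
  have n1 : ν ha = ha := by simp [ν, ha]
  have n2 : ν hb = hb := by simp [ν, hb]
  have n3 : ν ht = (iota α) * ht * (iota β) := by simp [ν, ht]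
  have i1 : iota ga = ha := by simp [iota, ga]
  have i2 : iota gb = hb := by simp [iota, gb]
  have mi : ∀ x, μ (iota x) = iota x := by
    have : μ.comp iota = iota := by
      apply FreeGroup.ext_hom
      intro i
      fin_cases i
      · change μ (iota ga) = iota ga
        rw [i1, m1]
      · change μ (iota gb) = iota gb
        rw [i2, m2]
    exact fun x => DFunLike.congr_fun this x
  have ni : ∀ x, ν (iota x) = iota x := by
    have : ν.comp iota = iota := by
      apply FreeGroup.ext_hom
      intro i
      fin_cases i
      · change ν (iota ga) = iota ga
        rw [i1, n1]
      · change ν (iota gb) = iota gb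
        rw [i2, n2]
    exact fun x => DFunLike.congr_fun this x
  have nm : ν.comp μ = MonoidHom.id F3 := by
    apply FreeGroup.ext_hom
    intro i
    fin_cases i
    · change ν (μ ha) = ha
      rw [m1, n1]
    · change ν (μ hb) = hb
      rw [m2, n2]
    · change ν (μ ht) = ht
      rw [m3, map_mul, map_mul, map_inv, map_inv, ni, ni, n3]
      group
  refine ⟨μ, ?_, m1, m2, ?_⟩
  · exact Function.LeftInverse.injective (g := ν) (fun x => DFunLike.congr_fun nm x)
  · rw [map_mul, map_mul, mi, mi, m3]
    group

theorem liftProp : LiftProp := by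
  classical
  intro N
  refine ⟨3 * N + 1, fun n hn T hT => ?_⟩
  have hkey : ∀ p : F2 × F2, ∃ B : Finset ℕ, B.card ≤ 3 ∧ ∀ j ∉ B, j ≠ 0 →
      LL (th j) (eF (p.1 * p.2)) = LL (th j) (eF p.1) * LL (th j) (eF p.2) := by
    intro p
    obtain ⟨i, x, y, h⟩ := key_mul (G := F3) (eF p.1) (eF p.2)
    refine ⟨{x.toAdd.natAbs, y.toAdd.natAbs, (x.toAdd + y.toAdd).natAbs}, Finset.card_le_three,
      fun j hj h0 => ?_⟩
    simp only [Finset.mem_insert, Finset.mem_singleton, not_or] at hj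
    rw [map_mul]
    exact h (th j) (th_inv h0) (th_mul i x y (Ne.symm hj.1) (Ne.symm hj.2.1) (Ne.symm hj.2.2))
  choose B hB hB' using hkey
  obtain ⟨k, hk, hkB⟩ : ∃ k < n, 6 * (k + 1) ∉ T.biUnion B := by
    by_contra! hcon
    have h1 : ((Finset.range n).image fun k => 6 * (k + 1)) ⊆ T.biUnion B := by
      intro j hj
      obtain ⟨k, hk, rfl⟩ := Finset.mem_image.1 hj
      exact hcon k (Finset.mem_range.1 hk)
    have h2 := Finset.card_le_card h1
    rw [Finset.card_image_of_injective _ (by intro a b h; simpa using h), Finset.card_range] at h2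
    have h3 := Finset.card_biUnion_le_card_mul T B 3 (fun p _ => hB p)
    omega
  obtain ⟨α, β, hαβ⟩ := LL_cn hk
  obtain ⟨μ, hμ, m1, m2, m3⟩ := exists_mu α β
  have hgen : ∀ i : Fin 2, LL (th (6 * (k + 1))) (eF (FreeGroup.of i)) =
      th (6 * (k + 1)) i (Multiplicative.ofAdd 1) := by
    intro i
    have := LL_lprod (th (6 * (k + 1))) (l := [⟨i, Multiplicative.ofAdd 1⟩])
      ⟨by simp, by simp⟩
    rw [eF_of]
    simpa [lprod, tprod] using this
  refine ⟨fun g => μ (LL (th (6 * (k + 1))) (eF g)), ⟨?_, ?_, ?_⟩, ?_, ?_, ?_, ?_⟩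
  · simp [LL_one]
  · intro g
    rw [map_inv, LL_inv _ (th_inv (by omega)), map_inv]
  · intro p hp
    rw [hB' p _ (fun h => hkB (Finset.mem_biUnion.2 ⟨p, hp, h⟩)) (by omega), map_mul]
  · exact hμ.comp (Function.LeftInverse.injective (g := sig (6 * (k + 1))) (sig_LL _))
  · beta_reduce
    rw [ga, hgen]
    simp [th, m1]
  · beta_reduce
    rw [gb, hgen]
    have h1 : (1 : ℤ) ≠ ((6 * (k + 1) : ℕ) : ℤ) := by omega
    have h2 : (1 : ℤ) ≠ -((6 * (k + 1) : ℕ) : ℤ) := by omega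
    simp only [th, toAdd_ofAdd, if_neg h1, if_neg h2]
    simp [m2]
  · beta_reduce
    rw [hαβ, m3]

end NoQE

namespace NoQE

open Matrix

abbrev SL2 := Matrix.SpecialLinearGroup (Fin 2) ℤ

def sA (p : ℤ) : SL2 := ⟨!![1, p; 0, 1], by simp [Matrix.det_fin_two]⟩
def sB (p : ℤ) : SL2 := ⟨!![1, 0; p, 1], by simp [Matrix.det_fin_two]⟩

theorem sA_inv (p : ℤ) : (sA p)⁻¹ = sA (-p) := by
  apply inv_eq_of_mul_eq_one_right
  apply Subtype.ext
  change !![1, p; 0, 1] * !![1, -p; 0, 1] = (1 : Matrix (Fin 2) (Fin 2) ℤ)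
  simp [Matrix.one_fin_two]

theorem sB_inv (p : ℤ) : (sB p)⁻¹ = sB (-p) := by
  apply inv_eq_of_mul_eq_one_right
  apply Subtype.ext
  change !![1, 0; p, 1] * !![1, 0; -p, 1] = (1 : Matrix (Fin 2) (Fin 2) ℤ)
  simp [Matrix.one_fin_two]

theorem sA_sq : sA 2 * sA 2 = sA 4 := by
  apply Subtype.ext
  change !![1, 2; 0, 1] * !![1, 2; 0, 1] = (!![1, 4; 0, 1] : Matrix (Fin 2) (Fin 2) ℤ)
  simp

/-- nonzero integer vectors -/
def NV := {v : Fin 2 → ℤ // v ≠ 0}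

instance actNV : MulAction SL2 NV where
  smul g v := ⟨g.1 *ᵥ v.1, fun h => v.2 (by
    have : (g⁻¹ : SL2).1 *ᵥ (g.1 *ᵥ v.1) = v.1 := by
      rw [Matrix.mulVec_mulVec, ← Matrix.SpecialLinearGroup.coe_mul, inv_mul_cancel]
      simp
    rw [← this, h, Matrix.mulVec_zero])⟩
  one_smul v := Subtype.ext (by
    change (1 : SL2).1 *ᵥ v.1 = v.1
    simp)
  mul_smul g h v := Subtype.ext (by
    change (g * h : SL2).1 *ᵥ v.1 = g.1 *ᵥ (h.1 *ᵥ v.1)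
    rw [Matrix.mulVec_mulVec, ← Matrix.SpecialLinearGroup.coe_mul])

theorem smul_val (g : SL2) (v : NV) : (g • v).1 = g.1 *ᵥ v.1 := rfl

theorem sA_smul (p : ℤ) (v : NV) : (sA p • v).1 0 = v.1 0 + p * v.1 1 ∧ (sA p • v).1 1 = v.1 1 := by
  rw [smul_val]
  change (!![1, p; 0, 1] *ᵥ v.1) 0 = _ ∧ (!![1, p; 0, 1] *ᵥ v.1) 1 = _
  simp [Matrix.mulVec, dotProduct, Fin.sum_univ_two]

theorem sB_smul (p : ℤ) (v : NV) : (sB p • v).1 0 = v.1 0 ∧ (sB p • v).1 1 = p * v.1 0 + v.1 1 := by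
  rw [smul_val]
  change (!![1, 0; p, 1] *ᵥ v.1) 0 = _ ∧ (!![1, 0; p, 1] *ᵥ v.1) 1 = _
  simp [Matrix.mulVec, dotProduct, Fin.sum_univ_two]

theorem nv_ne (v : NV) : v.1 0 ≠ 0 ∨ v.1 1 ≠ 0 := by
  by_contra! h
  apply v.2
  funext i
  fin_cases i
  exacts [h.1, h.2]

def XX : Fin 2 → Set NV := ![
  {v | (0 ≤ v.1 1 ∧ v.1 1 ≤ v.1 0) ∨ (v.1 1 ≤ 0 ∧ v.1 0 ≤ v.1 1)},
  {v | (0 < v.1 1 ∧ 0 ≤ v.1 0 ∧ v.1 0 < v.1 1) ∨ (v.1 1 < 0 ∧ v.1 1 < v.1 0 ∧ v.1 0 ≤ 0)}]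

def YY : Fin 2 → Set NV := ![
  {v | (0 < v.1 1 ∧ v.1 0 < - v.1 1) ∨ (v.1 1 < 0 ∧ - v.1 1 < v.1 0)},
  {v | (0 < v.1 1 ∧ - v.1 1 ≤ v.1 0 ∧ v.1 0 < 0) ∨ (v.1 1 < 0 ∧ 0 < v.1 0 ∧ v.1 0 ≤ - v.1 1)}]

open scoped Pointwise in
theorem sanov (p : ℤ) (hp : p = 2 ∨ p = 4) :
    Function.Injective (FreeGroup.lift ![sA p, sB 2]) := by
  refine FreeGroup.injective_lift_of_ping_pong ![sA p, sB 2] XX YY ?_ ?_ ?_ ?_ ?_ ?_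
  · intro i
    fin_cases i
    · exact ⟨⟨![1, 0], fun h => by simpa using congrFun h 0⟩, Or.inl (by simp)⟩
    · exact ⟨⟨![0, 1], fun h => by simpa using congrFun h 1⟩, Or.inl (by simp)⟩
  · intro i j hij
    refine Set.disjoint_left.2 fun v => ?_
    have := nv_ne v
    fin_cases i <;> fin_cases j <;> simp [XX] at hij ⊢ <;> omega
  · intro i j hij
    refine Set.disjoint_left.2 fun v => ?_
    have := nv_ne v
    fin_cases i <;> fin_cases j <;> simp [YY] at hij ⊢ <;> omega
  · intro i j
    refine Set.disjoint_left.2 fun v => ?_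
    have := nv_ne v
    fin_cases i <;> fin_cases j <;> simp [XX, YY] <;> omega
  · intro i
    rintro _ ⟨v, hv, rfl⟩
    have := nv_ne v
    have h1 := sA_smul p v
    have h2 := sB_smul 2 v
    fin_cases i
    · simp [XX, YY] at hv ⊢
      rw [h1.1, h1.2]
      rcases hp with rfl | rfl <;> omega
    · simp [XX, YY] at hv ⊢
      rw [h2.1, h2.2]
      omega
  · intro i
    rintro _ ⟨v, hv, rfl⟩
    have := nv_ne v
    have h1 := sA_smul (-p) v
    have h2 := sB_smul (-2) v
    fin_cases i
    · simp [XX, YY, sA_inv] at hv ⊢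
      rw [h1.1, h1.2]
      rcases hp with rfl | rfl <;> omega
    · simp [XX, YY, sB_inv] at hv ⊢
      rw [h2.1, h2.2]
      omega

theorem hinj : ∃ g : F2 →* F3, Function.Injective g ∧ g ga = rho := by
  let g : F2 →* F3 := FreeGroup.lift ![rho, hb]
  have g1 : g ga = rho := by simp [g, ga]
  have g2 : g gb = hb := by simp [g, gb]
  let u : F2 →* F2 := FreeGroup.lift ![ga * (gb * gb), gb]
  have u1 : u ga = ga * (gb * gb) := by simp [u, ga]
  have u2 : u gb = gb := by simp [u, gb]
  let v : F2 →* F2 := FreeGroup.lift ![ga * (gb * gb)⁻¹, gb]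
  have v1 : v ga = ga * (gb * gb)⁻¹ := by simp [v, ga]
  have v2 : v gb = gb := by simp [v, gb]
  let r : F3 →* SL2 := FreeGroup.lift ![sA 2, sB 2, 1]
  have r1 : r ha = sA 2 := by simp [r, ha]
  have r2 : r hb = sB 2 := by simp [r, hb]
  have r3 : r ht = 1 := by simp [r, ht]
  have h1 : r.comp (g.comp v) = FreeGroup.lift ![sA 4, sB 2] := by
    apply FreeGroup.ext_hom
    intro i
    fin_cases i
    · change r (g (v ga)) = _
      rw [v1]
      simp only [map_mul, map_inv, g1, g2, rho, r1, r2, r3, sA_sq]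
      simp [mul_assoc]
    · change r (g (v gb)) = _
      rw [v2, g2, r2]
      simp
  have h2 : v.comp u = MonoidHom.id F2 := by
    apply FreeGroup.ext_hom
    intro i
    fin_cases i
    · change v (u ga) = ga
      rw [u1, map_mul, map_mul, v1, v2]; group
    · change v (u gb) = gb
      rw [u2, v2]
  refine ⟨g, ?_, g1⟩
  have h3 := sanov 4 (Or.inr rfl)
  rw [← h1] at h3
  have h4 : Function.Injective u :=
    Function.LeftInverse.injective (g := v) (fun x => DFunLike.congr_fun h2 x)
  intro x y hxy
  apply h4
  apply h3
  have e : ∀ x, v (u x) = x := fun x => DFunLike.congr_fun h2 x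
  change r (g (v (u x))) = r (g (v (u y)))
  rw [e, e, hxy]

end NoQE

namespace NoQE

open Matrix Filter Topology

abbrev M2 := Matrix (Fin 2) (Fin 2) ℝ

noncomputable def kap : ℝ := Real.sqrt 5 - 2

theorem kap_sq : kap ^ 2 = 1 - 4 * kap := by
  have := Real.sq_sqrt (show (0 : ℝ) ≤ 5 by norm_num)
  unfold kap
  nlinarith

theorem kap_pos : 0 < kap := by
  have : (2 : ℝ) < Real.sqrt 5 := by
    rw [Real.lt_sqrt (by norm_num)]; norm_num
  unfold kap
  linarith

theorem kap_lt : kap < 1 := by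
  have := kap_sq
  have := kap_pos
  nlinarith

theorem kap_irr (x y : ℤ) (h : (x : ℝ) + kap * y = 0) : x = 0 ∧ y = 0 := by
  have hirr : Irrational kap := by
    have := (Nat.Prime.irrational_sqrt (show Nat.Prime 5 by norm_num)).sub_intCast 2
    simpa [kap] using this
  by_cases hy : y = 0
  · subst hy
    simp at h
    exact ⟨h, rfl⟩
  · exfalso
    apply hirr
    refine ⟨-x / y, ?_⟩
    have : (y : ℝ) ≠ 0 := by exact_mod_cast hy
    push_cast
    rw [div_eq_iff this]
    linarith

def RR : F2 →* SL2 := FreeGroup.lift ![sA 2, sB 2]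

theorem RR_inj : Function.Injective RR := sanov 2 (Or.inl rfl)

def Rm : F2 →* M2 where
  toFun g := (RR g).1.map (Int.castRingHom ℝ)
  map_one' := by simp
  map_mul' x y := by
    rw [map_mul, Matrix.SpecialLinearGroup.coe_mul, Matrix.map_mul]

def gu : F2 := ga * ga * (gb * gb)

theorem RR_gu : (RR gu).1 = !![17, 4; 4, 1] := by
  have h1 : RR ga = sA 2 := by simp [RR, ga]
  have h2 : RR gb = sB 2 := by simp [RR, gb]
  simp only [gu, map_mul, h1, h2]
  change !![1, 2; 0, 1] * !![1, 2; 0, 1] * (!![1, 0; 2, 1] * !![1, 0; 2, 1]) = !![(17 : ℤ), 4; 4, 1]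
  simp

theorem Rm_gu : Rm gu = !![17, 4; 4, 1] := by
  change (RR gu).1.map (Int.castRingHom ℝ) = _
  rw [RR_gu]
  ext i j
  fin_cases i <;> fin_cases j <;> simp

theorem Rm_gu_inv : Rm gu⁻¹ = !![1, -4; -4, 17] := by
  have h : Rm gu⁻¹ * Rm gu = 1 := by rw [← map_mul]; simp
  have h' : Rm gu * !![1, -4; -4, 17] = 1 := by
    rw [Rm_gu, Matrix.one_fin_two]; norm_num
  calc Rm gu⁻¹ = Rm gu⁻¹ * (Rm gu * !![1, -4; -4, 17]) := by rw [h', mul_one]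
    _ = _ := by rw [← mul_assoc, h, one_mul]

noncomputable def vp : Fin 2 → ℝ := ![1, kap]
noncomputable def vm : Fin 2 → ℝ := ![-kap, 1]

theorem commute_of_int (g : F2) (h1 : (RR g).1 0 1 = (RR g).1 1 0)
    (h2 : (RR g).1 0 0 = (RR g).1 1 1 + 4 * (RR g).1 1 0) : gu * g = g * gu := by
  apply RR_inj
  apply Subtype.ext
  rw [map_mul, map_mul, Matrix.SpecialLinearGroup.coe_mul, Matrix.SpecialLinearGroup.coe_mul, RR_gu]
  ext i j
  fin_cases i <;> fin_cases j <;>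
    simp [Matrix.mul_apply, Fin.sum_univ_two, h1, h2] <;> ring

theorem comm_pm (g : F2) (h : vp ⬝ᵥ (Rm g *ᵥ vm) = 0) : gu * g = g * gu := by
  have e : ∀ i j, Rm g i j = ((RR g).1 i j : ℝ) := fun i j => rfl
  simp only [vp, vm, Matrix.mulVec, dotProduct, Fin.sum_univ_two, e, Matrix.cons_val_zero,
    Matrix.cons_val_one] at h
  have := kap_irr ((RR g).1 0 1 - (RR g).1 1 0)
    (- (RR g).1 0 0 + 4 * (RR g).1 1 0 + (RR g).1 1 1) (by
    push_cast
    linear_combination h + ((RR g).1 1 0 : ℝ) * kap_sq)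
  exact commute_of_int g (by omega) (by omega)

theorem comm_mp (g : F2) (h : vm ⬝ᵥ (Rm g *ᵥ vp) = 0) : gu * g = g * gu := by
  have e : ∀ i j, Rm g i j = ((RR g).1 i j : ℝ) := fun i j => rfl
  simp only [vp, vm, Matrix.mulVec, dotProduct, Fin.sum_univ_two, e, Matrix.cons_val_zero,
    Matrix.cons_val_one] at h
  have := kap_irr ((RR g).1 1 0 - (RR g).1 0 1)
    (- (RR g).1 0 0 + 4 * (RR g).1 0 1 + (RR g).1 1 1) (by
    push_cast
    linear_combination h + ((RR g).1 0 1 : ℝ) * kap_sq)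
  exact commute_of_int g (by omega) (by omega)

noncomputable def Nc : ℝ := (1 + kap ^ 2)⁻¹

theorem Nc_ne : Nc ≠ 0 := by
  unfold Nc; positivity

noncomputable def Qp : M2 := vecMulVec vp vp
noncomputable def Qm : M2 := vecMulVec vm vm

theorem Qp_eq : Qp = !![1, kap; kap, kap ^ 2] := by
  ext i j
  fin_cases i <;> fin_cases j <;> simp [Qp, vp, vecMulVec, sq]

theorem Qm_eq : Qm = !![kap ^ 2, -kap; -kap, 1] := by
  ext i j
  fin_cases i <;> fin_cases j <;> simp [Qm, vm, vecMulVec, sq]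

theorem Q_sum : Nc • (Qp + Qm) = 1 := by
  have : (1 + kap ^ 2) ≠ 0 := by positivity
  rw [Qp_eq, Qm_eq, Matrix.one_fin_two]
  ext i j
  fin_cases i <;> fin_cases j <;> simp [Nc] <;> field_simp <;> ring

theorem U_Qp : kap ^ 2 • (Rm gu * Qp) = Qp := by
  rw [Rm_gu, Qp_eq]
  have := kap_sq
  have h3 : kap ^ 3 = -4 + 17 * kap := by linear_combination (kap - 4) * kap_sq
  ext i j
  fin_cases i <;> fin_cases j <;> simp [Matrix.mul_apply, Fin.sum_univ_two]
  · linear_combination (17 * this + 4 * h3)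
  · linear_combination kap * (17 * this + 4 * h3)
  · linear_combination (4 * this + h3)
  · linear_combination kap * (4 * this + h3)

theorem U_Qm : Rm gu * Qm = kap ^ 2 • Qm := by
  rw [Rm_gu, Qm_eq]
  have := kap_sq
  have h3 : kap ^ 3 = -4 + 17 * kap := by linear_combination (kap - 4) * kap_sq
  ext i j
  fin_cases i <;> fin_cases j <;> simp [Matrix.mul_apply, Fin.sum_univ_two]
  · linear_combination -kap * h3
  · linear_combination h3
  · linear_combination kap * this
  · linear_combination -this

theorem Ui_Qp : Rm gu⁻¹ * Qp = kap ^ 2 • Qp := by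
  rw [Rm_gu_inv, Qp_eq]
  have := kap_sq
  have h3 : kap ^ 3 = -4 + 17 * kap := by linear_combination (kap - 4) * kap_sq
  ext i j
  fin_cases i <;> fin_cases j <;> simp [Matrix.mul_apply, Fin.sum_univ_two]
  · linear_combination -this
  · linear_combination -kap * this
  · linear_combination -h3
  · linear_combination -kap * h3

theorem Ui_Qm : kap ^ 2 • (Rm gu⁻¹ * Qm) = Qm := by
  rw [Rm_gu_inv, Qm_eq]
  have := kap_sq
  have h3 : kap ^ 3 = -4 + 17 * kap := by linear_combination (kap - 4) * kap_sq
  ext i j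
  fin_cases i <;> fin_cases j <;> simp [Matrix.mul_apply, Fin.sum_univ_two]
  · linear_combination kap * (4 * this + h3)
  · linear_combination -(4 * this + h3)
  · linear_combination -kap * (17 * this + 4 * h3)
  · linear_combination (17 * this + 4 * h3)

theorem U_pow (k : ℕ) : (kap ^ 2) ^ k • Rm (gu ^ k) = Nc • (Qp + (kap ^ 4) ^ k • Qm) := by
  induction k with
  | zero =>
    have := Q_sum
    rw [smul_add] at this
    simp [this]
  | succ k ih =>
    have : (kap ^ 2) ^ (k + 1) • Rm (gu ^ (k + 1)) =
        kap ^ 2 • (Rm gu * ((kap ^ 2) ^ k • Rm (gu ^ k))) := by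
      rw [pow_succ' gu, map_mul, Matrix.mul_smul, smul_smul, pow_succ']
    rw [this, ih, Matrix.mul_smul, Matrix.mul_add, smul_comm, smul_add, U_Qp, Matrix.mul_smul, U_Qm,
      smul_smul, smul_smul]
    congr 3
    ring

theorem Ui_pow (k : ℕ) : (kap ^ 2) ^ k • Rm (gu ^ k)⁻¹ = Nc • ((kap ^ 4) ^ k • Qp + Qm) := by
  induction k with
  | zero =>
    have := Q_sum
    rw [smul_add] at this
    simp [this]
  | succ k ih =>
    have : (kap ^ 2) ^ (k + 1) • Rm (gu ^ (k + 1))⁻¹ =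
        kap ^ 2 • (Rm gu⁻¹ * ((kap ^ 2) ^ k • Rm (gu ^ k)⁻¹)) := by
      rw [pow_succ gu, _root_.mul_inv_rev, map_mul, Matrix.mul_smul, smul_smul, pow_succ']
    rw [this, ih, Matrix.mul_smul, Matrix.mul_add, smul_comm, smul_add, Ui_Qm, Matrix.mul_smul,
      Ui_Qp, smul_smul, smul_smul]
    congr 3
    ring

theorem k4_tendsto : Tendsto (fun k : ℕ => (kap ^ 4) ^ k) atTop (𝓝 0) := by
  apply tendsto_pow_atTop_nhds_zero_of_lt_one
  · have := kap_pos; positivity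
  · exact pow_lt_one₀ kap_pos.le kap_lt (by norm_num)

theorem U_lim : Tendsto (fun k : ℕ => (kap ^ 2) ^ k • Rm (gu ^ k)) atTop (𝓝 (Nc • Qp)) := by
  simp only [U_pow]
  have := ((tendsto_const_nhds (x := Qp)).add (k4_tendsto.smul_const Qm)).const_smul Nc
  simpa using this

theorem Ui_lim : Tendsto (fun k : ℕ => (kap ^ 2) ^ k • Rm (gu ^ k)⁻¹) atTop (𝓝 (Nc • Qm)) := by
  simp only [Ui_pow]
  have := ((k4_tendsto.smul_const Qp).add (tendsto_const_nhds (x := Qm))).const_smul Nc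
  simpa using this

/-- image of a letter under the `k`-th homomorphism -/
def lett (k : ℕ) (x : Σ _ : Fin 2, F2) : F2 :=
  if x.1 = 0 then x.2 else gu ^ k * x.2 * (gu ^ k)⁻¹

/-- number of letters of the second type -/
def ecount : List (Σ _ : Fin 2, F2) → ℕ
  | [] => 0
  | x :: l => (if x.1 = 0 then 0 else 1) + ecount l

noncomputable def limL (x : Σ _ : Fin 2, F2) : M2 :=
  if x.1 = 0 then Rm x.2 else (Nc • Qp) * Rm x.2 * (Nc • Qm)

theorem word_lim (l : List (Σ _ : Fin 2, F2)) :
    Tendsto (fun k : ℕ => ((kap ^ 4) ^ k) ^ (ecount l) • Rm (l.map (lett k)).prod) atTop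
      (𝓝 (l.map limL).prod) := by
  induction l with
  | nil => simp [ecount]
  | cons x l ih =>
    by_cases hx : x.1 = 0
    · have h := (tendsto_const_nhds (x := Rm x.2)).mul ih
      simpa [ecount, lett, limL, hx] using h
    · have h := ((U_lim.mul (tendsto_const_nhds (x := Rm x.2))).mul Ui_lim).mul ih
      simp only [List.map_cons, List.prod_cons, limL, if_neg hx]
      refine h.congr fun k => ?_
      simp only [ecount, lett, if_neg hx, map_mul, Matrix.smul_mul, Matrix.mul_smul, smul_smul]
      congr 1
      ring

def BadL (l : List (Σ _ : Fin 2, F2)) : Prop :=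
  (∀ x ∈ l, gu * x.2 ≠ x.2 * gu) ∧ l.IsChain (fun x y => x.1 ≠ y.1)

theorem lim_id (g : F2) (X : M2) : (Nc • Qp) * Rm g * (Nc • Qm) * X =
    vecMulVec vp ((Nc ^ 2 * (vp ⬝ᵥ (Rm g *ᵥ vm))) • (vm ᵥ* X)) := by
  ext i j
  fin_cases i <;> fin_cases j <;>
    simp [Qp, Qm, Matrix.mul_apply, Fin.sum_univ_two, vecMulVec, dotProduct, Matrix.mulVec,
      Matrix.vecMul] <;> ring

theorem lim_inv (l : List (Σ _ : Fin 2, F2)) (h : BadL l) :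
    ((∀ x ∈ l.head?, x.1 = 0) → vm ᵥ* (l.map limL).prod ≠ 0) ∧
    ((∃ x ∈ l.head?, x.1 ≠ 0) → ∃ y, y ≠ 0 ∧ (l.map limL).prod = vecMulVec vp y) := by
  induction l with
  | nil =>
    refine ⟨fun _ hv => ?_, by simp⟩
    have := congrFun hv 1
    simp [vm] at this
  | cons x l ih =>
    have hl : BadL l := ⟨fun y hy => h.1 y (by simp [hy]), h.2.tail⟩
    have hx := h.1 x (by simp)
    have hch := (List.isChain_cons.1 h.2).1
    specialize ih hl
    constructor
    · intro hx0
      replace hx0 : x.1 = 0 := hx0 x (by simp)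
      rw [List.map_cons, List.prod_cons, limL, if_pos hx0]
      have hne : vm ⬝ᵥ (Rm x.2 *ᵥ vp) ≠ 0 := fun hh => hx (comm_mp _ hh)
      cases l with
      | nil =>
        intro hh
        simp only [List.map_nil, List.prod_nil, mul_one] at hh
        rw [Matrix.dotProduct_mulVec, hh] at hne
        simp at hne
      | cons z l =>
        obtain ⟨y, hy, hy'⟩ := ih.2 ⟨z, by simp, fun hz => hch z (by simp) (hx0.trans hz.symm)⟩
        rw [hy']
        intro hh
        apply hy
        have e : vm ᵥ* (Rm x.2 * vecMulVec vp y) = (vm ⬝ᵥ (Rm x.2 *ᵥ vp)) • y := by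
          ext j
          fin_cases j <;>
            simp [Matrix.mul_apply, Fin.sum_univ_two, vecMulVec, dotProduct, Matrix.mulVec,
              Matrix.vecMul] <;> ring
        rw [e] at hh
        exact (smul_eq_zero.1 hh).resolve_left hne
    · rintro ⟨x', hx', hx0⟩
      have : x' = x := by simpa using hx'.symm
      subst this
      have hne : vp ⬝ᵥ (Rm x'.2 *ᵥ vm) ≠ 0 := fun hh => hx (comm_pm _ hh)
      rw [List.map_cons, List.prod_cons, limL, if_neg hx0, lim_id]
      refine ⟨_, ?_, rfl⟩
      apply smul_ne_zero
      · exact mul_ne_zero (pow_ne_zero _ Nc_ne) hne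
      · apply ih.1
        intro z hz
        have := hch z hz
        omega

theorem lim_ne (l : List (Σ _ : Fin 2, F2)) (h : BadL l) : (l.map limL).prod ≠ 0 := by
  intro h0
  by_cases hh : ∀ x ∈ l.head?, x.1 = 0
  · apply (lim_inv l h).1 hh
    rw [h0]; simp
  · push Not at hh
    obtain ⟨y, hy, hy'⟩ := (lim_inv l h).2 hh
    apply hy
    rw [h0] at hy'
    funext j
    have := congrFun (congrFun hy' 0) j
    simpa [vecMulVec, vp] using this.symm

theorem word_ne (l : List (Σ _ : Fin 2, F2)) (h : BadL l) (he : ecount l ≠ 0) (c : F2) :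
    ∀ᶠ k : ℕ in atTop, (l.map (lett k)).prod ≠ c := by
  have h1 : Tendsto (fun k : ℕ => ((kap ^ 4) ^ k) ^ (ecount l) • Rm c) atTop (𝓝 0) := by
    have := (k4_tendsto.pow (ecount l)).smul_const (Rm c)
    simpa [he] using this
  have h2 := (word_lim l).sub h1
  rw [sub_zero] at h2
  filter_upwards [h2.eventually_ne (lim_ne l h)] with k hk hc
  apply hk
  rw [hc, sub_self]

end NoQE

namespace NoQE

open Monoid Filter

theorem zp_inj {G : Type} [Group G] (x : G) (f : G →* Multiplicative ℤ) (h : (f x).toAdd = 2) :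
    Function.Injective (zpowersHom G x) := by
  intro m n hmn
  have := congrArg (fun y => (f y).toAdd) hmn
  simp only [zpowersHom_apply, map_zpow, toAdd_zpow, h, smul_eq_mul] at this
  apply Multiplicative.toAdd.injective
  omega

def expA : F2 →* Multiplicative ℤ := FreeGroup.lift ![Multiplicative.ofAdd 1, 1]
def expA3 : F3 →* Multiplicative ℤ := FreeGroup.lift ![Multiplicative.ofAdd 1, 1, 1]

theorem expA_gu : (expA gu).toAdd = 2 := by
  simp [expA, gu, ga, gb]

theorem expA3_rho : (expA3 rho).toAdd = 2 := by
  simp [expA3, rho, ha, hb, ht]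

theorem expA3_haha : (expA3 (ha * ha)).toAdd = 2 := by
  simp [expA3, ha]

theorem cent_gu (y : F2) (h : gu * y = y * gu) : y ∈ (zpowersHom F2 gu).range := by
  obtain ⟨z, i, j, hi, hj⟩ := common_root h
  have h2 : i * (expA z).toAdd = 2 := by
    rw [← expA_gu, hi, map_zpow, toAdd_zpow, smul_eq_mul]
  have hodd : ¬ ∃ r, i = r + r := by
    rintro ⟨r, hr⟩
    apply sq_A4 (z ^ r)
    rw [← zpow_add, ← hr, ← hi, gu]
  have hdvd : i.natAbs ∣ 2 := by
    have : i ∣ 2 := ⟨_, h2.symm⟩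
    simpa using Int.natAbs_dvd_natAbs.2 this
  have hle := Nat.le_of_dvd (by norm_num) hdvd
  have hii : i = 1 ∨ i = -1 := by
    have : i ≠ 0 := by rintro rfl; simp at h2
    have : i ≠ 2 := by rintro rfl; exact hodd ⟨1, rfl⟩
    have : i ≠ -2 := by rintro rfl; exact hodd ⟨-1, rfl⟩
    omega
  rcases hii with rfl | rfl
  · exact ⟨Multiplicative.ofAdd j, by simp [zpowersHom_apply, hi, hj]⟩
  · exact ⟨Multiplicative.ofAdd (-j), by simp [zpowersHom_apply, hi, hj]⟩

abbrev phD : Fin 2 → (Multiplicative ℤ →* F2) := fun _ => zpowersHom F2 gu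
abbrev DD := PushoutI phD

theorem phD_inj (i : Fin 2) : Function.Injective (phD i) := zp_inj gu expA expA_gu

def PhiD : F3 →* DD :=
  FreeGroup.lift ![PushoutI.of (φ := phD) 1 ga, PushoutI.of (φ := phD) 1 gb,
    PushoutI.of (φ := phD) 0 gb]

theorem PhiD_ha : PhiD ha = PushoutI.of (φ := phD) 1 ga := by simp [PhiD, ha]
theorem PhiD_hb : PhiD hb = PushoutI.of (φ := phD) 1 gb := by simp [PhiD, hb]
theorem PhiD_ht : PhiD ht = PushoutI.of (φ := phD) 0 gb := by simp [PhiD, ht]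

abbrev phG : Fin 2 → (Multiplicative ℤ →* F3) :=
  fun i => zpowersHom F3 (if i = 0 then rho else ha * ha)
abbrev GG := PushoutI phG

theorem phG_inj (i : Fin 2) : Function.Injective (phG i) := by
  by_cases h : i = 0
  · exact zp_inj _ expA3 (by rw [if_pos h]; exact expA3_rho)
  · exact zp_inj _ expA3 (by rw [if_neg h]; exact expA3_haha)

abbrev o0 : F3 →* GG := PushoutI.of (φ := phG) 0
abbrev o1 : F3 →* GG := PushoutI.of (φ := phG) 1

theorem GG_rel : o1 (ha * ha) = o0 rho := by
  have h0 := PushoutI.of_apply_eq_base phG 0 (Multiplicative.ofAdd 1)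
  have h1 := PushoutI.of_apply_eq_base phG 1 (Multiplicative.ofAdd 1)
  rw [← h0] at h1
  simpa [phG, zpowersHom_apply] using h1

def thF : Fin 2 → (F2 →* GG) :=
  ![FreeGroup.lift ![o1 ha, o0 ht], FreeGroup.lift ![o0 ha, o0 hb] ]

theorem thF_gu (i : Fin 2) : thF i gu = o0 (ha * ha * (hb * hb)) := by
  fin_cases i
  · have e1 : thF 0 ga = o1 ha := by simp [thF, ga]
    have e2 : thF 0 gb = o0 ht := by simp [thF, gb]
    change thF 0 gu = _
    rw [gu, map_mul, map_mul, map_mul, e1, e2, ← map_mul, GG_rel, ← map_mul, ← map_mul]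
    congr 1
    simp [rho, mul_assoc]
  · have e1 : thF 1 ga = o0 ha := by simp [thF, ga]
    have e2 : thF 1 gb = o0 hb := by simp [thF, gb]
    change thF 1 gu = _
    simp only [gu, map_mul, e1, e2]

def Theta : DD →* GG :=
  PushoutI.lift thF (zpowersHom GG (o0 (ha * ha * (hb * hb)))) (by
    intro i
    ext
    simp [zpowersHom_apply, thF_gu])

theorem Theta_Phi : Theta.comp PhiD = o0 := by
  ext i
  fin_cases i
  · change Theta (PhiD ha) = o0 ha
    rw [PhiD_ha, Theta, PushoutI.lift_of]; simp [thF, ga]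
  · change Theta (PhiD hb) = o0 hb
    rw [PhiD_hb, Theta, PushoutI.lift_of]; simp [thF, gb]
  · change Theta (PhiD ht) = o0 ht
    rw [PhiD_ht, Theta, PushoutI.lift_of]; simp [thF, gb]

theorem PhiD_inj : Function.Injective PhiD := by
  have h : Function.Injective (Theta.comp PhiD) := by
    rw [Theta_Phi]; exact PushoutI.of_injective phG_inj 0
  exact Function.Injective.of_comp (f := Theta) h

def eF2 (k : ℕ) (i : Fin 2) : F2 →* F2 :=
  if i = 0 then MonoidHom.id _ else (MulAut.conj (gu ^ k)).toMonoidHom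

theorem eF2_lett (k : ℕ) (i : Fin 2) (g : F2) : eF2 k i g = lett k ⟨i, g⟩ := by
  by_cases h : i = 0 <;> simp [eF2, lett, h, -map_pow]

theorem eF2_gu (k : ℕ) (i : Fin 2) : eF2 k i gu = gu := by
  by_cases h : i = 0 <;> simp [eF2, h, -map_pow]
  rw [(Commute.pow_self gu k).eq]; simp

def Ek (k : ℕ) : DD →* F2 :=
  PushoutI.lift (eF2 k) (zpowersHom F2 gu) (by
    intro i
    ext
    simp [zpowersHom_apply, eF2_gu])

theorem Ek_of (k : ℕ) (i : Fin 2) (g : F2) : Ek k (PushoutI.of (φ := phD) i g) = lett k ⟨i, g⟩ := by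
  rw [Ek, PushoutI.lift_of, eF2_lett]

theorem fk_rho (k : ℕ) : (Ek k).comp PhiD rho = ga ^ 2 := by
  have h : PhiD rho = PushoutI.of (φ := phD) 1 gu *
      PushoutI.of (φ := phD) 0 (gb⁻¹ * gb⁻¹) := by
    simp only [rho, gu, map_mul, map_inv, PhiD_ha, PhiD_hb, PhiD_ht]
  rw [MonoidHom.comp_apply, h, map_mul, Ek_of, Ek_of, ← eF2_lett, eF2_gu]
  simp [lett, gu, mul_assoc, sq]

theorem nform (d : DD) : ∃ (c : Multiplicative ℤ) (l : List (Σ _ : Fin 2, F2)), BadL l ∧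
    d = PushoutI.base phD c * (l.map fun x => PushoutI.of (φ := phD) x.1 x.2).prod := by
  obtain ⟨T⟩ := PushoutI.NormalWord.transversal_nonempty phD phD_inj
  let nw : PushoutI.NormalWord T := d • PushoutI.NormalWord.empty
  have hp : nw.prod = d := by
    simp [nw, PushoutI.NormalWord.prod_smul]
  refine ⟨nw.head, nw.toList, ⟨?_, ?_⟩, ?_⟩
  · rintro ⟨i, g⟩ hx hc
    have hr := cent_gu g hc
    have hs := nw.normalized i g hx
    have h1 := nw.ne_one _ hx
    apply h1
    have := (T.compl i).injective (a₁ := (⟨g, hr⟩, ⟨1, T.one_mem i⟩))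
      (a₂ := (⟨1, one_mem _⟩, ⟨g, hs⟩)) (by simp)
    simpa using congrArg (fun p => (p.1 : F2)) this
  · exact nw.chain_ne
  · conv_lhs => rw [← hp]
    rw [PushoutI.NormalWord.prod, CoprodI.Word.prod, map_list_prod, List.map_map]
    rfl

theorem ecount_zero {l : List (Σ _ : Fin 2, F2)} (h : ecount l = 0) : ∀ x ∈ l, x.1 = 0 := by
  induction l with
  | nil => simp
  | cons y l ih =>
    simp only [ecount] at h
    intro x hx
    rcases List.mem_cons.1 hx with rfl | hx
    · by_contra hh
      rw [if_neg hh] at h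
      omega
    · exact ih (by omega) x hx

theorem fk_ne (w : F3) (hw : w ≠ 1) : ∀ᶠ k : ℕ in atTop, (Ek k).comp PhiD w ≠ 1 := by
  have hd : PhiD w ≠ 1 := fun h => hw (PhiD_inj (h.trans (map_one _).symm))
  obtain ⟨c, l, hl, e⟩ := nform (PhiD w)
  have hE : ∀ k, (Ek k).comp PhiD w = gu ^ c.toAdd * (l.map (lett k)).prod := by
    intro k
    rw [MonoidHom.comp_apply, e, map_mul, map_list_prod, List.map_map]
    have e1 : Ek k (PushoutI.base phD c) = gu ^ c.toAdd := by
      rw [Ek, PushoutI.lift_base, zpowersHom_apply]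
    rw [e1]
    congr 2
    apply List.map_congr_left
    intro x _
    exact Ek_of k x.1 x.2
  by_cases he : ecount l = 0
  · refine Eventually.of_forall fun k hk => hd ?_
    have h0 := ecount_zero he
    have e2 : PhiD w = PushoutI.of (φ := phD) 0 (gu ^ c.toAdd * (l.map (lett k)).prod) := by
      rw [e, map_mul, map_list_prod, List.map_map]
      congr 1
      · rw [← PushoutI.of_apply_eq_base phD 0]
        rfl
      · congr 1
        apply List.map_congr_left
        rintro ⟨i, g⟩ hx
        have : i = 0 := h0 _ hx
        subst this
        simp [lett]
    rw [e2, ← hE k, hk, map_one]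
  · filter_upwards [word_ne l hl he (gu ^ c.toAdd)⁻¹] with k hk h
    rw [hE] at h
    exact hk (eq_inv_of_mul_eq_one_right h)

theorem disc (S : Finset F3) (hS : ∀ s ∈ S, s ≠ 1) :
    ∃ f : F3 →* F2, f rho = ga ^ 2 ∧ ∀ s ∈ S, f s ≠ 1 := by
  have : ∀ᶠ k : ℕ in atTop, ∀ s ∈ S, (Ek k).comp PhiD s ≠ 1 :=
    (eventually_all_finset S).2 fun s hs => fk_ne s (hS s hs)
  obtain ⟨k, hk⟩ := this.exists
  exact ⟨_, fk_rho k, hk⟩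

end NoQE

/-- The theory of nonabelian free groups does not admit quantifier elimination down to boolean
combinations of universal formulas: some formula `φ` is equivalent (in the free group of
rank 2, whose complete theory is the common theory of nonabelian free groups) to no boolean
combination of universal formulas. -/
theorem no_QE_to_boolean_combinations_of_universal_formulas :
    ∃ (k : ℕ) (φ : Lgp.Formula (Fin k)),
      ∀ ψ : Lgp.Formula (Fin k), IsBoolCombOfUniversals ψ →
        ¬ ∀ v : Fin k → FreeGroup (Fin 2), (φ.Realize v ↔ ψ.Realize v) :=
  NoQE.main_of (NoQE.up_of NoQE.liftProp NoQE.disc) (NoQE.down_of NoQE.liftProp NoQE.hinj)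
    NoQE.phi1 NoQE.phi2
end

section
/- The ∀-amalgamation property fails for finitely generated free groups: there exist finitely generated nonabelian free groups A₀, A₁, A₂ and ∀-embeddings f₁ : A₀ → A₁ and f₂ : A₀ → A₂ such that there is no finitely generated free group B admitting ∀-embeddings g₁ : A₁ → B and g₂ : A₂ → B with g₁ ∘ f₁ = g₂ ∘ f₂. In particular, the class of finitely generated free groups is not a ∀-Fraïssé class. -/
open FirstOrder

/-- A group homomorphism is a `∀`-embedding if it is injective and preserves all universal
formulas (on all finite tuples). -/
def IsForallEmbedding {A B : Type*} [Group A] [Group B] (f : A →* B) : Prop :=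
  Function.Injective f ∧
    ∀ (k : ℕ) (φ : Lgp.Formula (Fin k)), IsUniversalF φ →
      ∀ a : Fin k → A, φ.Realize a → φ.Realize (f ∘ a)

/-- A bundled group, used to quantify over groups. -/
structure BGroup where
  carrier : Type
  [str : Group carrier]

attribute [instance] BGroup.str

instance : CoeSort BGroup Type := ⟨BGroup.carrier⟩

/-- A group is nonabelian if some pair of its elements does not commute. -/
def Nonabelian (G : Type*) [Group G] : Prop :=
  ∃ x y : G, x * y ≠ y * x

namespace FGA

open Polynomial Matrix

/-- direction vectors -/
def uvec : Fin 2 × Bool → Fin 2 → ℚ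
  | (0, true) => ![1, 0]
  | (0, false) => ![0, 1]
  | (1, true) => ![1, 1]
  | (1, false) => ![1, -1]

def usc : Fin 2 → ℚ := ![1, 1/2]

def Qm (x : Fin 2 × Bool) : Matrix (Fin 2) (Fin 2) ℚ := usc x.1 • Matrix.vecMulVec (uvec x) (uvec x)

noncomputable def Mm (x : Fin 2 × Bool) : Matrix (Fin 2) (Fin 2) ℚ[X] :=
  (X ^ 2 : ℚ[X]) • (Qm x).map C + (Qm (x.1, !x.2)).map C

lemma usc_ne (i : Fin 2) : usc i ≠ 0 := by
  fin_cases i <;> simp [usc]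

lemma uvec_dot (x y : Fin 2 × Bool) (h : x.1 = y.1 → x.2 = y.2) : uvec x ⬝ᵥ uvec y ≠ 0 := by
  obtain ⟨i, e⟩ := x
  obtain ⟨j, f⟩ := y
  fin_cases i <;> fin_cases j <;> cases e <;> cases f <;>
    simp [uvec, dotProduct, Fin.sum_univ_two] at h ⊢

lemma prodQ (x : Fin 2 × Bool) (L : List (Fin 2 × Bool)) (h : FreeGroup.IsReduced (x :: L)) :
    ∃ c : ℚ, c ≠ 0 ∧ ∃ y ∈ (x :: L).getLast?,
      ((x :: L).map Qm).prod = c • Matrix.vecMulVec (uvec x) (uvec y) := by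
  induction L generalizing x with
  | nil => exact ⟨usc x.1, usc_ne _, x, by simp, by simp [Qm]⟩
  | cons z L ih =>
    have h2 := h
    rw [FreeGroup.IsReduced, List.isChain_cons_cons] at h2
    obtain ⟨c, hc, y, hy, e⟩ := ih z h2.2
    refine ⟨usc x.1 * (uvec x ⬝ᵥ uvec z) * c, ?_, y, ?_, ?_⟩
    · exact mul_ne_zero (mul_ne_zero (usc_ne _) (uvec_dot x z h2.1)) hc
    · simpa using hy
    · rw [List.map_cons, List.prod_cons, e, Qm, smul_mul_smul_comm, Matrix.vecMulVec_mul_vecMulVec]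
      ext i j
      simp only [Matrix.smul_apply, Matrix.vecMulVec_apply, smul_eq_mul, Pi.smul_apply]
      ring

lemma Mm_entry (x : Fin 2 × Bool) (i j : Fin 2) :
    ((Mm x) i j).natDegree ≤ 2 ∧ ((Mm x) i j).coeff 2 = Qm x i j := by
  have : Mm x i j = C (Qm x i j) * X ^ 2 + C (Qm (x.1, !x.2) i j) := by
    simp only [Mm, Matrix.add_apply, Matrix.smul_apply, Matrix.map_apply, smul_eq_mul]
    ring
  rw [this]
  constructor
  · compute_degree
  · simp [coeff_C]

lemma prodM (L : List (Fin 2 × Bool)) : ∀ i j : Fin 2,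
    ((L.map Mm).prod i j).natDegree ≤ 2 * L.length ∧
      ((L.map Mm).prod i j).coeff (2 * L.length) = (L.map Qm).prod i j := by
  induction L with
  | nil =>
    intro i j
    fin_cases i <;> fin_cases j <;> simp
  | cons x L ih =>
    intro i j
    have e : 2 * (x :: L).length = 2 + 2 * L.length := by simp; ring
    rw [List.map_cons, List.prod_cons, Matrix.mul_apply, Fin.sum_univ_two, List.map_cons,
      List.prod_cons, Matrix.mul_apply, Fin.sum_univ_two, e]
    constructor
    · refine (natDegree_add_le _ _).trans (max_le ?_ ?_)
      · exact natDegree_mul_le_of_le (Mm_entry _ _ _).1 (ih _ _).1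
      · exact natDegree_mul_le_of_le (Mm_entry _ _ _).1 (ih _ _).1
    · rw [coeff_add, coeff_mul_add_eq_of_natDegree_le (Mm_entry _ _ _).1 (ih _ _).1,
        coeff_mul_add_eq_of_natDegree_le (Mm_entry _ _ _).1 (ih _ _).1, (Mm_entry _ _ _).2,
        (Mm_entry _ _ _).2, (ih _ _).2, (ih _ _).2]

lemma tr_prodM (L : List (Fin 2 × Bool)) (hL : FreeGroup.IsCyclicallyReduced L) (hne : L ≠ []) :
    (L.map Mm).prod.trace ≠ 2 * X ^ L.length := by
  obtain ⟨x, L, rfl⟩ := List.exists_cons_of_ne_nil hne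
  obtain ⟨c, hc, y, hy, e⟩ := prodQ x L hL.1
  intro h
  have h1 := congrArg (fun p => coeff p (2 * (x :: L).length)) h
  have h3 : coeff (2 * X ^ (x :: L).length : ℚ[X]) (2 * (x :: L).length) = 0 := by
    have : (2 * X ^ (x :: L).length : ℚ[X]) = C 2 * X ^ (x :: L).length := by rw [map_ofNat C]
    rw [this, coeff_C_mul, coeff_X_pow, if_neg, mul_zero]
    simp only [List.length_cons]
    omega
  rw [h3, Matrix.trace_fin_two, coeff_add, (prodM _ _ _).2, (prodM _ _ _).2, e] at h1
  apply uvec_dot x y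
  · intro h
    exact (hL.2 y hy x (by simp) h.symm).symm
  · have : c * (uvec x ⬝ᵥ uvec y) = 0 := by
      rw [← h1]
      simp [Matrix.vecMulVec, dotProduct, Fin.sum_univ_two]
      ring
    exact (mul_eq_zero.1 this).resolve_left hc

abbrev KK := AlgebraicClosure (RatFunc ℚ)

noncomputable def ev : ℚ[X] →+* KK := (algebraMap (RatFunc ℚ) KK).comp (algebraMap ℚ[X] (RatFunc ℚ))

lemma ev_inj : Function.Injective ev :=
  (algebraMap (RatFunc ℚ) KK).injective.comp (RatFunc.algebraMap_injective ℚ)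

lemma evX : ev X ≠ 0 := by
  intro h
  exact X_ne_zero (ev_inj (h.trans (map_zero ev).symm))

noncomputable def repM (x : Fin 2 × Bool) : Matrix (Fin 2) (Fin 2) KK :=
  (ev X)⁻¹ • (Mm x).map ev

lemma repM_det (x : Fin 2 × Bool) : (repM x).det = 1 := by
  have h : (Mm x).det = X ^ 2 := by
    have k2 : (C (2⁻¹ : ℚ)) * 2 = (1 : ℚ[X]) := by rw [← map_ofNat C, ← C_mul]; norm_num
    obtain ⟨i, e⟩ := x
    fin_cases i <;> cases e <;>
      simp [Mm, Qm, uvec, usc, Matrix.det_fin_two, Matrix.vecMulVec, Matrix.map_apply] <;>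
      linear_combination (X ^ 2 * (C (2⁻¹ : ℚ) * 2 + 1) : ℚ[X]) * k2
  have h2 : ((Mm x).map ev).det = (ev X) ^ 2 := by
    rw [← map_pow, ← h, RingHom.map_det]; rfl
  rw [repM, Matrix.det_smul, h2, Fintype.card_fin]
  have := evX
  field_simp

lemma repM_mul (i : Fin 2) (e : Bool) : repM (i, e) * repM (i, !e) = 1 := by
  have h : Mm (i, e) * Mm (i, !e) = (X ^ 2 : ℚ[X]) • 1 := by
    have k2 : (C (2⁻¹ : ℚ)) * 2 = (1 : ℚ[X]) := by rw [← map_ofNat C, ← C_mul]; norm_num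
    refine Matrix.ext fun a b => ?_
    fin_cases i <;> cases e <;> fin_cases a <;> fin_cases b <;>
      simp [Mm, Qm, uvec, usc, Matrix.mul_apply, Fin.sum_univ_two, Matrix.vecMulVec, Matrix.map_apply] <;>
      first | done | (ring; done) | linear_combination (X ^ 2 * (C (2⁻¹ : ℚ) * 2 + 1) : ℚ[X]) * k2
  have h2 : (Mm (i, e)).map ev * (Mm (i, !e)).map ev = (ev X ^ 2) • 1 := by
    rw [← Matrix.map_mul, h]
    ext a b
    fin_cases a <;> fin_cases b <;> simp
  rw [repM, repM, smul_mul_smul_comm, h2, smul_smul]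
  have := evX
  field_simp
  simp

noncomputable def repU (x : Fin 2 × Bool) : (Matrix (Fin 2) (Fin 2) KK)ˣ :=
  ⟨repM x, repM (x.1, !x.2), repM_mul x.1 x.2, by simpa using repM_mul x.1 (!x.2)⟩

noncomputable def rep : FreeGroup (Fin 2) →* (Matrix (Fin 2) (Fin 2) KK)ˣ :=
  FreeGroup.lift fun i => repU (i, true)

lemma rep_det (g : FreeGroup (Fin 2)) : (rep g : Matrix (Fin 2) (Fin 2) KK).det = 1 := by
  have : ((Units.map Matrix.detMonoidHom).comp rep) = 1 := by
    apply FreeGroup.ext_hom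
    intro i
    apply Units.ext
    simp [rep, repU, repM_det]
  have h := congrArg Units.val (DFunLike.congr_fun this g)
  simpa using h

lemma rep_mk (L : List (Fin 2 × Bool)) : rep (FreeGroup.mk L) = (L.map repU).prod := by
  rw [rep, FreeGroup.lift_mk]
  congr 1
  apply List.map_congr_left
  rintro ⟨i, e⟩ -
  cases e
  · apply Units.ext
    rfl
  · rfl

lemma prod_repM (L : List (Fin 2 × Bool)) :
    ((L.map repU).prod : Matrix (Fin 2) (Fin 2) KK) = ((ev X)⁻¹) ^ L.length • ((L.map Mm).prod).map ev := by
  induction L with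
  | nil => simp
  | cons x L ih =>
    rw [List.map_cons, List.prod_cons, Units.val_mul, ih, List.map_cons, List.prod_cons,
      Matrix.map_mul]
    show repM x * _ = _
    rw [repM, smul_mul_smul_comm, List.length_cons, pow_succ']

lemma rep_trace_cyc (L : List (Fin 2 × Bool)) (hL : FreeGroup.IsCyclicallyReduced L) (hne : L ≠ []) :
    (rep (FreeGroup.mk L) : Matrix (Fin 2) (Fin 2) KK).trace ≠ 2 := by
  rw [rep_mk, prod_repM, Matrix.trace_smul]
  intro h
  apply tr_prodM L hL hne
  apply ev_inj
  have h1 : ev (L.map Mm).prod.trace = ((L.map Mm).prod.map ev).trace := by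
    rw [Matrix.trace_fin_two, Matrix.trace_fin_two, map_add]; rfl
  rw [h1, map_mul, map_pow, ← mul_comm (ev X ^ _), map_ofNat, ← h, smul_eq_mul, ← mul_assoc, ← mul_pow,
    mul_inv_cancel₀ evX, one_pow, one_mul]

theorem rep_trace (g : FreeGroup (Fin 2)) (hg : g ≠ 1) :
    (rep g : Matrix (Fin 2) (Fin 2) KK).trace ≠ 2 := by
  have hr : FreeGroup.IsReduced g.toWord := FreeGroup.isReduced_toWord
  have h1 := FreeGroup.reduceCyclically.conj_conjugator_reduceCyclically g.toWord
  have h2 := FreeGroup.reduceCyclically.isCyclicallyReduced hr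
  set L := FreeGroup.reduceCyclically g.toWord
  set c := FreeGroup.reduceCyclically.conjugator g.toWord
  have hgc : g = FreeGroup.mk c * FreeGroup.mk L * (FreeGroup.mk c)⁻¹ := by
    rw [FreeGroup.inv_mk, FreeGroup.mul_mk, FreeGroup.mul_mk, h1, FreeGroup.mk_toWord]
  have hL : L ≠ [] := by
    intro h
    rw [h] at hgc
    apply hg
    rw [hgc, ← FreeGroup.one_eq_mk]
    group
  have := rep_trace_cyc L h2 hL
  rw [hgc, map_mul, map_mul, map_inv, Units.val_mul, Matrix.trace_mul_comm,
    ← Units.val_mul]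
  simpa [mul_assoc] using this

end FGA

namespace FGA

open Polynomial Matrix

/-- Alternation conditions on a list of syllables. -/
def NFok {W V : Type*} (PW : W → Prop) (PV : V → Prop) : List (W × V) → Prop
  | [] => True
  | p :: r => PW p.1 ∧ (r ≠ [] → PV p.2) ∧ NFok PW PV r

abbrev F2 := FreeGroup (Fin 2)
abbrev MK := Matrix (Fin 2) (Fin 2) KK

lemma exists_diag (c : F2) (hc : c ≠ 1) : ∃ (R : F2 →* MKˣ) (l m : KK),
    l * m = 1 ∧ l ≠ m ∧ (R c : MK) = !![l, 0; 0, m] ∧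
    (∀ g, (R g : MK).det = 1) ∧ ∀ g, g ≠ 1 → (R g : MK).trace ≠ 2 := by
  set M : MK := (rep c : MK) with hM
  have hdet : M.det = 1 := rep_det c
  obtain ⟨l, hl⟩ := IsAlgClosed.exists_root (X ^ 2 - C M.trace * X + 1 : KK[X]) (by
    have : (X ^ 2 - C M.trace * X + 1 : KK[X]).degree = 2 := by compute_degree!
    rw [this]; norm_num)
  have hl : l ^ 2 - M.trace * l + 1 = 0 := by simpa using hl
  have hl0 : l ≠ 0 := by rintro rfl; simp at hl
  set m := M.trace - l with hm
  have hlm : l * m = 1 := by rw [hm]; linear_combination -hl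
  have hne : l ≠ m := by
    intro h
    have h1 : M.trace = 2 * l := by rw [two_mul]; nth_rewrite 2 [h]; rw [hm]; ring
    have h2 : l ^ 2 = 1 := by rw [h1] at hl; linear_combination -hl
    have hcc : c ^ 2 ≠ 1 := by
      intro h; exact hc ((pow_eq_one_iff_left (by norm_num)).1 h)
    apply rep_trace _ hcc
    rw [map_pow, Units.val_pow_eq_pow_val, ← hM, pow_two, Matrix.trace_fin_two, Matrix.mul_apply, Matrix.mul_apply]
    rw [Matrix.det_fin_two] at hdet
    rw [Matrix.trace_fin_two] at h1
    simp only [Fin.sum_univ_two]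
    linear_combination (M 0 0 + M 1 1 + 2 * l) * h1 - 2 * hdet + 4 * h2
  have eig : ∀ x : KK, x ^ 2 - M.trace * x + 1 = 0 → ∃ v ≠ 0, M *ᵥ v = x • v := by
    intro x hx
    have : (M - x • (1 : MK)).det = 0 := by
      rw [Matrix.det_fin_two]
      rw [Matrix.det_fin_two] at hdet
      rw [Matrix.trace_fin_two] at hx
      simp
      linear_combination hx + hdet
    obtain ⟨v, hv, h⟩ := Matrix.exists_mulVec_eq_zero_iff.2 this
    refine ⟨v, hv, ?_⟩
    rw [Matrix.sub_mulVec, Matrix.smul_mulVec, Matrix.one_mulVec] at h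
    exact sub_eq_zero.1 h
  obtain ⟨v, hv, hv2⟩ := eig l hl
  obtain ⟨u, hu, hu2⟩ := eig m (by rw [hm]; linear_combination hl)
  set P : MK := !![v 0, u 0; v 1, u 1] with hP
  have e0 := congrFun hv2 0
  have e1 := congrFun hv2 1
  have f0 := congrFun hu2 0
  have f1 := congrFun hu2 1
  simp [Matrix.mulVec, dotProduct, Fin.sum_univ_two] at e0 e1 f0 f1
  have hPd : P.det ≠ 0 := by
    intro h
    have hvu : v 0 * u 1 - u 0 * v 1 = 0 := by simpa [hP, Matrix.det_fin_two] using h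
    have hlm' : l - m ≠ 0 := sub_ne_zero.2 hne
    by_cases hv0 : v 0 = 0
    · have hv1 : v 1 ≠ 0 := by
        intro h1; apply hv; ext i; fin_cases i <;> simp [hv0, h1]
      have hu0 : u 0 = 0 := by
        rw [hv0] at hvu
        simpa [hv1] using hvu
      apply hu
      have : (l - m) * (v 1 * u 1) = 0 := by
        linear_combination  -u 1 * e1 + v 1 * f1 + M 1 0 * hvu
      ext i
      fin_cases i
      · simpa using hu0
      · simpa [hlm', hv1] using this
    · have h00 : (l - m) * (v 0 * u 0) = 0 := by
        linear_combination  -u 0 * e0 + v 0 * f0 - M 0 1 * hvu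
      have hu0 : u 0 = 0 := by simpa [hlm', hv0] using h00
      have hu1 : u 1 = 0 := by simpa [hu0, hv0] using hvu
      apply hu; ext i; fin_cases i <;> simp [hu0, hu1]
  set Pu : MKˣ := Matrix.nonsingInvUnit P (isUnit_iff_ne_zero.2 hPd)
  have hPu : (Pu : MK) = P := rfl
  have conjv : ∀ g, (((MulAut.conj Pu⁻¹).toMonoidHom.comp rep) g : MK)
      = (Pu⁻¹ : MKˣ) * (rep g : MK) * Pu := by
    intro g; simp
  refine ⟨(MulAut.conj Pu⁻¹).toMonoidHom.comp rep, l, m, hlm, hne, ?_, ?_, ?_⟩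
  · rw [conjv, mul_assoc, Units.inv_mul_eq_iff_eq_mul, hPu, ← hM]
    ext i j
    fin_cases i <;> fin_cases j <;> simp [hP, Matrix.mul_apply, Fin.sum_univ_two]
    · linear_combination e0
    · linear_combination f0
    · linear_combination e1
    · linear_combination f1
  · intro g
    rw [conjv, Matrix.det_mul, Matrix.det_mul, rep_det, mul_one, ← Matrix.det_mul, ← Units.val_mul]
    simp
  · intro g hg
    rw [conjv, Matrix.trace_mul_comm, ← mul_assoc, ← Units.val_mul]
    simpa using rep_trace g hg

lemma inv_entries (A : MKˣ) (h : (A : MK).det = 1) :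
    ((A⁻¹ : MKˣ) : MK) = !![(A : MK) 1 1, - (A : MK) 0 1; - (A : MK) 1 0, (A : MK) 0 0] := by
  rw [Matrix.coe_units_inv, Matrix.inv_def, h, Matrix.adjugate_fin_two]
  simp

lemma comm_trace (V D : MKˣ) (l m : KK) (hlm : l * m = 1) (hD : (D : MK) = !![l, 0; 0, m])
    (hV : (V : MK).det = 1) (h : (V : MK) 1 0 = 0 ∨ (V : MK) 0 1 = 0) :
    ((V * D * V⁻¹ * D⁻¹ : MKˣ) : MK).trace = 2 := by
  have hDd : (D : MK).det = 1 := by rw [hD, Matrix.det_fin_two]; simpa using hlm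
  rw [Units.val_mul, Units.val_mul, Units.val_mul, inv_entries V hV, inv_entries D hDd, hD,
    Matrix.trace_fin_two]
  rw [Matrix.det_fin_two] at hV
  simp only [Matrix.mul_apply, Fin.sum_univ_two]
  rcases h with h | h <;> rw [h] at hV ⊢ <;> simp at hV ⊢ <;>
    linear_combination 2 * l * m * hV + 2 * hlm

lemma noncomm_ne {R : F2 →* MKˣ} {c v : F2} {l m : KK} (hlm : l * m = 1)
    (hD : (R c : MK) = !![l, 0; 0, m]) (hdet : ∀ g, (R g : MK).det = 1)
    (htr : ∀ g, g ≠ 1 → (R g : MK).trace ≠ 2) (h : v * c ≠ c * v) :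
    (R v : MK) 1 0 ≠ 0 ∧ (R v : MK) 0 1 ≠ 0 := by
  have hne : v * c * v⁻¹ * c⁻¹ ≠ 1 := by
    intro h2; apply h
    rw [mul_inv_eq_one, mul_inv_eq_iff_eq_mul] at h2; exact h2
  have h1 := htr _ hne
  constructor <;> intro h3 <;> apply h1 <;> rw [map_mul, map_mul, map_mul, map_inv, map_inv]
  · exact comm_trace _ _ l m hlm hD (hdet v) (Or.inl h3)
  · exact comm_trace _ _ l m hlm hD (hdet v) (Or.inr h3)

lemma bp_poly {R : F2 →* MKˣ} {c : F2} {l m : KK} (hlm : l * m = 1)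
    (hD : (R c : MK) = !![l, 0; 0, m]) (L : List (F2 × F2)) (hL : L ≠ [])
    (h : NFok (fun w => (R w : MK) 0 1 ≠ 0) (fun v => (R v : MK) 1 0 ≠ 0) L) :
    ∃ (e : Fin 2 → KK) (p q : KK[X]), p.natDegree ≤ 2 * L.length ∧ p.coeff (2 * L.length) ≠ 0 ∧
      q.natDegree < 2 * L.length ∧ ∀ N : ℕ,
        ((l ^ 2) ^ N) ^ L.length •
          ((R (L.map fun p => c ^ N * p.1 * (c ^ N)⁻¹ * p.2).prod : MK) *ᵥ e) =
        ![p.eval ((l ^ 2) ^ N), q.eval ((l ^ 2) ^ N)] := by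
  have hdiag : ∀ N : ℕ, (R (c ^ N) : MK) = !![l ^ N, 0; 0, m ^ N] := by
    intro N
    rw [map_pow, Units.val_pow_eq_pow_val, hD]
    induction N with
    | zero => ext i j; fin_cases i <;> fin_cases j <;> simp
    | succ N ih =>
      rw [pow_succ, ih]
      ext i j; fin_cases i <;> fin_cases j <;> simp [Matrix.mul_apply, Fin.sum_univ_two, pow_succ]
  have hdiag' : ∀ N : ℕ, (R (c ^ N)⁻¹ : MK) = !![m ^ N, 0; 0, l ^ N] := by
    intro N
    have : (R (c ^ N) : MK).det = 1 := by
      rw [hdiag, Matrix.det_fin_two]; simp [← mul_pow, hlm]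
    rw [map_inv, inv_entries _ this, hdiag]
    simp
  have hconj : ∀ (N : ℕ) (w : F2), (l ^ 2) ^ N • (R (c ^ N * w * (c ^ N)⁻¹) : MK) =
      !![(R w : MK) 0 0 * (l ^ 2) ^ N, (R w : MK) 0 1 * ((l ^ 2) ^ N) ^ 2;
        (R w : MK) 1 0, (R w : MK) 1 1 * (l ^ 2) ^ N] := by
    intro N w
    have h1 : l ^ N * m ^ N = 1 := by rw [← mul_pow, hlm, one_pow]
    rw [map_mul, map_mul, Units.val_mul, Units.val_mul, hdiag, hdiag', ← pow_mul, mul_comm 2 N, pow_mul]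
    generalize l ^ N = a at *
    generalize m ^ N = b at *
    rw [Matrix.eta_fin_two (R w : MK), Matrix.mul_fin_two, Matrix.mul_fin_two]
    ext i j
    fin_cases i <;> fin_cases j <;> simp
    · linear_combination (a ^ 2 * (R w : MK) 0 0) * h1
    · ring
    · linear_combination ((R w : MK) 1 0) * (a * b + 1) * h1
    · linear_combination (a ^ 2 * (R w : MK) 1 1) * h1
  induction L with
  | nil => exact absurd rfl hL
  | cons x L ih =>
    obtain ⟨w, v⟩ := x
    obtain ⟨hw, hv, hr⟩ := h
    simp only at hw hv
    -- the step
    have step : ∀ (k : ℕ) (e : Fin 2 → KK) (p q : KK[X]), p.natDegree ≤ k → q.natDegree ≤ k →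
        q.coeff k ≠ 0 →
        ∃ p' q' : KK[X], p'.natDegree ≤ k + 2 ∧ p'.coeff (k + 2) ≠ 0 ∧ q'.natDegree < k + 2 ∧
          ∀ (N : ℕ) (u : Fin 2 → KK), u = ![p.eval ((l ^ 2) ^ N), q.eval ((l ^ 2) ^ N)] →
            (l ^ 2) ^ N • ((R (c ^ N * w * (c ^ N)⁻¹) : MK) *ᵥ u) =
              ![p'.eval ((l ^ 2) ^ N), q'.eval ((l ^ 2) ^ N)] := by
      intro k e p q hp hq hq2
      refine ⟨C ((R w : MK) 0 0) * p * X + C ((R w : MK) 0 1) * q * X ^ 2,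
        C ((R w : MK) 1 0) * p + C ((R w : MK) 1 1) * q * X, ?_, ?_, ?_, ?_⟩
      · refine (natDegree_add_le _ _).trans (max_le ?_ ?_)
        · refine (natDegree_mul_le_of_le (natDegree_C_mul_le _ _ |>.trans hp) natDegree_X_le).trans (by omega)
        · refine (natDegree_mul_le_of_le (natDegree_C_mul_le _ _ |>.trans hq) (natDegree_X_pow_le 2))
      · rw [coeff_add, show k + 2 = (k + 1) + 1 from rfl, coeff_mul_X, coeff_C_mul,
          coeff_eq_zero_of_natDegree_lt (by omega : p.natDegree < k + 1), mul_zero, zero_add,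
          show k + 1 + 1 = k + 2 from rfl, coeff_mul_X_pow, coeff_C_mul]
        exact mul_ne_zero hw hq2
      · refine lt_of_le_of_lt (natDegree_add_le _ _) (max_lt ?_ ?_)
        · exact lt_of_le_of_lt (natDegree_C_mul_le _ _ |>.trans hp) (by omega)
        · exact lt_of_le_of_lt (natDegree_mul_le_of_le (natDegree_C_mul_le _ _ |>.trans hq) natDegree_X_le) (by omega)
      · intro N u hu
        rw [← Matrix.smul_mulVec, hconj, hu]
        ext i
        fin_cases i <;> simp <;> ring
    by_cases hL0 : L = []
    · subst hL0
      obtain ⟨p', q', h1, h2, h3, h4⟩ := step 0 0 0 1 (by simp) (by simp) (by simp)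
      refine ⟨(R v⁻¹ : MK) *ᵥ ![0, 1], p', q', by simpa using h1, by simpa using h2, by simpa using h3, ?_⟩
      intro N
      rw [← h4 N ((R v : MK) *ᵥ ((R v⁻¹ : MK) *ᵥ ![0, 1]))]
      · rw [List.map_cons, List.map_nil, List.prod_cons, List.prod_nil, mul_one, map_mul, Units.val_mul,
          List.length_singleton, pow_one, Matrix.mulVec_mulVec, Matrix.mulVec_mulVec,
          Matrix.mulVec_mulVec, mul_assoc]
      · rw [Matrix.mulVec_mulVec, ← Units.val_mul, ← map_mul]; simp
    · obtain ⟨e, p, q, h1, h2, h3, h4⟩ := ih hL0 hr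
      have hv := hv hL0
      obtain ⟨p', q', k1, k2, k3, k4⟩ := step (2 * L.length) e
        (C ((R v : MK) 0 0) * p + C ((R v : MK) 0 1) * q)
        (C ((R v : MK) 1 0) * p + C ((R v : MK) 1 1) * q)
        ((natDegree_add_le _ _).trans (max_le (natDegree_C_mul_le _ _ |>.trans h1)
          (natDegree_C_mul_le _ _ |>.trans h3.le)))
        ((natDegree_add_le _ _).trans (max_le (natDegree_C_mul_le _ _ |>.trans h1)
          (natDegree_C_mul_le _ _ |>.trans h3.le)))
        (by
          rw [coeff_add, coeff_C_mul, coeff_C_mul, coeff_eq_zero_of_natDegree_lt h3, mul_zero, add_zero]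
          exact mul_ne_zero hv h2)
      have el : 2 * ((w, v) :: L).length = 2 * L.length + 2 := by simp; ring
      refine ⟨e, p', q', by rw [el]; exact k1, by rw [el]; exact k2, by rw [el]; exact k3, ?_⟩
      intro N
      rw [← k4 N ((R v : MK) *ᵥ (((l ^ 2) ^ N) ^ L.length •
          ((R (L.map fun p => c ^ N * p.1 * (c ^ N)⁻¹ * p.2).prod : MK) *ᵥ e)))]
      · rw [List.map_cons, List.prod_cons, map_mul, map_mul, Units.val_mul, Units.val_mul,
          List.length_cons, pow_succ']
        simp only [Matrix.mulVec_smul, ← Matrix.mulVec_mulVec, smul_smul]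
      · rw [h4]
        ext i
        fin_cases i <;> simp

theorem NFok.imp {W V : Type*} {PW PW' : W → Prop} {PV PV' : V → Prop} (h1 : ∀ w, PW w → PW' w)
    (h2 : ∀ v, PV v → PV' v) (L : List (W × V)) (h : NFok PW PV L) : NFok PW' PV' L := by
  induction L with
  | nil => trivial
  | cons p L ih => exact ⟨h1 _ h.1, fun hh => h2 _ (h.2.1 hh), ih h.2.2⟩

/-- The big powers property. -/
theorem big_powers (c g0 : F2) (L : List (F2 × F2)) (hL : L ≠ [])
    (h : NFok (fun w => w * c ≠ c * w) (fun v => v * c ≠ c * v) L) :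
    ∀ᶠ N : ℕ in Filter.atTop,
      g0 * (L.map fun p => c ^ N * p.1 * (c ^ N)⁻¹ * p.2).prod ≠ 1 := by
  have hc : c ≠ 1 := by
    rintro rfl
    obtain ⟨x, L, rfl⟩ := List.exists_cons_of_ne_nil hL
    exact h.1 (by simp)
  obtain ⟨R, l, m, hlm, hne, hD, hdet, htr⟩ := exists_diag c hc
  obtain ⟨e, p, q, h1, h2, h3, h4⟩ := bp_poly hlm hD L hL
    (NFok.imp (fun w hw => (noncomm_ne hlm hD hdet htr hw).2)
      (fun w hw => (noncomm_ne hlm hD hdet htr hw).1) L h)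
  have hlpow : ∀ n : ℕ, n ≠ 0 → l ^ n ≠ 1 := by
    intro n hn hh
    apply htr (c ^ n)
    · intro h; exact hc ((pow_eq_one_iff_left hn).1 h)
    · have h5 : (R (c ^ n) : MK) = !![l ^ n, 0; 0, m ^ n] := by
        rw [map_pow, Units.val_pow_eq_pow_val, hD]
        clear hh hn
        induction n with
        | zero => ext i j; fin_cases i <;> fin_cases j <;> simp
        | succ N ih =>
          rw [pow_succ, ih]
          ext i j; fin_cases i <;> fin_cases j <;> simp [Matrix.mul_apply, Fin.sum_univ_two, pow_succ]
      have h6 : m ^ n = 1 := by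
        have : l ^ n * m ^ n = 1 := by rw [← mul_pow, hlm, one_pow]
        rwa [hh, one_mul] at this
      rw [h5, hh, h6, Matrix.trace_fin_two]; simp; norm_num
  have hinj : Function.Injective (fun N : ℕ => (l ^ 2) ^ N) := by
    intro a b hab
    have l0 : l ≠ 0 := left_ne_zero_of_mul_eq_one hlm
    by_contra hh
    wlog hlt : a < b generalizing a b
    · exact this hab.symm (Ne.symm hh) (by omega)
    · apply hlpow (2 * (b - a)) (by omega)
      simp only at hab
      obtain ⟨d, rfl⟩ := Nat.exists_eq_add_of_lt hlt
      rw [show a + d + 1 - a = d + 1 by omega, pow_mul]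
      rw [add_assoc, pow_add] at hab
      exact (mul_eq_left₀ (pow_ne_zero _ (pow_ne_zero _ l0))).1 hab.symm
  set k : KK := ((R g0⁻¹ : MK) *ᵥ e) 0 with hk
  have hpoly : p - C k * X ^ L.length ≠ 0 := by
    intro h5
    apply h2
    rw [sub_eq_zero.1 h5, coeff_C_mul, coeff_X_pow, if_neg, mul_zero]
    have := List.length_pos_iff.2 hL
    omega
  have hfin : {y : KK | (p - C k * X ^ L.length).IsRoot y}.Finite :=
    Polynomial.finite_setOfPred_isRoot hpoly
  have := hinj.tendsto_cofinite.eventually hfin.compl_mem_cofinite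
  rw [Nat.cofinite_eq_atTop] at this
  filter_upwards [this] with N hN heq
  apply hN
  have h6 : (L.map fun p => c ^ N * p.1 * (c ^ N)⁻¹ * p.2).prod = g0⁻¹ := by
    rw [eq_comm, inv_eq_iff_mul_eq_one]; exact heq
  have h7 := congrFun (h4 N) 0
  rw [h6] at h7
  simp only [Pi.smul_apply, ← hk] at h7
  show eval _ _ = 0
  simp at h7 ⊢
  rw [← h7]; ring

end FGA

namespace FGA

lemma isReduced_pow {α : Type*} (d : α → ℕ) (hd : ∀ i, d i ≠ 0) (L : List (α × Bool))
    (h : FreeGroup.IsReduced L) :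
    FreeGroup.IsReduced (L.flatMap fun x => List.replicate (d x.1) x) ∧
      (L.flatMap fun x => List.replicate (d x.1) x).head? = L.head? := by
  induction L with
  | nil => simp
  | cons x L ih =>
    rw [FreeGroup.IsReduced, List.isChain_cons] at h
    obtain ⟨ih1, ih2⟩ := ih h.2
    rw [List.flatMap_cons]
    constructor
    · rw [FreeGroup.IsReduced, List.isChain_append]
      refine ⟨?_, ih1, ?_⟩
      · rw [List.isChain_iff_getElem]
        intro i hi
        simp
      · intro a ha b hb
        rw [ih2] at hb
        have : a = x := by
          have := List.mem_of_mem_getLast? ha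
          exact List.eq_of_mem_replicate this
        subst this
        exact h.1 b hb
    · obtain ⟨n, hn⟩ := Nat.exists_eq_succ_of_ne_zero (hd x.1)
      rw [hn, List.replicate_succ]
      simp

theorem powmap_inj {α : Type*} [DecidableEq α] (d : α → ℕ) (hd : ∀ i, d i ≠ 0) :
    Function.Injective (FreeGroup.lift fun i : α => (FreeGroup.of i) ^ d i) := by
  rw [injective_iff_map_eq_one]
  intro g hg
  have key : ∀ L : List (α × Bool), FreeGroup.lift (fun i : α => (FreeGroup.of i) ^ d i) (FreeGroup.mk L)
      = FreeGroup.mk (L.flatMap fun x => List.replicate (d x.1) x) := by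
    intro L
    induction L with
    | nil => rw [List.flatMap_nil, ← FreeGroup.one_eq_mk, map_one]
    | cons x L ih =>
      have : FreeGroup.mk (x :: L) = FreeGroup.mk [x] * FreeGroup.mk L := by
        rw [FreeGroup.mul_mk]; rfl
      rw [this, map_mul, ih, List.flatMap_cons, ← FreeGroup.mul_mk]
      congr 1
      have h2 : ∀ n, FreeGroup.mk (List.replicate n x) = (FreeGroup.mk [x]) ^ n := by
        intro n
        induction n with
        | zero => rw [List.replicate_zero, ← FreeGroup.one_eq_mk, pow_zero]
        | succ n ihn => rw [List.replicate_succ, pow_succ', ← ihn, FreeGroup.mul_mk]; rfl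
      rw [h2]
      obtain ⟨i, e⟩ := x
      cases e
      · have : FreeGroup.mk [(i, false)] = (FreeGroup.of i)⁻¹ := rfl
        rw [this, map_inv, FreeGroup.lift_apply_of, inv_pow]
      · have : FreeGroup.mk [(i, true)] = FreeGroup.of i := rfl
        rw [this, FreeGroup.lift_apply_of]
  rw [← FreeGroup.mk_toWord (x := g), key] at hg
  have hr := isReduced_pow d hd g.toWord FreeGroup.isReduced_toWord
  have h1 : (FreeGroup.mk (g.toWord.flatMap fun x => List.replicate (d x.1) x)).toWord = [] := by
    rw [hg]; simp
  rw [FreeGroup.toWord_mk, hr.1.reduce_eq] at h1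
  rw [h1] at hr
  have h2 := hr.2
  rw [List.head?_nil, eq_comm, List.head?_eq_none_iff] at h2
  exact FreeGroup.toWord_eq_nil_iff.1 h2

lemma free_comm_subsingleton {ι : Type*} (h : ∀ x y : FreeGroup ι, x * y = y * x) : Subsingleton ι := by
  classical
  constructor
  intro i j
  by_contra hij
  have h1 := congrArg (FreeGroup.lift fun k : ι =>
    if k = i then (Equiv.swap 0 1 : Equiv.Perm (Fin 3)) else Equiv.swap 1 2) (h (FreeGroup.of i) (FreeGroup.of j))
  simp [Ne.symm hij] at h1
  revert h1
  decide

theorem commuting {F : Type*} [Group F] [IsFreeGroup F] (x c : F) (h : x * c = c * x)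
    (hroot : ∀ (g : F) (k : ℤ), c = g ^ k → k = 1 ∨ k = -1) : x ∈ Subgroup.zpowers c := by
  let H := Subgroup.closure ({x, c} : Set F)
  have hcomm : ∀ a ∈ H, ∀ b ∈ H, a * b = b * a := by
    have : IsMulCommutative H := Subgroup.isMulCommutative_closure (by
      rintro a (rfl | rfl) b (rfl | rfl) <;> simp [h])
    intro a ha b hb
    exact congrArg Subtype.val (mul_comm' (⟨a, ha⟩ : H) ⟨b, hb⟩)
  have hsub : Subsingleton (IsFreeGroup.Generators H) := by
    apply free_comm_subsingleton
    intro a b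
    apply (IsFreeGroup.mulEquiv H).injective
    rw [map_mul, map_mul]
    apply Subtype.ext
    exact hcomm _ (Subtype.property _) _ (Subtype.property _)
  have hcyc : ∃ u : FreeGroup (IsFreeGroup.Generators H), ∀ a, ∃ k : ℤ, a = u ^ k := by
    rcases isEmpty_or_nonempty (IsFreeGroup.Generators H) with he | ⟨⟨i⟩⟩
    · exact ⟨1, fun a => ⟨0, Subsingleton.elim _ _⟩⟩
    · refine ⟨FreeGroup.of i, fun a => ?_⟩
      induction a using FreeGroup.induction_on with
      | C1 => exact ⟨0, by simp⟩
      | of j => exact ⟨1, by rw [Subsingleton.elim j i]; simp⟩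
      | inv_of j _ => exact ⟨-1, by rw [Subsingleton.elim j i]; simp⟩
      | mul x y hx hy =>
        obtain ⟨k, rfl⟩ := hx
        obtain ⟨l, rfl⟩ := hy
        exact ⟨k + l, by rw [zpow_add]⟩
  obtain ⟨u, hu⟩ := hcyc
  have hu2 : ∀ a ∈ H, ∃ k : ℤ, a = ((IsFreeGroup.mulEquiv H u : H) : F) ^ k := by
    intro a ha
    obtain ⟨k, hk⟩ := hu ((IsFreeGroup.mulEquiv H).symm ⟨a, ha⟩)
    refine ⟨k, ?_⟩
    have := congrArg (IsFreeGroup.mulEquiv H) hk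
    rw [MulEquiv.apply_symm_apply, map_zpow] at this
    exact congrArg Subtype.val this
  obtain ⟨k, hk⟩ := hu2 c (Subgroup.subset_closure (by simp))
  obtain ⟨n, hn⟩ := hu2 x (Subgroup.subset_closure (by simp))
  rw [Subgroup.mem_zpowers_iff]
  rcases hroot _ _ hk with rfl | rfl
  · refine ⟨n, ?_⟩
    rw [hn, hk]; simp
  · refine ⟨-n, ?_⟩
    rw [hn, hk]; simp

theorem normal_form {P V W : Type*} [Group P] [Group V] [Group W] (iV : V →* P) (iW : W →* P)
    (cV : V) (cW : W) (hc : iV cV = iW cW) (hgen : iV.range ⊔ iW.range = ⊤) (s : P) :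
    ∃ (g0 : V) (L : List (W × V)),
      NFok (fun w => w ∉ Subgroup.zpowers cW) (fun v => v ∉ Subgroup.zpowers cV) L ∧
        s = iV g0 * (L.map fun p => iW p.1 * iV p.2).prod := by
  let S : Set P := {s | ∃ (g0 : V) (L : List (W × V)),
      NFok (fun w => w ∉ Subgroup.zpowers cW) (fun v => v ∉ Subgroup.zpowers cV) L ∧
        s = iV g0 * (L.map fun p => iW p.1 * iV p.2).prod}
  have hV : ∀ v, ∀ s ∈ S, iV v * s ∈ S := by
    rintro v s ⟨g0, L, hL, rfl⟩
    exact ⟨v * g0, L, hL, by rw [map_mul, mul_assoc]⟩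
  have hCW : ∀ w ∈ Subgroup.zpowers cW, ∃ v ∈ Subgroup.zpowers cV, iV v = iW w := by
    rintro w ⟨k, rfl⟩
    exact ⟨cV ^ k, ⟨k, rfl⟩, by simp [hc]⟩
  have hCV : ∀ v ∈ Subgroup.zpowers cV, ∃ w ∈ Subgroup.zpowers cW, iV v = iW w := by
    rintro w ⟨k, rfl⟩
    exact ⟨cW ^ k, ⟨k, rfl⟩, by simp [hc]⟩
  have hW : ∀ w, ∀ s ∈ S, iW w * s ∈ S := by
    rintro w s ⟨g0, L, hL, rfl⟩
    by_cases hw : w ∈ Subgroup.zpowers cW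
    · obtain ⟨v, -, hv⟩ := hCW w hw
      rw [← hv]
      exact hV v _ ⟨g0, L, hL, rfl⟩
    by_cases h2 : L ≠ [] → g0 ∉ Subgroup.zpowers cV
    · exact ⟨1, (w, g0) :: L, ⟨hw, h2, hL⟩, by simp [mul_assoc]⟩
    · push Not at h2
      obtain ⟨hL0, hg⟩ := h2
      obtain ⟨⟨w1, v1⟩, L, rfl⟩ := List.exists_cons_of_ne_nil hL0
      obtain ⟨w0, hw0, e⟩ := hCV g0 hg
      by_cases h3 : w * w0 * w1 ∈ Subgroup.zpowers cW
      · obtain ⟨v, -, hv⟩ := hCW _ h3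
        refine ⟨v * v1, L, hL.2.2, ?_⟩
        rw [map_mul, hv, e]; simp [mul_assoc]
      · refine ⟨1, (w * w0 * w1, v1) :: L, ⟨h3, hL.2.1, hL.2.2⟩, ?_⟩
        rw [e]; simp [mul_assoc]
  let Q : Subgroup P :=
    { carrier := {p | (∀ s ∈ S, p * s ∈ S) ∧ ∀ s ∈ S, p⁻¹ * s ∈ S}
      mul_mem' := by
        rintro a b ⟨ha, ha'⟩ ⟨hb, hb'⟩
        refine ⟨fun s hs => ?_, fun s hs => ?_⟩
        · rw [mul_assoc]; exact ha _ (hb _ hs)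
        · rw [mul_inv_rev, mul_assoc]; exact hb' _ (ha' _ hs)
      one_mem' := by simp
      inv_mem' := by
        rintro a ⟨ha, ha'⟩
        exact ⟨ha', by simpa using ha⟩ }
  have hQ : Q = ⊤ := by
    rw [eq_top_iff, ← hgen]
    refine sup_le ?_ ?_
    · rintro _ ⟨v, rfl⟩
      exact ⟨hV v, by rw [← map_inv]; exact hV v⁻¹⟩
    · rintro _ ⟨v, rfl⟩
      exact ⟨hW v, by rw [← map_inv]; exact hW v⁻¹⟩
  have hs : s ∈ Q := by rw [hQ]; trivial
  have := hs.1 1 ⟨1, [], trivial, by simp⟩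
  rwa [mul_one] at this

end FGA

namespace FGA

/-- The word `(x^i (y x^k y⁻¹))² x`. -/
def ww (i k : ℕ) {G : Type*} [Group G] (x y : G) : G := (x ^ i * (y * x ^ k * y⁻¹)) ^ 2 * x

lemma map_ww (i k : ℕ) {G H : Type*} [Group G] [Group H] (f : G →* H) (x y : G) :
    f (ww i k x y) = ww i k (f x) (f y) := by
  simp [ww]

lemma ww_conj (i k : ℕ) {G : Type*} [Group G] (g x y : G) :
    ww i k (g * x * g⁻¹) (g * y * g⁻¹) = g * ww i k x y * g⁻¹ := by
  have := map_ww i k (MulAut.conj g).toMonoidHom x y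
  simpa using this.symm

lemma zpow_multInt (g : Multiplicative ℤ) (n : ℤ) : (g ^ n).toAdd = n * g.toAdd := by
  rw [toAdd_zpow, smul_eq_mul]

lemma gen_root {ι : Type*} [DecidableEq ι] (j : ι) (g : FreeGroup ι) (k : ℤ) (h : FreeGroup.of j = g ^ k) :
    k = 1 ∨ k = -1 := by
  have h1 := congrArg (fun x => (FreeGroup.lift (fun i : ι => Multiplicative.ofAdd (if i = j then (1 : ℤ) else 0)) x).toAdd) h
  simp only [map_zpow, zpow_multInt, FreeGroup.lift_apply_of, if_true, toAdd_ofAdd] at h1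
  exact Int.isUnit_iff.1 (IsUnit.of_mul_eq_one _ h1.symm)

lemma zpow_three_of_dvd {G : Type*} [Group G] (g : G) (n : ℤ) (h : 3 ∣ n) : ∃ p : G, g ^ n = p ^ 3 := by
  obtain ⟨m, rfl⟩ := h
  exact ⟨g ^ m, by rw [mul_comm, zpow_mul]; norm_cast⟩

lemma ww_root {i k : ℕ} (e : ℤ) (he : (2 * (i + k) + 1 : ℤ) = e) (he2 : ∀ n : ℤ, n ∣ e → n = 1 ∨ n = -1 ∨ 3 ∣ n)
    (m : ℕ) (x y : Equiv.Perm (Fin m)) (hxy : (ww i k x y) ^ (m.factorial / 3) ≠ 1) (hm : 3 ∣ m.factorial)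
    (g : F2) (n : ℤ) (h : ww i k (FreeGroup.of 0) (FreeGroup.of 1) = g ^ n) : n = 1 ∨ n = -1 := by
  have h1 := congrArg (fun x => (FreeGroup.lift (![Multiplicative.ofAdd (1 : ℤ), 1]) x).toAdd) h
  simp only [map_zpow, zpow_multInt, map_ww, FreeGroup.lift_apply_of] at h1
  have h2 : (ww i k (Multiplicative.ofAdd (1 : ℤ)) 1).toAdd = e := by
    rw [← he]; simp [ww, toAdd_mul, toAdd_pow]
  have h3 : n ∣ e := ⟨_, h2.symm.trans h1⟩
  rcases he2 n h3 with h | h | h3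
  · exact Or.inl h
  · exact Or.inr h
  · exfalso
    obtain ⟨p, hp⟩ := zpow_three_of_dvd g n h3
    rw [hp] at h
    have h4 := congrArg (FreeGroup.lift ![x, y]) h
    rw [map_ww, map_pow] at h4
    simp only [FreeGroup.lift_apply_of] at h4
    apply hxy
    have h5 : ww i k x y = (FreeGroup.lift ![x, y] p) ^ 3 := h4
    rw [h5, ← pow_mul, Nat.mul_div_cancel' hm]
    have : Fintype.card (Equiv.Perm (Fin m)) = m.factorial := by
      rw [Fintype.card_perm, Fintype.card_fin]
    rw [← this, pow_card_eq_one]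

lemma root01 (g : F2) (n : ℤ) (h : ww 0 1 (FreeGroup.of 0) (FreeGroup.of 1) = g ^ n) : n = 1 ∨ n = -1 := by
  refine ww_root 3 (by norm_num) ?_ 3 (finRotate 3) (Equiv.swap 1 2) (by decide +kernel) (by decide) g n h
  intro n hn
  have h1 := Int.le_of_dvd (by norm_num) hn
  have h2 := Int.le_of_dvd (by norm_num) (neg_dvd.2 hn)
  have h3 : -3 ≤ n := by omega
  interval_cases n <;> revert hn <;> decide

lemma root13 (g : F2) (n : ℤ) (h : ww 1 3 (FreeGroup.of 0) (FreeGroup.of 1) = g ^ n) : n = 1 ∨ n = -1 := by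
  refine ww_root 9 (by norm_num) ?_ 5 (Equiv.swap 0 1 * (Equiv.swap 2 3 * Equiv.swap 3 4))
    (Equiv.swap 0 2 * Equiv.swap 1 3) ?_ (by decide) g n h
  · intro n hn
    have h1 := Int.le_of_dvd (by norm_num) hn
    have h2 := Int.le_of_dvd (by norm_num) (neg_dvd.2 hn)
    have h3 : -9 ≤ n := by omega
    interval_cases n <;> revert hn <;> decide
  · have h1 : ww 1 3 (Equiv.swap 0 1 * (Equiv.swap 2 3 * Equiv.swap 3 4) : Equiv.Perm (Fin 5))
      (Equiv.swap 0 2 * Equiv.swap 1 3) = Equiv.swap 0 1 * (Equiv.swap 2 3 * Equiv.swap 3 4) := by decide +kernel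
    have h2 : (Equiv.swap 0 1 * (Equiv.swap 2 3 * Equiv.swap 3 4) : Equiv.Perm (Fin 5)) ^ 6 = 1 := by decide +kernel
    rw [h1]
    have : Nat.factorial 5 / 3 = 6 * 6 + 4 := by decide
    rw [this, pow_add, pow_mul, h2]
    decide +kernel

lemma NFok.map {W V W' V' : Type*} {PW : W' → Prop} {PV : V' → Prop} (f : W → W') (g : V → V')
    (L : List (W × V)) (h : NFok (fun w => PW (f w)) (fun v => PV (g v)) L) :
    NFok PW PV (L.map fun p => (f p.1, g p.2)) := by
  induction L with
  | nil => trivial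
  | cons p L ih => exact ⟨h.1, fun hh => h.2.1 (by simpa using hh), ih h.2.2⟩

lemma NFok.eventually {W V : Type*} {PW : W → Prop} {PV : V → Prop} {PW' : ℕ → W → Prop}
    {PV' : ℕ → V → Prop} (h1 : ∀ w, PW w → ∀ᶠ M in Filter.atTop, PW' M w)
    (h2 : ∀ v, PV v → ∀ᶠ M in Filter.atTop, PV' M v) (L : List (W × V)) (h : NFok PW PV L) :
    ∀ᶠ M in Filter.atTop, NFok (PW' M) (PV' M) L := by
  induction L with
  | nil => exact Filter.Eventually.of_forall fun _ => trivial
  | cons p L ih =>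
    have e2 : ∀ᶠ M in Filter.atTop, (L ≠ [] → PV' M p.2) := by
      by_cases hL : L = []
      · simp [hL]
      · filter_upwards [h2 _ (h.2.1 hL)] with M hM _ using hM
    filter_upwards [h1 _ h.1, e2, ih h.2.2] with M a b c using ⟨a, b, c⟩

lemma sep_general {P V W : Type*} [Group P] [Group V] [Group W] (iV : V →* P) (iW : W →* P)
    (φ : V →* F2) (ψ : W →* F2) (c : F2) (h : ℕ → P →* F2) (hV : ∀ N v, h N (iV v) = φ v)
    (hW : ∀ N w, h N (iW w) = c ^ N * ψ w * (c ^ N)⁻¹) (g0 : V) (L : List (W × V))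
    (hL : L ≠ []) (hok : NFok (fun w => ψ w * c ≠ c * ψ w) (fun v => φ v * c ≠ c * φ v) L) :
    ∀ᶠ N in Filter.atTop, h N (iV g0 * (L.map fun p => iW p.1 * iV p.2).prod) ≠ 1 := by
  have := big_powers c (φ g0) (L.map fun p => (ψ p.1, φ p.2)) (by simpa using hL) (NFok.map ψ φ L hok)
  filter_upwards [this] with N hN
  rw [map_mul, hV, map_list_prod, List.map_map]
  rw [List.map_map] at hN
  have e : L.map (⇑(h N) ∘ fun p => iW p.1 * iV p.2) =
      L.map ((fun p : F2 × F2 => c ^ N * p.1 * (c ^ N)⁻¹ * p.2) ∘ fun p => (ψ p.1, φ p.2)) :=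
    List.map_congr_left fun p _ => by simp [hV, hW]
  rw [e]
  exact hN

/-- Step A homomorphisms. -/
def hA (k M : ℕ) : FreeGroup (Fin 3) →* F2 :=
  FreeGroup.lift ![FreeGroup.of 0, FreeGroup.of 1,
    FreeGroup.of 1 ^ M * FreeGroup.of 0 ^ k * (FreeGroup.of 1 ^ M)⁻¹]

lemma pow2_inj (d : Fin 2 → ℕ) (hd : ∀ i, d i ≠ 0) :
    Function.Injective (FreeGroup.lift ![(FreeGroup.of 0 : F2) ^ d 0, FreeGroup.of 1 ^ d 1]) := by
  have e : ![(FreeGroup.of 0 : F2) ^ d 0, FreeGroup.of 1 ^ d 1] = fun i => FreeGroup.of i ^ d i := by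
    funext i
    fin_cases i <;> rfl
  rw [e]
  exact powmap_inj d hd

lemma pow2_inj_swap (d : Fin 2 → ℕ) (hd : ∀ i, d i ≠ 0) :
    Function.Injective (FreeGroup.lift ![(FreeGroup.of 1 : F2) ^ d 0, FreeGroup.of 0 ^ d 1]) := by
  have h1 := (FreeGroup.freeGroupCongr (Equiv.swap (0 : Fin 2) 1)).injective.comp (powmap_inj d hd)
  convert h1 using 1
  have : FreeGroup.lift ![(FreeGroup.of 1 : F2) ^ d 0, FreeGroup.of 0 ^ d 1] =
    (FreeGroup.freeGroupCongr (Equiv.swap (0 : Fin 2) 1)).toMonoidHom.comp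
      (FreeGroup.lift fun i : Fin 2 => (FreeGroup.of i) ^ d i) := by
    apply FreeGroup.ext_hom
    intro i
    fin_cases i <;> simp
  rw [this]
  rfl

lemma noncomm_map {G : Type*} [Group G] [IsFreeGroup G] (c : G)
    (hroot : ∀ (g : G) (k : ℤ), c = g ^ k → k = 1 ∨ k = -1) (x : G) (hx : x ∉ Subgroup.zpowers c) :
    x * c * x⁻¹ * c⁻¹ ≠ 1 := by
  intro h
  rw [mul_inv_eq_one, mul_inv_eq_iff_eq_mul] at h
  exact hx (commuting x c h hroot)

lemma noncomm_of_comm {G H : Type*} [Group G] [Group H] (f : G →* H) (x c : G)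
    (h : f (x * c * x⁻¹ * c⁻¹) ≠ 1) : f x * f c ≠ f c * f x := by
  intro h2
  apply h
  rw [map_mul, map_mul, map_mul, map_inv, map_inv, h2]
  group

lemma sepA (k : ℕ) (hk : k ≠ 0) (g : FreeGroup (Fin 3)) (hg : g ≠ 1) :
    ∀ᶠ M in Filter.atTop, hA k M g ≠ 1 := by
  let iV : F2 →* FreeGroup (Fin 3) := FreeGroup.lift ![FreeGroup.of 0, FreeGroup.of 1]
  let iW : F2 →* FreeGroup (Fin 3) := FreeGroup.lift ![FreeGroup.of 1, FreeGroup.of 2]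
  let ψ : F2 →* F2 := FreeGroup.lift ![(FreeGroup.of 1 : F2) ^ 1, FreeGroup.of 0 ^ k]
  have hψ : Function.Injective ψ := pow2_inj_swap ![1, k] (by
    intro i; fin_cases i <;> simp [hk])
  have hV : ∀ N v, hA k N (iV v) = MonoidHom.id F2 v := by
    intro N v
    rw [← MonoidHom.comp_apply]
    congr 1
    apply FreeGroup.ext_hom
    intro i
    fin_cases i <;> simp [hA, iV]
  have hW : ∀ N w, hA k N (iW w) = FreeGroup.of 1 ^ N * ψ w * (FreeGroup.of 1 ^ N)⁻¹ := by
    intro N v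
    have : (hA k N).comp iW = (MulAut.conj ((FreeGroup.of 1 : F2) ^ N)).toMonoidHom.comp ψ := by
      apply FreeGroup.ext_hom
      intro i
      fin_cases i
      · simp [hA, iW, ψ, -map_pow]
        rw [← pow_succ, pow_succ']; group
      · simp [hA, iW, ψ, -map_pow]
    exact DFunLike.congr_fun this v
  obtain ⟨g0, L, hL, e⟩ := normal_form iV iW (FreeGroup.of 1) (FreeGroup.of 0) (by simp [iV, iW]) (by
    rw [eq_top_iff, ← FreeGroup.closure_range_of, Subgroup.closure_le]
    rintro _ ⟨i, rfl⟩
    fin_cases i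
    · exact Subgroup.mem_sup_left ⟨FreeGroup.of 0, by simp [iV]⟩
    · exact Subgroup.mem_sup_left ⟨FreeGroup.of 1, by simp [iV]⟩
    · exact Subgroup.mem_sup_right ⟨FreeGroup.of 1, by simp [iW]⟩) g
  by_cases hL0 : L = []
  · subst hL0
    refine Filter.Eventually.of_forall fun M => ?_
    rw [e]
    simp only [List.map_nil, List.prod_nil, mul_one] at e ⊢
    rw [hV]
    intro h
    apply hg
    rw [e, show g0 = 1 from h, map_one]
  · rw [e]
    refine sep_general iV iW (MonoidHom.id F2) ψ (FreeGroup.of 1) (hA k) hV hW g0 L hL0 ?_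
    refine NFok.imp ?_ ?_ L hL
    · intro w hw
      have h1 := noncomm_of_comm ψ w (FreeGroup.of 0) (by
        rw [Ne, map_eq_one_iff ψ hψ]
        exact noncomm_map _ (gen_root 0) w hw)
      simpa [ψ] using h1
    · intro v hv
      exact noncomm_of_comm (MonoidHom.id F2) v (FreeGroup.of 1) (noncomm_map _ (gen_root 1) v hv)

abbrev F4 := FreeGroup (Fin 4)

/-- the conjugating element -/
def cM (i k M : ℕ) : F2 := ww i k (FreeGroup.of 0) (FreeGroup.of 1 ^ M)

def hB (i k M N : ℕ) : F4 →* F2 :=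
  FreeGroup.lift ![FreeGroup.of 1,
    FreeGroup.of 0 ^ i * (FreeGroup.of 1 ^ M * FreeGroup.of 0 ^ k * (FreeGroup.of 1 ^ M)⁻¹),
    (cM i k M) ^ N * FreeGroup.of 0 * ((cM i k M) ^ N)⁻¹,
    (cM i k M) ^ N * FreeGroup.of 1 ^ M * ((cM i k M) ^ N)⁻¹]

/-- The embeddings of the counterexample. -/
def ff (i k : ℕ) : F2 →* F4 :=
  FreeGroup.lift ![(FreeGroup.of 1 ^ 2)⁻¹ * ww i k (FreeGroup.of 2) (FreeGroup.of 3), FreeGroup.of 0]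

lemma hB_ff (i k M N : ℕ) : (hB i k M N).comp (ff i k) = MonoidHom.id F2 := by
  apply FreeGroup.ext_hom
  intro j
  fin_cases j
  · simp only [ff, MonoidHom.comp_apply, FreeGroup.lift_apply_of, Fin.zero_eta, Matrix.cons_val_zero,
      map_mul, map_ww, map_inv, map_pow, MonoidHom.id_apply]
    simp only [hB, FreeGroup.lift_apply_of]
    show (_ ^ 2)⁻¹ * ww i k (cM i k M ^ N * FreeGroup.of 0 * (cM i k M ^ N)⁻¹)
      (cM i k M ^ N * FreeGroup.of 1 ^ M * (cM i k M ^ N)⁻¹) = _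
    rw [ww_conj]
    have : cM i k M ^ N * ww i k (FreeGroup.of 0) (FreeGroup.of 1 ^ M) * (cM i k M ^ N)⁻¹ =
        ww i k (FreeGroup.of 0) (FreeGroup.of 1 ^ M) := by
      change cM i k M ^ N * cM i k M * (cM i k M ^ N)⁻¹ = cM i k M
      rw [← pow_succ, pow_succ']; group
    rw [this, ww]
    exact inv_mul_cancel_left _ _
  · simp [hB, ff]

lemma sepB (i k : ℕ) (hk : k ≠ 0)
    (hroot : ∀ (g : F2) (n : ℤ), ww i k (FreeGroup.of 0) (FreeGroup.of 1) = g ^ n → n = 1 ∨ n = -1)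
    (s : F4) (hs : s ≠ 1) :
    ∀ᶠ M in Filter.atTop, ∀ᶠ N in Filter.atTop, hB i k M N s ≠ 1 := by
  let iV : FreeGroup (Fin 3) →* F4 := FreeGroup.lift ![FreeGroup.of 0, FreeGroup.of 1,
    ww i k (FreeGroup.of 2) (FreeGroup.of 3)]
  let iW : F2 →* F4 := FreeGroup.lift ![FreeGroup.of 2, FreeGroup.of 3]
  let ψ : ℕ → F2 →* F2 := fun M => FreeGroup.lift ![(FreeGroup.of 0 : F2), FreeGroup.of 1 ^ M]
  let emb : FreeGroup (Fin 3) →* FreeGroup (Fin 3) := FreeGroup.lift ![FreeGroup.of 1,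
    FreeGroup.of 0 ^ i * FreeGroup.of 2, (FreeGroup.of 0 ^ i * FreeGroup.of 2) ^ 2 * FreeGroup.of 0]
  let dem : FreeGroup (Fin 3) →* FreeGroup (Fin 3) := FreeGroup.lift ![
    (FreeGroup.of 1 ^ 2)⁻¹ * FreeGroup.of 2, FreeGroup.of 0,
    (((FreeGroup.of 1 ^ 2)⁻¹ * FreeGroup.of 2) ^ i)⁻¹ * FreeGroup.of 1]
  have hdem : ∀ x, dem (emb x) = x := by
    intro x
    have : dem.comp emb = MonoidHom.id _ := by
      apply FreeGroup.ext_hom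
      intro j
      fin_cases j <;> simp [dem, emb]
    exact DFunLike.congr_fun this x
  let φ : ℕ → FreeGroup (Fin 3) →* F2 := fun M => (hA k M).comp emb
  have hφ1 : ∀ x, x ≠ 1 → ∀ᶠ M in Filter.atTop, φ M x ≠ 1 := by
    intro x hx
    apply sepA k hk
    intro h
    apply hx
    rw [← hdem x, h, map_one]
  have hψ : ∀ M, M ≠ 0 → Function.Injective (ψ M) := by
    intro M hM
    have := pow2_inj ![1, M] (by intro i; fin_cases i <;> simp [hM])
    simpa [ψ] using this
  have hφc : ∀ M, φ M (FreeGroup.of 2) = cM i k M := by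
    intro M
    simp [φ, emb, hA, cM, ww]
  have hψc : ∀ M, ψ M (ww i k (FreeGroup.of 0) (FreeGroup.of 1)) = cM i k M := by
    intro M
    rw [map_ww]; simp [ψ, cM]
  have hW : ∀ M N w, hB i k M N (iW w) = cM i k M ^ N * ψ M w * (cM i k M ^ N)⁻¹ := by
    intro M N w
    have : (hB i k M N).comp iW = (MulAut.conj (cM i k M ^ N)).toMonoidHom.comp (ψ M) := by
      apply FreeGroup.ext_hom
      intro i
      fin_cases i <;> simp [hB, iW, ψ, -map_pow]
    exact DFunLike.congr_fun this w
  have hciVW : iV (FreeGroup.of 2) = iW (ww i k (FreeGroup.of 0) (FreeGroup.of 1)) := by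
    rw [map_ww]; simp [iV, iW]
  have hV : ∀ M N v, hB i k M N (iV v) = φ M v := by
    intro M N v
    have : (hB i k M N).comp iV = φ M := by
      apply FreeGroup.ext_hom
      intro j
      fin_cases j
      · simp [hB, iV, φ, emb, hA]
      · simp [hB, iV, φ, emb, hA]
      · show hB i k M N (iV (FreeGroup.of 2)) = φ M (FreeGroup.of 2)
        rw [hciVW, hW, hψc, hφc, ← pow_succ, pow_succ']; group
    exact DFunLike.congr_fun this v
  obtain ⟨g0, L, hL, e⟩ := normal_form iV iW (FreeGroup.of 2)
    (ww i k (FreeGroup.of 0) (FreeGroup.of 1)) hciVW (by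
    rw [eq_top_iff, ← FreeGroup.closure_range_of, Subgroup.closure_le]
    rintro _ ⟨i, rfl⟩
    fin_cases i
    · exact Subgroup.mem_sup_left ⟨FreeGroup.of 0, by simp [iV]⟩
    · exact Subgroup.mem_sup_left ⟨FreeGroup.of 1, by simp [iV]⟩
    · exact Subgroup.mem_sup_right ⟨FreeGroup.of 0, by simp [iW]⟩
    · exact Subgroup.mem_sup_right ⟨FreeGroup.of 1, by simp [iW]⟩) s
  by_cases hL0 : L = []
  · subst hL0
    simp only [List.map_nil, List.prod_nil, mul_one] at e
    have hg0 : g0 ≠ 1 := by rintro rfl; apply hs; rw [e, map_one]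
    filter_upwards [hφ1 g0 hg0] with M hM
    refine Filter.Eventually.of_forall fun N => ?_
    rw [e, hV]; exact hM
  · have hev : ∀ᶠ M in Filter.atTop, NFok (fun w => ψ M w * cM i k M ≠ cM i k M * ψ M w)
        (fun v => φ M v * cM i k M ≠ cM i k M * φ M v) L := by
      refine NFok.eventually (PW' := fun M w => ψ M w * cM i k M ≠ cM i k M * ψ M w)
        (PV' := fun M v => φ M v * cM i k M ≠ cM i k M * φ M v) ?_ ?_ L hL
      · intro w hw
        filter_upwards [Filter.eventually_ne_atTop 0] with M hM
        rw [← hψc]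
        apply noncomm_of_comm
        rw [Ne, map_eq_one_iff _ (hψ M hM)]
        exact noncomm_map _ hroot w hw
      · intro v hv
        filter_upwards [hφ1 _ (noncomm_map _ (gen_root 2) v hv)] with M hM
        rw [← hφc]
        exact noncomm_of_comm _ _ _ hM
    filter_upwards [hev] with M hM
    rw [e]
    exact sep_general iV iW (φ M) (ψ M) (cM i k M) (hB i k M) (hV M) (hW M) g0 L hL0 hM

/-- Separation of finite sets by retractions. -/
theorem separate (i k : ℕ) (hk : k ≠ 0)
    (hroot : ∀ (g : F2) (n : ℤ), ww i k (FreeGroup.of 0) (FreeGroup.of 1) = g ^ n → n = 1 ∨ n = -1)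
    (S : Finset F4) (hS : ∀ s ∈ S, s ≠ 1) :
    ∃ h : F4 →* F2, (∀ x, h (ff i k x) = x) ∧ ∀ s ∈ S, h s ≠ 1 := by
  have h1 : ∀ᶠ M in Filter.atTop, ∀ᶠ N in Filter.atTop, ∀ s ∈ S, hB i k M N s ≠ 1 := by
    have : ∀ᶠ M in Filter.atTop, ∀ s ∈ S, ∀ᶠ N in Filter.atTop, hB i k M N s ≠ 1 := by
      rw [Filter.eventually_all_finset]
      exact fun s hs => sepB i k hk hroot s (hS s hs)
    filter_upwards [this] with M hM
    rw [Filter.eventually_all_finset]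
    exact hM
  obtain ⟨M, hM⟩ := h1.exists
  obtain ⟨N, hN⟩ := hM.exists
  exact ⟨hB i k M N, fun x => DFunLike.congr_fun (hB_ff i k M N) x, hN⟩

end FGA

namespace FGA
open FirstOrder.Language

/-- Group homomorphisms are structure homomorphisms. -/
def toLHom {A B : Type*} [Group A] [Group B] (r : A →* B) : A →[Lgp] B where
  toFun := r
  map_fun' := by
    intro n f x
    cases f
    · exact map_one r
    · exact map_inv r _
    · exact map_mul r _ _
  map_rel' := by
    intro n R
    exact Empty.elim R

lemma realize_hom {A B : Type*} [Group A] [Group B] (r : A →* B) {α : Type*} (t : Lgp.Term α)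
    (v : α → A) : t.realize (r ∘ v) = r (t.realize v) :=
  HomClass.realize_term (toLHom r)

lemma qf_transfer {A B : Type*} [Group A] [Group B] {α : Type*} {n : ℕ}
    (ψ : Lgp.BoundedFormula α n) (h : ψ.IsQF) (v : α → B) (xs : Fin n → B) :
    ∃ S : Finset B, (∀ s ∈ S, s ≠ 1) ∧ ∀ r : B →* A, (∀ s ∈ S, r s ≠ 1) →
      (ψ.Realize (r ∘ v) (r ∘ xs) ↔ ψ.Realize v xs) := by
  classical
  induction h with
  | falsum => exact ⟨∅, by simp, fun r _ => Iff.rfl⟩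
  | of_isAtomic h =>
    cases h with
    | equal t₁ t₂ =>
      have key : ∀ r : B →* A, ((t₁.bdEqual t₂).Realize (r ∘ v) (r ∘ xs) ↔
          r (t₁.realize (Sum.elim v xs)) = r (t₂.realize (Sum.elim v xs))) := by
        intro r
        rw [BoundedFormula.realize_bdEqual, ← Sum.comp_elim, realize_hom, realize_hom]
      by_cases he : t₁.realize (Sum.elim v xs) = t₂.realize (Sum.elim v xs)
      · refine ⟨∅, by simp, fun r _ => ?_⟩
        rw [key, BoundedFormula.realize_bdEqual, he]
        simp
      · refine ⟨{t₁.realize (Sum.elim v xs) * (t₂.realize (Sum.elim v xs))⁻¹}, ?_, fun r hr => ?_⟩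
        · simpa [mul_inv_eq_one] using he
        · rw [key, BoundedFormula.realize_bdEqual]
          have := hr _ (Finset.mem_singleton_self _)
          rw [map_mul, map_inv, Ne, mul_inv_eq_one] at this
          exact iff_of_false this he
    | rel R ts => exact Empty.elim R
  | imp h1 h2 ih1 ih2 =>
    obtain ⟨S1, hS1, k1⟩ := ih1
    obtain ⟨S2, hS2, k2⟩ := ih2
    refine ⟨S1 ∪ S2, ?_, fun r hr => ?_⟩
    · intro s hs
      rcases Finset.mem_union.1 hs with h | h
      · exact hS1 s h
      · exact hS2 s h
    · rw [BoundedFormula.realize_imp, BoundedFormula.realize_imp,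
        k1 r fun s hs => hr s (Finset.mem_union_left _ hs),
        k2 r fun s hs => hr s (Finset.mem_union_right _ hs)]

theorem forallEmbedding_of_separate {A B : Type*} [Group A] [Group B] (f : A →* B)
    (h : ∀ S : Finset B, (∀ s ∈ S, s ≠ 1) → ∃ r : B →* A, (∀ x, r (f x) = x) ∧ ∀ s ∈ S, r s ≠ 1) :
    IsForallEmbedding f := by
  constructor
  · obtain ⟨r, hr, -⟩ := h ∅ (by simp)
    exact Function.LeftInverse.injective hr
  · rintro k φ ⟨n, ψ, hψ, rfl⟩ a ha
    rw [BoundedFormula.realize_alls] at ha ⊢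
    intro xs
    obtain ⟨S, hS, hr⟩ := qf_transfer (A := A) ψ hψ (f ∘ a) xs
    obtain ⟨r, hr1, hr2⟩ := h S hS
    rw [← hr r hr2]
    have : r ∘ f ∘ a = a := by funext i; exact hr1 _
    rw [this]
    exact ha _

section Retract
variable {α : Type}

def tOne : Lgp.Term α := Term.func (GroupFn.one : Lgp.Functions 0) ![]
def tInv (t : Lgp.Term α) : Lgp.Term α := Term.func (GroupFn.inv : Lgp.Functions 1) ![t]
def tMul (s t : Lgp.Term α) : Lgp.Term α := Term.func (GroupFn.mul : Lgp.Functions 2) ![s, t]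

variable {G : Type*} [Group G]

lemma realize_tOne (v : α → G) : (tOne : Lgp.Term α).realize v = 1 := rfl
lemma realize_tInv (v : α → G) (t : Lgp.Term α) : (tInv t).realize v = (t.realize v)⁻¹ := rfl
lemma realize_tMul (v : α → G) (s t : Lgp.Term α) :
    (tMul s t).realize v = s.realize v * t.realize v := rfl

/-- Word as a term, with a given term for each letter. -/
def wordTerm {ι : Type} (lt : ι → Lgp.Term α) : List (ι × Bool) → Lgp.Term α
  | [] => tOne
  | (i, true) :: L => tMul (lt i) (wordTerm lt L)
  | (i, false) :: L => tMul (tInv (lt i)) (wordTerm lt L)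

lemma realize_wordTerm {ι : Type} (lt : ι → Lgp.Term α) (v : α → G) (L : List (ι × Bool)) :
    (wordTerm lt L).realize v = FreeGroup.lift (fun i => (lt i).realize v) (FreeGroup.mk L) := by
  induction L with
  | nil => rw [← FreeGroup.one_eq_mk, map_one]; rfl
  | cons x L ih =>
    obtain ⟨i, e⟩ := x
    have : FreeGroup.mk ((i, e) :: L) = FreeGroup.mk [(i, e)] * FreeGroup.mk L := by
      rw [FreeGroup.mul_mk]; rfl
    rw [this, map_mul, ← ih]
    cases e
    · rw [wordTerm, realize_tMul, realize_tInv]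
      simp [FreeGroup.lift_mk]
    · rw [wordTerm, realize_tMul]
      simp [FreeGroup.lift_mk]

end Retract

/-- A `∀`-embedding of `F4` into a free group has a retraction. -/
theorem exists_retraction {B : Type} [Group B] [IsFreeGroup B] (g : F4 →* B)
    (hg : IsForallEmbedding g) : ∃ p : B →* F4, ∀ x, p (g x) = x := by
  classical
  let ι := IsFreeGroup.Generators B
  let E : B ≃* FreeGroup ι := IsFreeGroup.toFreeGroup B
  let L : Fin 4 → List (ι × Bool) := fun j => (E (g (FreeGroup.of j))).toWord
  let T : Finset ι := Finset.univ.biUnion fun j => ((L j).map Prod.fst).toFinset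
  let lt : ι → Lgp.Term (Fin 4 ⊕ Fin T.card) := fun i =>
    if h : i ∈ T then Term.var (Sum.inr (T.equivFin ⟨i, h⟩)) else tOne
  let eqn : Fin 4 → Lgp.BoundedFormula (Fin 4) T.card := fun j =>
    (Term.var (Sum.inl j)).bdEqual (wordTerm lt (L j))
  have hq : ∀ j, (eqn j).IsQF := fun j =>
    BoundedFormula.IsQF.of_isAtomic (BoundedFormula.IsAtomic.equal _ _)
  let ψ : Lgp.BoundedFormula (Fin 4) T.card :=
    (eqn 0).imp ((eqn 1).imp ((eqn 2).imp ((eqn 3).imp BoundedFormula.falsum)))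
  have hψ : ψ.IsQF := (hq 0).imp ((hq 1).imp ((hq 2).imp ((hq 3).imp .falsum)))
  have heqn : ∀ {G : Type} [Group G] (v : Fin 4 → G) (xs : Fin T.card → G) (j : Fin 4),
      (eqn j).Realize v xs ↔ v j = FreeGroup.lift (fun i => (lt i).realize (Sum.elim v xs))
        (FreeGroup.mk (L j)) := by
    intro G _ v xs j
    rw [BoundedFormula.realize_bdEqual, realize_wordTerm]
    rfl
  have hB : ¬ (ψ.alls).Realize (g ∘ (FreeGroup.of : Fin 4 → F4)) := by
    intro h
    rw [BoundedFormula.realize_alls] at h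
    have h1 := h fun i => E.symm (FreeGroup.of (T.equivFin.symm i : ι))
    have h2 : ∀ j, (eqn j).Realize (g ∘ (FreeGroup.of : Fin 4 → F4))
        (fun i => E.symm (FreeGroup.of (T.equivFin.symm i : ι))) := by
      intro j
      rw [heqn]
      have h3 : ∀ i ∈ T, (lt i).realize (Sum.elim (g ∘ (FreeGroup.of : Fin 4 → F4))
          (fun i => E.symm (FreeGroup.of (T.equivFin.symm i : ι)))) = E.symm (FreeGroup.of i) := by
        intro i hi
        simp [lt, hi]
      have h4 : FreeGroup.lift (fun i => (lt i).realize (Sum.elim (g ∘ (FreeGroup.of : Fin 4 → F4))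
          (fun i => E.symm (FreeGroup.of (T.equivFin.symm i : ι))))) (FreeGroup.mk (L j)) =
          FreeGroup.lift (fun i => E.symm (FreeGroup.of i)) (FreeGroup.mk (L j)) := by
        rw [FreeGroup.lift_mk, FreeGroup.lift_mk]
        congr 1
        apply List.map_congr_left
        rintro ⟨i, e⟩ hx
        have hi : i ∈ T := by
          simp only [T, Finset.mem_biUnion, Finset.mem_univ, true_and, List.mem_toFinset]
          exact ⟨j, List.mem_map.2 ⟨_, hx, rfl⟩⟩
        cases e <;> simp only [h3 i hi]
      rw [h4]
      have h5 : FreeGroup.lift (fun i => E.symm (FreeGroup.of i)) = E.symm.toMonoidHom := by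
        apply FreeGroup.ext_hom; simp
      rw [h5]
      simp [L, FreeGroup.mk_toWord]
    exact h1 (h2 0) (h2 1) (h2 2) (h2 3)
  have hA : ¬ (ψ.alls).Realize (FreeGroup.of : Fin 4 → F4) := fun h =>
    hB (hg.2 4 _ ⟨_, ψ, hψ, rfl⟩ _ h)
  rw [BoundedFormula.realize_alls] at hA
  push Not at hA
  obtain ⟨xs, hxs⟩ := hA
  have hall : ∀ j, (eqn j).Realize (FreeGroup.of : Fin 4 → F4) xs := by
    simp only [ψ, BoundedFormula.realize_imp] at hxs
    push Not at hxs
    obtain ⟨h0, h1, h2, h3, -⟩ := hxs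
    intro j
    fin_cases j
    · exact h0
    · exact h1
    · exact h2
    · exact h3
  let q := FreeGroup.lift (fun i => (lt i).realize (Sum.elim (FreeGroup.of : Fin 4 → F4) xs))
  refine ⟨q.comp E.toMonoidHom, fun x => ?_⟩
  have : (q.comp E.toMonoidHom).comp g = MonoidHom.id _ := by
    apply FreeGroup.ext_hom
    intro j
    have := (heqn _ _ j).1 (hall j)
    simp only [L, FreeGroup.mk_toWord] at this
    exact this.symm
  exact DFunLike.congr_fun this x

end FGA

namespace FGA

/-- The affine group over a commutative ring. -/
@[ext] structure Aff (R : Type*) [CommRing R] where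
  u : Rˣ
  x : R

namespace Aff
variable {R : Type*} [CommRing R]

instance : Mul (Aff R) := ⟨fun a b => ⟨a.u * b.u, a.x + a.u * b.x⟩⟩
instance : One (Aff R) := ⟨⟨1, 0⟩⟩
instance : Inv (Aff R) := ⟨fun a => ⟨a.u⁻¹, -(↑(a.u⁻¹) * a.x)⟩⟩

@[simp] lemma mul_u (a b : Aff R) : (a * b).u = a.u * b.u := rfl
@[simp] lemma mul_x (a b : Aff R) : (a * b).x = a.x + a.u * b.x := rfl
@[simp] lemma one_u : (1 : Aff R).u = 1 := rfl
@[simp] lemma one_x : (1 : Aff R).x = 0 := rfl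
@[simp] lemma inv_u (a : Aff R) : (a⁻¹).u = a.u⁻¹ := rfl
@[simp] lemma inv_x (a : Aff R) : (a⁻¹).x = -(↑(a.u⁻¹) * a.x) := rfl

instance : Group (Aff R) :=
  Group.ofLeftAxioms
    (fun a b c => by ext <;> simp <;> ring)
    (fun a => by ext <;> simp)
    (fun a => by ext <;> simp)

/-- The linear part. -/
def uHom : Aff R →* Rˣ where
  toFun := u
  map_one' := rfl
  map_mul' _ _ := rfl

@[simp] lemma uHom_apply (a : Aff R) : uHom a = a.u := rfl

/-- Functoriality. -/
def map {S : Type*} [CommRing S] (f : R →+* S) : Aff R →* Aff S where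
  toFun a := ⟨Units.map f a.u, f a.x⟩
  map_one' := by ext <;> simp
  map_mul' a b := by ext <;> simp

end Aff

variable {R : Type*} [CommRing R]

lemma aff_a_x (Z W : Aff R) : ((Z ^ 2)⁻¹ * W).x =
    (↑(Z.u⁻¹) : R) ^ 2 * (W.x - (1 + Z.u) * Z.x) := by
  have h : (↑(Z.u⁻¹) : R) * Z.u = 1 := by simp
  simp only [pow_two, mul_inv_rev, Aff.mul_x, Aff.mul_u, Aff.inv_x, Aff.inv_u, Units.val_mul]
  linear_combination ((↑(Z.u⁻¹) : R) * Z.x) * h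

lemma aff_conj_x (A P : Aff R) : (P * A * P⁻¹).x = (1 - A.u) * P.x + P.u * A.x := by
  have h : (P.u : R) * (↑(P.u⁻¹) : R) = 1 := by simp
  simp only [Aff.mul_x, Aff.mul_u, Aff.inv_x, Units.val_mul]
  linear_combination (-(A.u : R) * P.x) * h

lemma aff_conj_u (A P : Aff R) : (P * A * P⁻¹).u = A.u := by
  simp [mul_comm]

lemma aff_ww01 (A P : Aff R) : (ww 0 1 A P).x =
    (1 - A.u ^ 2) * P.x + (P.u * (1 + A.u) + A.u ^ 2) * A.x := by
  rw [ww, pow_zero, one_mul, pow_one, pow_two]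
  simp only [Aff.mul_x (P * A * P⁻¹ * _), Aff.mul_x (P * A * P⁻¹) (P * A * P⁻¹), Aff.mul_u (P * A * P⁻¹), aff_conj_x, aff_conj_u, Units.val_mul]
  ring

lemma aff_ww13 (A P : Aff R) : (ww 1 3 A P).x =
    (1 + A.u ^ 4) * (A.x + A.u * ((1 - A.u ^ 3) * P.x + P.u * (1 + A.u + A.u ^ 2) * A.x))
      + A.u ^ 8 * A.x := by
  rw [ww, pow_one, pow_two]
  have h3 : (P * A ^ 3 * P⁻¹).x = (1 - A.u ^ 3) * P.x + P.u * (1 + A.u + A.u ^ 2) * A.x := by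
    rw [aff_conj_x]
    simp only [pow_succ, pow_zero, one_mul, Aff.mul_x, Aff.mul_u, Units.val_mul]
    ring
  have h3u : (P * A ^ 3 * P⁻¹).u = A.u ^ 3 := by
    rw [aff_conj_u, ← Aff.uHom_apply, map_pow, Aff.uHom_apply]
  generalize P * A ^ 3 * P⁻¹ = Q at h3 h3u
  simp only [Aff.mul_x, Aff.mul_u, Units.val_mul, h3, h3u, Units.val_pow_eq_pow_val]
  ring

/-- The element `a` is killed on the second side. -/
lemma aff_zero2 (w : R) (hw : w ^ 2 + w + 1 = 0) (Z A P : Aff R) (hZ : (Z.u : R) = -1)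
    (hA : (A.u : R) = w) : ((Z ^ 2)⁻¹ * ww 1 3 A P).x = 0 := by
  have h3 : w ^ 3 = 1 := by linear_combination (w - 1) * hw
  rw [aff_a_x, aff_ww13, hZ, hA]
  have h4 : w ^ 4 = w := by linear_combination w * h3
  have h8 : w ^ 8 = w ^ 2 := by linear_combination (w ^ 5 + w ^ 2) * h3
  have hq : 1 + w + w ^ 2 = 0 := by linear_combination hw
  rw [h3, h4, h8, hq]
  linear_combination ((↑(Z.u⁻¹) : R) ^ 2 * A.x) * hw

section Der
variable {ι : Type*}

/-- The homomorphism to the affine group with prescribed derivation values. -/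
def der (r : FreeGroup ι →* Rˣ) (d : ι → R) : FreeGroup ι →* Aff R :=
  FreeGroup.lift fun i => ⟨r (FreeGroup.of i), d i⟩

@[simp] lemma der_of (r : FreeGroup ι →* Rˣ) (d : ι → R) (i : ι) :
    der r d (FreeGroup.of i) = ⟨r (FreeGroup.of i), d i⟩ := by simp [der]

lemma der_u (r : FreeGroup ι →* Rˣ) (d : ι → R) (x : FreeGroup ι) : (der r d x).u = r x := by
  have : Aff.uHom.comp (der r d) = r := by
    apply FreeGroup.ext_hom; intro i; simp
  exact DFunLike.congr_fun this x

/-- Value of derivations at a group element, as a linear map. -/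
def derL (r : FreeGroup ι →* Rˣ) (x : FreeGroup ι) : (ι → R) →ₗ[R] R where
  toFun d := (der r d x).x
  map_add' d e := by
    induction x using FreeGroup.induction_on with
    | C1 => simp
    | of i => simp
    | inv_of i h => simp; ring
    | mul x y hx hy => simp only [map_mul, Aff.mul_x, hx, hy, der_u]; ring
  map_smul' c d := by
    induction x using FreeGroup.induction_on with
    | C1 => simp
    | of i => simp
    | inv_of i h => simp; ring
    | mul x y hx hy =>
      simp only [map_mul, Aff.mul_x, hx, hy, der_u, smul_eq_mul, RingHom.id_apply]; ring

lemma derL_apply (r : FreeGroup ι →* Rˣ) (x : FreeGroup ι) (d : ι → R) :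
    derL r x d = (der r d x).x := rfl

lemma derL_char (f : FreeGroup ι →* Multiplicative ℤ) (x : FreeGroup ι) :
    derL (R := R) 1 x (fun i => ((f (FreeGroup.of i)).toAdd : R)) = ((f x).toAdd : R) := by
  rw [derL_apply]
  induction x using FreeGroup.induction_on with
  | C1 => simp
  | of i => simp
  | inv_of i h => simp
  | mul x y hx hy => simp only [map_mul, Aff.mul_x, hx, hy, der_u]; simp

lemma der_map {S : Type*} [CommRing S] (f : R →+* S) (r : FreeGroup ι →* Rˣ) (d : ι → R)
    (x : FreeGroup ι) : Aff.map f (der r d x) =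
      der ((Units.map (f : R →* S)).comp r) (fun i => f (d i)) x := by
  have : (Aff.map f).comp (der r d) = der ((Units.map (f : R →* S)).comp r) (fun i => f (d i)) := by
    apply FreeGroup.ext_hom
    intro i
    simp [Aff.map]
  exact DFunLike.congr_fun this x

end Der

lemma ww_comm (i k : ℕ) {C : Type*} [CommGroup C] (x y : C) :
    ww i k x y = x ^ (2 * (i + k) + 1) := by
  rw [ww, mul_comm y, mul_inv_cancel_right, ← pow_add, ← pow_mul, ← pow_succ, mul_comm 2]

lemma ff0 (i k : ℕ) {C : Type*} [Group C] (f : F4 →* C) : f (ff i k (FreeGroup.of 0)) =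
    (f (FreeGroup.of 1) ^ 2)⁻¹ * ww i k (f (FreeGroup.of 2)) (f (FreeGroup.of 3)) := by
  simp [ff, map_ww]

lemma ff1 (i k : ℕ) : ff i k (FreeGroup.of 1) = FreeGroup.of 0 := by
  simp [ff]

end FGA

namespace FGA

/-- Integer-valued homomorphism on `F4`. -/
def chi (v : Fin 4 → ℤ) : F4 →* Multiplicative ℤ :=
  FreeGroup.lift fun i => Multiplicative.ofAdd (v i)

@[simp] lemma chi_of (v : Fin 4 → ℤ) (i : Fin 4) :
    chi v (FreeGroup.of i) = Multiplicative.ofAdd (v i) := by simp [chi]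

lemma exists_omega : ∃ w : ℂ, w ^ 2 + w + 1 = 0 := by
  have h3 : ((Real.sqrt 3 : ℝ) : ℂ) ^ 2 = 3 := by
    rw [← Complex.ofReal_pow, Real.sq_sqrt (by norm_num)]; norm_num
  refine ⟨(-1 + (Real.sqrt 3 : ℝ) * Complex.I) / 2, ?_⟩
  have hI := Complex.I_sq
  linear_combination (1 / 4 * Complex.I ^ 2) * h3 + 3 / 4 * hI

lemma exists_zroot (ζ : ℂˣ) (n : ℤ) (hn : n ≠ 0) : ∃ s : ℂˣ, s ^ n = ζ := by
  have h0 : n.natAbs ≠ 0 := Int.natAbs_ne_zero.2 hn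
  obtain ⟨s, hs⟩ := IsAlgClosed.exists_pow_nat_eq (ζ : ℂ) (Nat.pos_of_ne_zero h0)
  have hs0 : s ≠ 0 := by
    rintro rfl
    rw [zero_pow h0] at hs
    exact ζ.ne_zero hs.symm
  have h1 : (Units.mk0 s hs0) ^ n.natAbs = ζ := by
    ext; simpa using hs
  rcases Int.natAbs_eq n with h | h
  · exact ⟨Units.mk0 s hs0, by rw [h, zpow_natCast, h1]⟩
  · exact ⟨(Units.mk0 s hs0)⁻¹, by rw [h, zpow_neg, inv_zpow, inv_inv, zpow_natCast, h1]⟩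

lemma ab01 {C : Type*} [CommGroup C] (f : F4 →* C) : f (ff 0 1 (FreeGroup.of 0)) =
    (f (FreeGroup.of 1) ^ 2)⁻¹ * f (FreeGroup.of 2) ^ 3 := by
  rw [ff0, ww_comm]

lemma ab13 {C : Type*} [CommGroup C] (f : F4 →* C) : f (ff 1 3 (FreeGroup.of 0)) =
    (f (FreeGroup.of 1) ^ 2)⁻¹ * f (FreeGroup.of 2) ^ 9 := by
  rw [ff0, ww_comm]

/-- One step of the rigidity argument. -/
lemma rigid_aux (t : F4 →* F4) (ht : ∀ x, t (ff 1 3 x) = ff 0 1 x) (w : ℂ)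
    (hw : w ^ 2 + w + 1 = 0) (s τ ζ : ℂˣ) (hζ : (ζ : ℂ) = -w ^ 2)
    (h : s ^ (chi ![0, 3, 2, 0] (t (FreeGroup.of 1 * (FreeGroup.of 2 ^ 4)⁻¹))).toAdd *
      τ ^ (chi ![0, 0, 0, 1] (t (FreeGroup.of 1 * (FreeGroup.of 2 ^ 4)⁻¹))).toAdd = ζ)
    (dz da dp : ℂ) :
    (1 - (s : ℂ) ^ 4) * dp + (τ * (1 + s ^ 2) + s ^ 4) * da - (1 + s ^ 3) * dz = 0 := by
  let Φ : F4 →* Aff ℂ := FreeGroup.lift ![1, ⟨s ^ 3, dz⟩, ⟨s ^ 2, da⟩, ⟨τ, dp⟩]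
  have hu : ∀ x, (Φ x).u = s ^ (chi ![0, 3, 2, 0] x).toAdd * τ ^ (chi ![0, 0, 0, 1] x).toAdd := by
    have : Aff.uHom.comp Φ = (zpowersHom _ s).comp (chi ![0, 3, 2, 0]) *
        (zpowersHom _ τ).comp (chi ![0, 0, 0, 1]) := by
      apply FreeGroup.ext_hom
      intro i
      fin_cases i
      · simp [Φ]
      · simp [Φ]
      · simp [Φ]
      · simp [Φ]
    intro x
    exact DFunLike.congr_fun this x
  let ρ : F4 →* ℂˣ := (Aff.uHom.comp Φ).comp t
  have hρa : ρ (ff 1 3 (FreeGroup.of 0)) = 1 := by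
    change Aff.uHom (Φ (t _)) = 1
    rw [ht]
    have := ab01 (Aff.uHom.comp Φ)
    refine this.trans ?_
    simp [Φ, ← pow_mul]
  have hs : ρ (FreeGroup.of 1) * (ρ (FreeGroup.of 2) ^ 4)⁻¹ = ζ := by
    rw [← map_pow, ← map_inv, ← map_mul, ← h]
    exact hu _
  rw [ab13] at hρa
  set Z := ρ (FreeGroup.of 1)
  set A := ρ (FreeGroup.of 2)
  have hZ : Z = ζ * A ^ 4 := by rw [← hs]; group
  have h9 : A ^ 9 = Z ^ 2 := by
    rw [inv_mul_eq_one] at hρa; exact hρa.symm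
  have hA : A = ζ ^ 2 := by
    rw [hZ, mul_pow, ← pow_mul] at h9
    have : A * A ^ 8 = ζ ^ 2 * A ^ 8 := by rw [← pow_succ']; exact h9
    exact mul_right_cancel this
  have hw3 : w ^ 3 = 1 := by linear_combination (w - 1) * hw
  have hA' : (A : ℂ) = w := by
    rw [hA, Units.val_pow_eq_pow_val, hζ]
    linear_combination w * hw3
  have hZ' : (Z : ℂ) = -1 := by
    rw [hZ, Units.val_mul, Units.val_pow_eq_pow_val, hA', hζ]
    linear_combination (-(w ^ 3) - 1) * hw3
  have key := aff_zero2 w hw (Φ (t (FreeGroup.of 1))) (Φ (t (FreeGroup.of 2)))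
    (Φ (t (FreeGroup.of 3))) hZ' hA'
  have e1 : (Φ.comp t) (ff 1 3 (FreeGroup.of 0)) = Φ (ff 0 1 (FreeGroup.of 0)) := by
    rw [MonoidHom.comp_apply, ht]
  rw [ff0, ff0] at e1
  simp only [MonoidHom.comp_apply] at e1
  rw [e1, aff_a_x, aff_ww01] at key
  simp only [Φ, FreeGroup.lift_apply_of] at key
  have hne : ((↑((s ^ 3)⁻¹ : ℂˣ) : ℂ)) ^ 2 ≠ 0 := pow_ne_zero _ (Units.ne_zero _)
  have k2 := (mul_eq_zero.1 key).resolve_left hne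
  simp at k2
  linear_combination k2

lemma rigid (t : F4 →* F4) (ht : ∀ x, t (ff 1 3 x) = ff 0 1 x) :
    (chi ![0, 3, 2, 0] (t (FreeGroup.of 1 * (FreeGroup.of 2 ^ 4)⁻¹))).toAdd = 0 ∧
    (chi ![0, 0, 0, 1] (t (FreeGroup.of 1 * (FreeGroup.of 2 ^ 4)⁻¹))).toAdd = 0 := by
  obtain ⟨w, hw⟩ := exists_omega
  have hw0 : -w ^ 2 ≠ 0 := by
    intro h
    have : w = 0 := by simpa using h
    rw [this] at hw; norm_num at hw
  have aux := rigid_aux t ht w hw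
  set j := (chi ![0, 3, 2, 0] (t (FreeGroup.of 1 * (FreeGroup.of 2 ^ 4)⁻¹))).toAdd
  set l := (chi ![0, 0, 0, 1] (t (FreeGroup.of 1 * (FreeGroup.of 2 ^ 4)⁻¹))).toAdd
  have hl : l = 0 := by
    by_contra hl
    obtain ⟨τ, hτ⟩ := exists_zroot (Units.mk0 _ hw0) l hl
    have := aux 1 τ (Units.mk0 _ hw0) rfl (by simpa using hτ) 1 0 0
    norm_num at this
  refine ⟨?_, hl⟩
  by_contra hj
  obtain ⟨s, hs⟩ := exists_zroot (Units.mk0 _ hw0) j hj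
  have := aux s 1 (Units.mk0 _ hw0) rfl (by simpa using hs)
  have e1 : (s : ℂ) ^ 3 = -1 := by linear_combination - this 1 0 0
  have e2 := this 0 0 1
  have e3 := this 0 1 0
  have e4 : (s : ℂ) = -1 := by linear_combination e2 + s * e1
  rw [e4] at e3
  norm_num at e3

end FGA

namespace FGA

open TrivSqZeroExt in
lemma eps_cancel (y : DualNumber ℂ) (h : DualNumber.eps * y = 0) : fst y = 0 := by
  have h1 := congrArg snd h
  rw [snd_mul, DualNumber.fst_eps, DualNumber.snd_eps, snd_zero] at h1
  simpa only [zero_smul, zero_mul, zero_add, MulOpposite.op_one, one_smul, op_smul_eq_smul, smul_eq_mul, mul_one] using h1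

/-- A unit of the dual numbers. -/
def epsU (c : ℂˣ) : (DualNumber ℂ)ˣ where
  val := TrivSqZeroExt.inl (c : ℂ) * (1 + DualNumber.eps)
  inv := TrivSqZeroExt.inl ((c⁻¹ : ℂˣ) : ℂ) * (1 - DualNumber.eps)
  val_inv := by
    have h : (DualNumber.eps : DualNumber ℂ) * DualNumber.eps = 0 := DualNumber.eps_mul_eps
    have h2 : (TrivSqZeroExt.inl (c : ℂ) : DualNumber ℂ) * TrivSqZeroExt.inl ((c⁻¹ : ℂˣ) : ℂ) = 1 := by
      rw [TrivSqZeroExt.inl_mul_inl]; simp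
    linear_combination (1 - DualNumber.eps * DualNumber.eps) * h2 - h
  inv_val := by
    have h : (DualNumber.eps : DualNumber ℂ) * DualNumber.eps = 0 := DualNumber.eps_mul_eps
    have h2 : (TrivSqZeroExt.inl (c : ℂ) : DualNumber ℂ) * TrivSqZeroExt.inl ((c⁻¹ : ℂˣ) : ℂ) = 1 := by
      rw [TrivSqZeroExt.inl_mul_inl]; simp
    linear_combination (1 - DualNumber.eps * DualNumber.eps) * h2 - h

/-- The reduction map. -/
def fstR : DualNumber ℂ →+* ℂ := (TrivSqZeroExt.fstHom ℂ ℂ ℂ).toRingHom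

/-- The inclusion of constants. -/
def inlR : ℂ →+* DualNumber ℂ := TrivSqZeroExt.inlHom ℂ ℂ

lemma fstR_apply (x : DualNumber ℂ) : fstR x = x.fst := rfl
lemma fst_inlR (x : ℂ) : fstR (inlR x) = x := rfl

lemma map_epsU (c : ℂˣ) : Units.map (fstR : DualNumber ℂ →* ℂ) (epsU c) = c := by
  ext
  simp [epsU, fstR_apply]

lemma epsU_val (c : ℂˣ) : (epsU c : DualNumber ℂ) = inlR c * (1 + DualNumber.eps) := rfl

/-- Constant unit. -/
def cU : ℂˣ →* (DualNumber ℂ)ˣ := Units.map (inlR : ℂ →* DualNumber ℂ)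

lemma map_cU (c : ℂˣ) : Units.map (fstR : DualNumber ℂ →* ℂ) (cU c) = c := by
  ext
  simp [cU, fst_inlR]

lemma cU_val (c : ℂˣ) : (cU c : DualNumber ℂ) = inlR c := rfl

section
variable {ι : Type*} (c1 c2 c3 : FreeGroup ι →* Multiplicative ℤ)

/-- A character built out of three integer functionals. -/
def rr {R : Type*} [CommRing R] (a b c : Rˣ) : FreeGroup ι →* Rˣ :=
  (zpowersHom _ a).comp c1 * (zpowersHom _ b).comp c2 * (zpowersHom _ c).comp c3

lemma rr_apply {R : Type*} [CommRing R] (a b c : Rˣ) (x : FreeGroup ι) :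
    rr c1 c2 c3 a b c x = a ^ (c1 x).toAdd * b ^ (c2 x).toAdd * c ^ (c3 x).toAdd := rfl

lemma rr_map {R S : Type*} [CommRing R] [CommRing S] (f : R →* S) (a b c : Rˣ) :
    (Units.map f).comp (rr c1 c2 c3 a b c) =
      rr c1 c2 c3 (Units.map f a) (Units.map f b) (Units.map f c) := by
  apply FreeGroup.ext_hom
  intro i
  simp [rr_apply, map_zpow]

/-- Key: vanishing of derivations. -/
lemma der_vanish (g1 g2 : F4 →* FreeGroup ι)
    (hr : ∀ x, g1 (ff 0 1 x) = g2 (ff 1 3 x))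
    (hgen : ∀ S : Subgroup (FreeGroup ι), (∀ x, g1 x ∈ S) → (∀ x, g2 x ∈ S) → S = ⊤)
    (h1z : ((c1 (g1 (.of 1))).toAdd, (c2 (g1 (.of 1))).toAdd, (c3 (g1 (.of 1))).toAdd) = (3, 0, 0))
    (h1a : ((c1 (g1 (.of 2))).toAdd, (c2 (g1 (.of 2))).toAdd, (c3 (g1 (.of 2))).toAdd) = (2, 0, 0))
    (h1p : ((c1 (g1 (.of 3))).toAdd, (c2 (g1 (.of 3))).toAdd, (c3 (g1 (.of 3))).toAdd) = (0, 1, 0))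
    (h2z : ((c1 (g2 (.of 1))).toAdd, (c2 (g2 (.of 1))).toAdd, (c3 (g2 (.of 1))).toAdd) = (0, 0, 9))
    (h2a : ((c1 (g2 (.of 2))).toAdd, (c2 (g2 (.of 2))).toAdd, (c3 (g2 (.of 2))).toAdd) = (0, 0, 2))
    (w : ℂ) (hw : w ^ 2 + w + 1 = 0) (s τ ζ : ℂˣ) (hs : (s : ℂ) = -1) (hτ : (τ : ℂ) = -1 / 2)
    (hζ : (ζ : ℂ) = -w ^ 2) (d : ι → ℂ)
    (v0 : (der (rr c1 c2 c3 s τ ζ) d (g1 (.of 0))).x = 0)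
    (v1 : (der (rr c1 c2 c3 s τ ζ) d (g1 (.of 1))).x = 0)
    (v2 : (der (rr c1 c2 c3 s τ ζ) d (g2 (.of 1))).x = 0)
    (v3 : (der (rr c1 c2 c3 s τ ζ) d (g2 (.of 2))).x = 0) : d = 0 := by
  have hw3 : w ^ 3 = 1 := by linear_combination (w - 1) * hw
  simp only [Prod.mk.injEq] at h1z h1a h1p h2z h2a
  set ρ := rr c1 c2 c3 s τ ζ with hρ
  have he : (DualNumber.eps : DualNumber ℂ) * DualNumber.eps = 0 := DualNumber.eps_mul_eps
  -- the general deformation equation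
  have gen : ∀ a b c : (DualNumber ℂ)ˣ, Units.map (fstR : DualNumber ℂ →* ℂ) a = s →
      Units.map (fstR : DualNumber ℂ →* ℂ) b = τ → Units.map (fstR : DualNumber ℂ →* ℂ) c = ζ →
      ∃ Z A P Z' A' P' : Aff (DualNumber ℂ),
        Z.u = a ^ 3 ∧ A.u = a ^ 2 ∧ P.u = b ∧ Z'.u = c ^ 9 ∧ A'.u = c ^ 2 ∧
        fstR Z.x = (der ρ d (g1 (.of 1))).x ∧ fstR A.x = (der ρ d (g1 (.of 2))).x ∧
        fstR P.x = (der ρ d (g1 (.of 3))).x ∧ fstR Z'.x = (der ρ d (g2 (.of 1))).x ∧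
        fstR A'.x = (der ρ d (g2 (.of 2))).x ∧ fstR P'.x = (der ρ d (g2 (.of 3))).x ∧
        (Z ^ 2)⁻¹ * ww 0 1 A P = (Z' ^ 2)⁻¹ * ww 1 3 A' P' := by
    intro a b c ha hb hc
    let Ψ := der (rr c1 c2 c3 a b c) (fun i => inlR (d i))
    have hx : ∀ x, fstR (Ψ x).x = (der ρ d x).x := by
      intro x
      have := der_map fstR (rr c1 c2 c3 a b c) (fun i => inlR (d i)) x
      rw [rr_map, ha, hb, hc] at this
      exact congrArg Aff.x this
    have hu : ∀ x, (Ψ x).u = _ := fun x => (der_u _ _ x).trans (rr_apply _ _ _ _ _ _ _)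
    refine ⟨Ψ (g1 (.of 1)), Ψ (g1 (.of 2)), Ψ (g1 (.of 3)), Ψ (g2 (.of 1)), Ψ (g2 (.of 2)),
      Ψ (g2 (.of 3)), ?_, ?_, ?_, ?_, ?_, hx _, hx _, hx _, hx _, hx _, hx _, ?_⟩
    · rw [hu, h1z.1, h1z.2.1, h1z.2.2]; simp
    · rw [hu, h1a.1, h1a.2.1, h1a.2.2]; simp
    · rw [hu, h1p.1, h1p.2.1, h1p.2.2]; simp
    · rw [hu, h2z.1, h2z.2.1, h2z.2.2]; simp
    · rw [hu, h2a.1, h2a.2.1, h2a.2.2]; simp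
    · have h := congrArg Ψ (hr (.of 0))
      have e1 := ff0 0 1 (Ψ.comp g1)
      have e2 := ff0 1 3 (Ψ.comp g2)
      simp only [MonoidHom.comp_apply] at e1 e2
      rw [← e1, ← e2, h]
  have hW : inlR w ^ 2 + inlR w + 1 = 0 := by
    rw [← map_pow, ← map_add, ← map_one inlR, ← map_add, hw, map_zero]
  have hW3 : inlR w ^ 3 = 1 := by rw [← map_pow, hw3, map_one]
  have hS : inlR (s : ℂ) = -1 := by rw [hs, map_neg, map_one]
  have hT : 2 * inlR (τ : ℂ) = -1 := by
    rw [hτ, ← map_ofNat inlR 2, ← map_mul, ← map_one inlR, ← map_neg]; norm_num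
  have hZt : inlR (ζ : ℂ) = - inlR w ^ 2 := by rw [hζ, map_neg, map_pow]
  have unit_cancel : ∀ (u : (DualNumber ℂ)ˣ) (y : DualNumber ℂ),
      (↑(u⁻¹) : DualNumber ℂ) ^ 2 * y = 0 → y = 0 := by
    intro u y h
    have : (u : DualNumber ℂ) ^ 2 * ((↑(u⁻¹) : DualNumber ℂ) ^ 2 * y) = y := by
      rw [← mul_assoc, ← mul_pow, Units.mul_inv, one_pow, one_mul]
    rw [← this, h, mul_zero]
  have hzc : (cU ζ : DualNumber ℂ) ^ 9 = -1 := by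
    rw [cU_val, hZt]
    linear_combination (-(inlR w ^ 15) - inlR w ^ 12 - inlR w ^ 9 - inlR w ^ 6 - inlR w ^ 3 - 1) * hW3
  have hac : (cU ζ : DualNumber ℂ) ^ 2 = inlR w := by
    rw [cU_val, hZt]; linear_combination inlR w * hW3
  -- first deformation
  have a1 : (der ρ d (g1 (.of 2))).x = 0 := by
    obtain ⟨Z, A, P, Z', A', P', hZ, hA, hP, hZ', hA', xZ, xA, xP, xZ', xA', xP', rel⟩ :=
      gen (cU s) (epsU τ) (cU ζ) (map_cU _) (map_epsU _) (map_cU _)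
    have rx := congrArg Aff.x rel
    rw [aff_zero2 (inlR w) hW Z' A' P' (by rw [hZ', Units.val_pow_eq_pow_val, hzc])
      (by rw [hA', Units.val_pow_eq_pow_val, hac]), aff_a_x] at rx
    have rx := unit_cancel _ _ rx
    rw [aff_ww01, hZ, hA, hP] at rx
    simp only [Units.val_pow_eq_pow_val, cU_val, epsU_val, hS] at rx
    rw [← xA]
    apply eps_cancel
    linear_combination - rx + (1 + DualNumber.eps) * A.x * hT
  have a2 : (der ρ d (g1 (.of 3))).x = 0 := by
    obtain ⟨Z, A, P, Z', A', P', hZ, hA, hP, hZ', hA', xZ, xA, xP, xZ', xA', xP', rel⟩ :=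
      gen (epsU s) (cU τ) (cU ζ) (map_epsU _) (map_cU _) (map_cU _)
    have rx := congrArg Aff.x rel
    rw [aff_zero2 (inlR w) hW Z' A' P' (by rw [hZ', Units.val_pow_eq_pow_val, hzc])
      (by rw [hA', Units.val_pow_eq_pow_val, hac]), aff_a_x] at rx
    have rx := unit_cancel _ _ rx
    rw [aff_ww01, hZ, hA, hP] at rx
    simp only [Units.val_pow_eq_pow_val, cU_val, epsU_val, hS] at rx
    have hy : DualNumber.eps * (3 * Z.x - 4 * P.x + 3 * A.x) = 0 := by
      generalize inlR (τ : ℂ) = T at *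
      generalize (DualNumber.eps : DualNumber ℂ) = e at *
      linear_combination rx - A.x * (1 + e) * hT + (P.x * (6 + 4 * e + e ^ 2) +
        A.x * (-T - 6 - 4 * e - e ^ 2) - Z.x * (3 + e)) * he
    have := eps_cancel _ hy
    rw [← fstR_apply] at this
    simp only [map_add, map_sub, map_mul, xZ, xA, xP, v1, a1, map_ofNat] at this
    simpa using this
  have a3 : (der ρ d (g2 (.of 3))).x = 0 := by
    obtain ⟨Z, A, P, Z', A', P', hZ, hA, hP, hZ', hA', xZ, xA, xP, xZ', xA', xP', rel⟩ :=
      gen (cU s) (cU τ) (epsU ζ) (map_cU _) (map_cU _) (map_epsU _)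
    have rx := (congrArg Aff.x rel).symm
    have zero : ((Z ^ 2)⁻¹ * ww 0 1 A P).x = 0 := by
      rw [aff_a_x, aff_ww01, hZ, hA, hP]
      simp only [Units.val_pow_eq_pow_val, cU_val, hS]
      linear_combination (↑((cU s ^ 3)⁻¹) : DualNumber ℂ) ^ 2 * A.x * hT
    rw [zero, aff_a_x] at rx
    have rx := unit_cancel _ _ rx
    rw [aff_ww13, hZ', hA'] at rx
    simp only [Units.val_pow_eq_pow_val, epsU_val, hZt] at rx
    have hy : ∃ X, DualNumber.eps * (9 * Z'.x + 6 * P'.x + X * A'.x) = 0 := by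
      generalize inlR w = W at *
      generalize (DualNumber.eps : DualNumber ℂ) = e at *
      have p2 : (1 + e) ^ 2 = 1 + 2 * e := by linear_combination he
      have p8 : (1 + e) ^ 8 = 1 + 8 * e := by
        rw [show 8 = 2 * 4 from rfl, pow_mul, p2]
        linear_combination (24 + 32 * e + 16 * e ^ 2) * he
      have p9 : (1 + e) ^ 9 = 1 + 9 * e := by
        rw [pow_succ, p8]; linear_combination 8 * he
      have q2 : (-W ^ 2 * (1 + e)) ^ 2 = W * (1 + 2 * e) := by
        rw [mul_pow, p2]; linear_combination (W * (1 + 2 * e)) * hW3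
      have q9 : (-W ^ 2 * (1 + e)) ^ 9 = -(1 + 9 * e) := by
        rw [mul_pow, p9]
        linear_combination (1 + 9 * e) * (-(W ^ 15) - W ^ 12 - W ^ 9 - W ^ 6 - W ^ 3 - 1) * hW3
      have r2 : (W * (1 + 2 * e)) ^ 2 = W ^ 2 * (1 + 4 * e) := by
        linear_combination 4 * W ^ 2 * he
      have r3 : (W * (1 + 2 * e)) ^ 3 = 1 + 6 * e := by
        rw [pow_succ, r2]
        linear_combination (1 + 6 * e) * hW3 + 8 * W ^ 3 * he
      have r4 : (W * (1 + 2 * e)) ^ 4 = W * (1 + 8 * e) := by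
        rw [pow_succ, r3]
        linear_combination 12 * W * he
      have r8 : (W * (1 + 2 * e)) ^ 8 = W ^ 2 * (1 + 16 * e) := by
        rw [show 8 = 4 * 2 from rfl, pow_mul, r4]
        linear_combination 64 * W ^ 2 * he
      rw [q2, q9, r2, r3, r4, r8] at rx
      refine ⟨8 * W + 16 * W ^ 2 - P'.u * (2 * W + 4 * W ^ 2), ?_⟩
      clear q2 q9 r2 r3 r4 r8 p2 p8 p9
      generalize (P'.u : DualNumber ℂ) = U at *
      generalize P'.x = p at *
      generalize A'.x = a at *
      generalize Z'.x = z at *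
      clear zero rel xP' xZ' xA' hac hzc
      grind
    obtain ⟨X, hy⟩ := hy
    have := eps_cancel _ hy
    rw [← fstR_apply] at this
    simp only [map_add, map_mul, xZ', xA', xP', v2, v3, map_ofNat] at this
    simpa using this
  -- the two derivations agree on generators
  have hb2 : (der ρ d (g2 (.of 0))).x = 0 := by
    have := hr (.of 1)
    rw [ff1, ff1] at this
    rw [← this]; exact v0
  let S := MonoidHom.eqLocus (der ρ d) (der ρ 0)
  have mem : ∀ x, (der ρ d x).x = 0 → der ρ d x = der ρ 0 x := by
    intro x hx
    ext
    · rw [der_u, der_u]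
    · rw [hx, ← derL_apply, map_zero]
  have hS1 : (der ρ d).comp g1 = (der ρ 0).comp g1 := by
    apply FreeGroup.ext_hom
    intro i
    fin_cases i
    · exact mem _ v0
    · exact mem _ v1
    · exact mem _ a1
    · exact mem _ a2
  have hS2 : (der ρ d).comp g2 = (der ρ 0).comp g2 := by
    apply FreeGroup.ext_hom
    intro i
    fin_cases i
    · exact mem _ hb2
    · exact mem _ v2
    · exact mem _ v3
    · exact mem _ a3
  have top : S = ⊤ := hgen S (fun x => DFunLike.congr_fun hS1 x) (fun x => DFunLike.congr_fun hS2 x)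
  funext i
  have : FreeGroup.of i ∈ S := by rw [top]; trivial
  have h : der ρ d (FreeGroup.of i) = der ρ 0 (FreeGroup.of i) := this
  simpa using congrArg Aff.x h

end

end FGA

namespace FGA

theorem part2 {ι : Type*} (g1 g2 : F4 →* FreeGroup ι) (p1 p2 : FreeGroup ι →* F4)
    (h1 : ∀ x, p1 (g1 x) = x) (h2 : ∀ x, p2 (g2 x) = x)
    (hr : ∀ x, g1 (ff 0 1 x) = g2 (ff 1 3 x))
    (hgen : ∀ S : Subgroup (FreeGroup ι), (∀ x, g1 x ∈ S) → (∀ x, g2 x ∈ S) → S = ⊤) : False := by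
  have hrig := rigid (p1.comp g2) (fun x => by rw [MonoidHom.comp_apply, ← hr, h1])
  -- relation for integer functionals
  have rela : ∀ f : FreeGroup ι →* Multiplicative ℤ,
      3 * (f (g1 (.of 2))).toAdd - 2 * (f (g1 (.of 1))).toAdd =
      9 * (f (g2 (.of 2))).toAdd - 2 * (f (g2 (.of 1))).toAdd := by
    intro f
    have e1 := ab01 (f.comp g1)
    have e2 := ab13 (f.comp g2)
    simp only [MonoidHom.comp_apply] at e1 e2
    rw [hr, e2] at e1
    have := congrArg Multiplicative.toAdd e1
    simp only [toAdd_mul, toAdd_inv, toAdd_pow, nsmul_eq_mul] at this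
    push_cast at this
    linarith
  have relb : g1 (.of 0) = g2 (.of 0) := by
    have := hr (.of 1)
    rwa [ff1, ff1] at this
  let cs := (chi ![0, 3, 2, 0]).comp p1
  let cp := (chi ![0, 0, 0, 1]).comp p1
  let ca := (chi ![0, 1, 1, 0]).comp p1
  let cb := (chi ![1, 0, 0, 0]).comp p1
  let k0 := (chi ![0, 9, 2, 0]).comp p2
  have ev1 : ∀ (v : Fin 4 → ℤ) (i : Fin 4), (((chi v).comp p1) (g1 (.of i))).toAdd = v i := by
    intro v i; simp [h1]
  have ev2 : ∀ (v : Fin 4 → ℤ) (i : Fin 4), (((chi v).comp p2) (g2 (.of i))).toAdd = v i := by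
    intro v i; simp [h2]
  let m : ℤ := -((k0 (g1 (.of 1))).toAdd - (k0 (g1 (.of 2))).toAdd)
  let n : ℤ := -(k0 (g1 (.of 3))).toAdd
  let kk : FreeGroup ι →* Multiplicative ℤ := k0 * cs ^ m * cp ^ n
  have hkk : ∀ x, (kk x).toAdd = (k0 x).toAdd + m * (cs x).toAdd + n * (cp x).toAdd := by
    intro x
    simp [kk]
  have s1 : ∀ i, (cs (g1 (.of i))).toAdd = (![0, 3, 2, 0] : Fin 4 → ℤ) i := ev1 _
  have s2 : ∀ i, (cp (g1 (.of i))).toAdd = (![0, 0, 0, 1] : Fin 4 → ℤ) i := ev1 _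
  have s3 : ∀ i, (ca (g1 (.of i))).toAdd = (![0, 1, 1, 0] : Fin 4 → ℤ) i := ev1 _
  have s4 : ∀ i, (cb (g1 (.of i))).toAdd = (![1, 0, 0, 0] : Fin 4 → ℤ) i := ev1 _
  have s5 : ∀ i, (k0 (g2 (.of i))).toAdd = (![0, 9, 2, 0] : Fin 4 → ℤ) i := ev2 _
  have rig : ∀ v : Fin 4 → ℤ,
      ((chi v) ((p1.comp g2) (FreeGroup.of 1 * (FreeGroup.of 2 ^ 4)⁻¹))).toAdd =
      (((chi v).comp p1) (g2 (.of 1))).toAdd - 4 * (((chi v).comp p1) (g2 (.of 2))).toAdd := by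
    intro v
    simp only [map_mul, map_inv, map_pow, toAdd_mul, toAdd_inv, toAdd_pow, nsmul_eq_mul,
      MonoidHom.comp_apply]
    push_cast; ring
  rw [rig, rig] at hrig
  have r1 : (cs (g2 (.of 1))).toAdd - 4 * (cs (g2 (.of 2))).toAdd = 0 := hrig.1
  have r2 : (cp (g2 (.of 1))).toAdd - 4 * (cp (g2 (.of 2))).toAdd = 0 := hrig.2
  have q1 := rela cs
  have q2 := rela cp
  have q3 := rela k0
  have s10 : (cs (g1 (.of 0))).toAdd = 0 := s1 0
  have s11 : (cs (g1 (.of 1))).toAdd = 3 := s1 1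
  have s12 : (cs (g1 (.of 2))).toAdd = 2 := s1 2
  have s13 : (cs (g1 (.of 3))).toAdd = 0 := s1 3
  have s20 : (cp (g1 (.of 0))).toAdd = 0 := s2 0
  have s21 : (cp (g1 (.of 1))).toAdd = 0 := s2 1
  have s22 : (cp (g1 (.of 2))).toAdd = 0 := s2 2
  have s23 : (cp (g1 (.of 3))).toAdd = 1 := s2 3
  have s50 : (k0 (g2 (.of 0))).toAdd = 0 := s5 0
  have s51 : (k0 (g2 (.of 1))).toAdd = 9 := s5 1
  have s52 : (k0 (g2 (.of 2))).toAdd = 2 := s5 2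
  have t1 : (cs (g2 (.of 1))).toAdd = 0 := by omega
  have t2 : (cs (g2 (.of 2))).toAdd = 0 := by omega
  have t3 : (cp (g2 (.of 1))).toAdd = 0 := by omega
  have t4 : (cp (g2 (.of 2))).toAdd = 0 := by omega
  have u0 : (kk (g1 (.of 0))).toAdd = 0 := by
    rw [hkk, s10, s20, relb, s50]; simp
  have u1 : (kk (g1 (.of 1))).toAdd = 0 := by
    rw [hkk, s11, s21]; simp only [m]; omega
  have u2 : (kk (g1 (.of 2))).toAdd = 0 := by
    rw [hkk, s12, s22]; simp only [m]; omega
  have u3 : (kk (g1 (.of 3))).toAdd = 0 := by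
    rw [hkk, s13, s23]; simp only [n]; omega
  have u4 : (kk (g2 (.of 1))).toAdd = 9 := by
    rw [hkk, t1, t3, s51]; simp
  have u5 : (kk (g2 (.of 2))).toAdd = 2 := by
    rw [hkk, t2, t4, s52]; simp
  obtain ⟨w, hw⟩ := exists_omega
  have hw0 : -w ^ 2 ≠ 0 := by
    intro h
    have : w = 0 := by simpa using h
    rw [this] at hw; norm_num at hw
  let s : ℂˣ := Units.mk0 (-1) (by norm_num)
  let τ : ℂˣ := Units.mk0 (-1 / 2) (by norm_num)
  let ζ : ℂˣ := Units.mk0 _ hw0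
  have inj := der_vanish cs cp kk g1 g2 hr hgen (by rw [s11, s21, u1]) (by rw [s12, s22, u2])
    (by rw [s13, s23, u3]) (by rw [t1, t3, u4]) (by rw [t2, t4, u5]) w hw s τ ζ rfl rfl rfl
  let ρ := rr cs cp kk s τ ζ
  let L : (ι → ℂ) →ₗ[ℂ] (Fin 4 → ℂ) := LinearMap.pi
    ![derL ρ (g1 (.of 0)), derL ρ (g1 (.of 1)), derL ρ (g2 (.of 1)), derL ρ (g2 (.of 2))]
  have hL : LinearMap.ker L = ⊥ := by
    rw [LinearMap.ker_eq_bot']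
    intro d hd
    exact inj d (congrFun hd 0) (congrFun hd 1) (congrFun hd 2) (congrFun hd 3)
  let F : Fin 5 → (FreeGroup ι →* Multiplicative ℤ) := ![ca, cb, cs, cp, kk]
  let v : Fin 5 → (ι → ℂ) := fun j i => ((F j (FreeGroup.of i)).toAdd : ℂ)
  have hv : LinearIndependent ℂ v := by
    rw [Fintype.linearIndependent_iff]
    intro c hc
    have E : ∀ x, ∑ j, c j * ((F j x).toAdd : ℂ) = 0 := by
      intro x
      have := congrArg (derL (R := ℂ) 1 x) hc
      simp only [map_sum, map_smul, map_zero, smul_eq_mul] at this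
      rw [← this]
      refine Finset.sum_congr rfl fun j _ => ?_
      rw [← derL_char (R := ℂ)]
    have E0 := E (g1 (.of 0))
    have E1 := E (g1 (.of 1))
    have E2 := E (g1 (.of 2))
    have E3 := E (g1 (.of 3))
    have E4 := E (g2 (.of 1))
    have E5 := E (g2 (.of 2))
    have s30 : (ca (g1 (.of 0))).toAdd = 0 := s3 0
    have s31 : (ca (g1 (.of 1))).toAdd = 1 := s3 1
    have s32 : (ca (g1 (.of 2))).toAdd = 1 := s3 2
    have s33 : (ca (g1 (.of 3))).toAdd = 0 := s3 3
    have s40 : (cb (g1 (.of 0))).toAdd = 1 := s4 0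
    have s41 : (cb (g1 (.of 1))).toAdd = 0 := s4 1
    have s42 : (cb (g1 (.of 2))).toAdd = 0 := s4 2
    have s43 : (cb (g1 (.of 3))).toAdd = 0 := s4 3
    simp only [Fin.sum_univ_five, F] at E0 E1 E2 E3 E4 E5
    simp [s10, s11, s12, s13, s20, s21, s22, s23, s30, s31, s32, s33, s40, s41, s42, s43, u0, u1, u2, u3] at E0 E1 E2 E3
    have c0 : c 0 = 0 := by linear_combination 3 * E2 - 2 * E1
    have c2 : c 2 = 0 := by linear_combination E1 - E2
    simp [t2, t4, u5, c0, E0] at E5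
    intro j
    fin_cases j
    · exact c0
    · exact E0
    · exact c2
    · exact E3
    · exact E5
  have := (hv.map' L hL).fintype_card_le_finrank
  simp at this

theorem part2_general {B : Type} [Group B] [IsFreeGroup B] (g1 g2 : F4 →* B) (p1 p2 : B →* F4)
    (h1 : ∀ x, p1 (g1 x) = x) (h2 : ∀ x, p2 (g2 x) = x)
    (hr : ∀ x, g1 (ff 0 1 x) = g2 (ff 1 3 x)) : False := by
  let H : Subgroup B := g1.range ⊔ g2.range
  let E : H ≃* FreeGroup (IsFreeGroup.Generators H) := IsFreeGroup.toFreeGroup H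
  have m1 : ∀ x, g1 x ∈ H := fun x => (le_sup_left : g1.range ≤ H) ⟨x, rfl⟩
  have m2 : ∀ x, g2 x ∈ H := fun x => (le_sup_right : g2.range ≤ H) ⟨x, rfl⟩
  refine part2 (E.toMonoidHom.comp (g1.codRestrict H m1)) (E.toMonoidHom.comp (g2.codRestrict H m2))
    ((p1.comp H.subtype).comp E.symm.toMonoidHom) ((p2.comp H.subtype).comp E.symm.toMonoidHom)
    ?_ ?_ ?_ ?_
  · intro x; simp [h1]
  · intro x; simp [h2]
  · intro x
    simp only [MonoidHom.comp_apply]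
    congr 1
    exact Subtype.ext (hr x)
  · intro S k1 k2
    have hH : H ≤ (S.comap E.toMonoidHom).map H.subtype := by
      refine sup_le ?_ ?_
      · rintro _ ⟨x, rfl⟩
        exact ⟨⟨g1 x, m1 x⟩, k1 x, rfl⟩
      · rintro _ ⟨x, rfl⟩
        exact ⟨⟨g2 x, m2 x⟩, k2 x, rfl⟩
    rw [eq_top_iff]
    intro y _
    obtain ⟨z, hz, hzy⟩ := hH (E.symm y).2
    have : z = E.symm y := Subtype.ext hzy
    rw [this] at hz
    simpa using hz

lemma nonabelian_free (n : ℕ) : Nonabelian (FreeGroup (Fin (n + 2))) := by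
  by_contra h
  unfold Nonabelian at h
  push Not at h
  have := free_comm_subsingleton h
  have := @Subsingleton.elim _ this (0 : Fin (n + 2)) 1
  simp at this

end FGA
/-- The `∀`-amalgamation property fails for finitely generated free groups: there are finitely
generated nonabelian free groups `A₀, A₁, A₂` and `∀`-embeddings `f₁ : A₀ → A₁`, `f₂ : A₀ → A₂`
that cannot be completed by `∀`-embeddings into any finitely generated free group.  In
particular, the class of finitely generated free groups is not a `∀`-Fraïssé class. -/
theorem fg_free_groups_not_forall_amalgamation :
    ∃ (A₀ A₁ A₂ : BGroup),
      (IsFreeGroup A₀ ∧ Group.FG A₀ ∧ Nonabelian A₀) ∧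
      (IsFreeGroup A₁ ∧ Group.FG A₁ ∧ Nonabelian A₁) ∧
      (IsFreeGroup A₂ ∧ Group.FG A₂ ∧ Nonabelian A₂) ∧
      ∃ (f₁ : A₀.carrier →* A₁.carrier) (f₂ : A₀.carrier →* A₂.carrier),
        IsForallEmbedding f₁ ∧ IsForallEmbedding f₂ ∧
        ¬ ∃ (B : BGroup), IsFreeGroup B ∧ Group.FG B ∧
            ∃ (g₁ : A₁.carrier →* B.carrier) (g₂ : A₂.carrier →* B.carrier),
              IsForallEmbedding g₁ ∧ IsForallEmbedding g₂ ∧ g₁.comp f₁ = g₂.comp f₂ := by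
  refine ⟨⟨FGA.F2⟩, ⟨FGA.F4⟩, ⟨FGA.F4⟩, ⟨?_, ?_, FGA.nonabelian_free 0⟩,
    ⟨?_, ?_, FGA.nonabelian_free 2⟩, ⟨?_, ?_, FGA.nonabelian_free 2⟩, FGA.ff 0 1, FGA.ff 1 3,
    FGA.forallEmbedding_of_separate _ (FGA.separate 0 1 one_ne_zero FGA.root01),
    FGA.forallEmbedding_of_separate _ (FGA.separate 1 3 three_ne_zero FGA.root13), ?_⟩
  · exact inferInstanceAs (IsFreeGroup FGA.F2)
  · exact inferInstanceAs (Group.FG FGA.F2)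
  · exact inferInstanceAs (IsFreeGroup FGA.F4)
  · exact inferInstanceAs (Group.FG FGA.F4)
  · exact inferInstanceAs (IsFreeGroup FGA.F4)
  · exact inferInstanceAs (Group.FG FGA.F4)
  · rintro ⟨B, hB, -, g1, g2, h1, h2, hr⟩
    obtain ⟨p1, hp1⟩ := FGA.exists_retraction g1 h1
    obtain ⟨p2, hp2⟩ := FGA.exists_retraction g2 h2
    exact FGA.part2_general g1 g2 p1 p2 hp1 hp2 (fun x => DFunLike.congr_fun hr x)
end
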